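/- Let X be a compact metric space, T : X → X a surjective continuous (non-invertible) map, f ∈ C(X,ℝ), and μ an ergodic T-invariant Borel probability measure with h_μ(T) > 0. Then for μ-almost every x ∈ X there exists a closed subset E(x) ⊆ closure(W^s(x,T)) such that P(T,f,E(x)) ≥ P_μ(T,f) and E(x) is a weakly mixing set for T. -/

import Mathlib

open Filter Set Topology MeasureTheory

noncomputable section

variable {X : Type*}

/-- Birkhoff sum `f_n(x) = ∑_{j<n} f(T^j x)`. -/
def birk (T : X → X) (f : X → ℝ) (n : ℕ) (x : X) : ℝ :=
  ∑ j ∈ Finset.range n, f (T^[j] x)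

/-- `P_n(T,f,δ,K)`: supremum of `∑_{x∈E} exp f_n(x)` over `(n,δ)`-separated
subsets `E ⊆ K`. -/
def sepPn [MetricSpace X] (T : X → X) (f : X → ℝ) (n : ℕ) (δ : ℝ) (K : Set X) : ℝ :=
  sSup { r : ℝ | ∃ E : Finset X, ↑E ⊆ K ∧
    (∀ x ∈ E, ∀ y ∈ E, x ≠ y → ∃ i < n, δ < dist (T^[i] x) (T^[i] y)) ∧
    r = ∑ x ∈ E, Real.exp (birk T f n x) }

/-- The topological pressure of `T` for the subset `K`:
`P(T,f,K) = lim_{δ→0} limsup_n (1/n) log P_n(T,f,δ,K)`; since the expression is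
nonincreasing in `δ`, the limit is the supremum over `δ > 0`. -/
def pres [MetricSpace X] (T : X → X) (f : X → ℝ) (K : Set X) : EReal :=
  ⨆ (δ : ℝ) (_ : 0 < δ), atTop.limsup fun n : ℕ =>
    ((Real.log (sepPn T f n δ K) / n : ℝ) : EReal)

/-- The `ε`-stable set `W^s_ε(x,T)`. -/
def epsStable [MetricSpace X] (T : X → X) (ε : ℝ) (x : X) : Set X :=
  { y | ∀ n : ℕ, dist (T^[n] x) (T^[n] y) ≤ ε }

/-- The topological pressure of the preimages of the `ε`-stable set of `x`:
`P_s(T,f,x,ε) = lim_{δ→0} limsup_n (1/n) log P_n(T,f,δ,T^{-n}W^s_ε(x,T))`. -/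
def Ps [MetricSpace X] (T : X → X) (f : X → ℝ) (x : X) (ε : ℝ) : EReal :=
  ⨆ (δ : ℝ) (_ : 0 < δ), atTop.limsup fun n : ℕ =>
    ((Real.log (sepPn T f n δ ((T^[n]) ⁻¹' epsStable T ε x)) / n : ℝ) : EReal)

/-- A finite open cover of `X`. -/
def IsOpenCover [TopologicalSpace X] (𝒰 : Finset (Set X)) : Prop :=
  (∀ U ∈ 𝒰, IsOpen U) ∧ ⋃₀ (𝒰 : Set (Set X)) = univ

/-- A finite Borel cover of `X`. -/
def IsBorelCover [MeasurableSpace X] (𝒱 : Finset (Set X)) : Prop :=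
  (∀ V ∈ 𝒱, MeasurableSet V) ∧ ⋃₀ (𝒱 : Set (Set X)) = univ

/-- `𝒱` refines the iterated cover `𝒰_0^{n-1} = ⋁_{i<n} T^{-i}𝒰`. -/
def RefinesIter (T : X → X) (𝒰 : Finset (Set X)) (n : ℕ) (𝒱 : Finset (Set X)) : Prop :=
  ∀ V ∈ 𝒱, ∃ g : Fin n → Set X, (∀ i, g i ∈ 𝒰) ∧ V ⊆ ⋂ i : Fin n, (T^[(i : ℕ)]) ⁻¹' g i

/-- `P_n(T,f,𝒰,K)`: infimum over finite Borel covers `𝒱` refining `𝒰_0^{n-1}` of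
`∑_{V∈𝒱} sup_{x ∈ V∩K} exp f_n(x)` (an empty summand contributes `0`, which is
`Real.sSup ∅`). -/
def covPn [MeasurableSpace X] (T : X → X) (f : X → ℝ) (𝒰 : Finset (Set X)) (n : ℕ)
    (K : Set X) : ℝ :=
  sInf { r : ℝ | ∃ 𝒱 : Finset (Set X), IsBorelCover 𝒱 ∧ RefinesIter T 𝒰 n 𝒱 ∧
    r = ∑ V ∈ 𝒱, sSup ((fun x => Real.exp (birk T f n x)) '' (V ∩ K)) }

/-- A finite Borel partition of `X`. -/
def IsFinPartition [MeasurableSpace X] (α : Finset (Set X)) : Prop :=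
  (∀ A ∈ α, MeasurableSet A) ∧ ⋃₀ (α : Set (Set X)) = univ ∧
    (α : Set (Set X)).Pairwise Disjoint

/-- `H_μ(⋁_{i<n} T^{-i}α)`, computed over all atoms `⋂_{i<n} T^{-i} A_i`. -/
def dynH [MeasurableSpace X] (μ : Measure X) (T : X → X) (α : Finset (Set X)) (n : ℕ) : ℝ :=
  ∑ g : Fin n → α, Real.negMulLog ((μ (⋂ i : Fin n, (T^[(i : ℕ)]) ⁻¹' (g i : Set X))).toReal)

/-- `h_μ(T,α) = lim_n (1/n) H_μ(α_0^{n-1})`, which for an invariant measure equals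
the infimum of `(1/n) H_μ(α_0^{n-1})` over `n ≥ 1`. -/
def entPart [MeasurableSpace X] (μ : Measure X) (T : X → X) (α : Finset (Set X)) : ℝ :=
  ⨅ n : ℕ, dynH μ T α (n + 1) / (n + 1 : ℝ)

/-- The measure-theoretic entropy `h_μ(T)`. -/
def mEnt [MeasurableSpace X] (μ : Measure X) (T : X → X) : EReal :=
  ⨆ (α : Finset (Set X)) (_ : IsFinPartition α), ((entPart μ T α : ℝ) : EReal)

/-- The measure-theoretic pressure `P_μ(T,f) = h_μ(T) + ∫ f dμ`. -/
def mPres [MeasurableSpace X] (μ : Measure X) (T : X → X) (f : X → ℝ) : EReal :=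
  mEnt μ T + ((∫ x, f x ∂μ : ℝ) : EReal)

/-- The stable set `W^s(x,T)`. -/
def stableSet [MetricSpace X] (T : X → X) (x : X) : Set X :=
  { y | Tendsto (fun n : ℕ => dist (T^[n] x) (T^[n] y)) atTop (𝓝 0) }

/-- A Cantor set: a nonempty compact perfect totally disconnected set. -/
def IsCantorSet [TopologicalSpace X] (C : Set X) : Prop :=
  C.Nonempty ∧ IsCompact C ∧ Perfect C ∧ IsTotallyDisconnected C

/-- A weakly mixing set for `T`. -/
def IsWeaklyMixingSet [TopologicalSpace X] (T : X → X) (A : Set X) : Prop :=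
  A.Nonempty ∧ IsClosed A ∧
  ∃ B : Set X, B ⊆ A ∧
    (∃ C : ℕ → Set X, (∀ n, IsCantorSet (C n)) ∧ B = ⋃ n, C n) ∧
    closure B = A ∧
    ∀ C : Set X, C ⊆ B → IsCantorSet C →
      ∀ g : C → X, Continuous g → (∀ c : C, g c ∈ A) →
        ∃ φ : ℕ → ℕ, StrictMono φ ∧
          ∀ c : C, Tendsto (fun i => T^[φ i] (c : X)) atTop (𝓝 (g c))

/-- Translate the second coordinate of a finite set of pairs by `j`. -/
def timeShift (j : ℕ) (S : Finset (ℕ × ℕ)) : Finset (ℕ × ℕ) :=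
  S.image fun p => (p.1, p.2 + j)

/-- The rectangle `[0,k) × [a,b)`. -/
def timeBlock (k a b : ℕ) : Finset (ℕ × ℕ) := Finset.range k ×ˢ Finset.Ico a b

/-- A monotone submodular set function which is invariant under time translation. -/
structure IsShiftPolymatroid (H : Finset (ℕ × ℕ) → ℝ) : Prop where
  empty : H ∅ = 0
  mono : ∀ {S S'}, S ⊆ S' → H S ≤ H S'
  submod : ∀ S S', H (S ∪ S') + H (S ∩ S') ≤ H S + H S'
  shift_one : ∀ S, H (timeShift 1 S) = H S

/-- The growth rate of a shift polymatroid along the first `k` rows. -/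
def polyRate (H : Finset (ℕ × ℕ) → ℝ) (k : ℕ) : ℝ :=
  ⨅ n : ℕ, H (timeBlock k 0 (n + 1)) / (n + 1 : ℝ)

lemma mem_timeBlock {k a b : ℕ} {p : ℕ × ℕ} :
    p ∈ timeBlock k a b ↔ p.1 < k ∧ a ≤ p.2 ∧ p.2 < b := by
  simp [timeBlock]

lemma mem_timeShift {j : ℕ} {S : Finset (ℕ × ℕ)} {p : ℕ × ℕ} :
    p ∈ timeShift j S ↔ j ≤ p.2 ∧ (p.1, p.2 - j) ∈ S := by
  simp only [timeShift, Finset.mem_image, Prod.exists]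
  constructor
  · rintro ⟨a, b, h, rfl⟩
    simpa using h
  · rintro ⟨h1, h2⟩
    exact ⟨_, _, h2, by ext <;> simp; omega⟩

lemma timeShift_union (j : ℕ) (S S' : Finset (ℕ × ℕ)) :
    timeShift j (S ∪ S') = timeShift j S ∪ timeShift j S' := Finset.image_union _ _

lemma timeShift_timeBlock (j k a b : ℕ) :
    timeShift j (timeBlock k a b) = timeBlock k (a + j) (b + j) := by
  ext p
  simp only [mem_timeShift, mem_timeBlock]
  omega

lemma timeShift_add (i j : ℕ) (S : Finset (ℕ × ℕ)) :
    timeShift i (timeShift j S) = timeShift (i + j) S := by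
  ext p
  simp only [mem_timeShift]
  constructor
  · rintro ⟨h1, h2, h3⟩
    exact ⟨by omega, by rwa [Nat.sub_sub] at h3⟩
  · rintro ⟨h1, h2⟩
    exact ⟨by omega, by omega, by rwa [Nat.sub_sub]⟩

namespace IsShiftPolymatroid

variable {H : Finset (ℕ × ℕ) → ℝ}

lemma shift (hH : IsShiftPolymatroid H) (j : ℕ) (S : Finset (ℕ × ℕ)) :
    H (timeShift j S) = H S := by
  induction j with
  | zero => congr 1; ext p; simp [mem_timeShift]
  | succ j ih => rw [add_comm, ← timeShift_add, hH.shift_one, ih]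

lemma nonneg (hH : IsShiftPolymatroid H) (S : Finset (ℕ × ℕ)) : 0 ≤ H S := by
  rw [← hH.empty]; exact hH.mono (by simp)

lemma cond_anti (hH : IsShiftPolymatroid H) {B B' : Finset (ℕ × ℕ)} (W : Finset (ℕ × ℕ))
    (h : B ⊆ B') : H (W ∪ B') - H B' ≤ H (W ∪ B) - H B := by
  have h1 := hH.submod B' (W ∪ B)
  have h2 : B' ∪ (W ∪ B) = W ∪ B' := by
    ext p; simp only [Finset.mem_union]; have := @h p; tauto
  have h3 : H B ≤ H (B' ∩ (W ∪ B)) := hH.mono fun p hp => by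
    simp [h hp, hp]
  rw [h2] at h1
  linarith

lemma cond_anti' (hH : IsShiftPolymatroid H) {B B' V V' : Finset (ℕ × ℕ)} (W : Finset (ℕ × ℕ))
    (h : B ⊆ B') (hV : V = W ∪ B) (hV' : V' = W ∪ B') : H V' - H B' ≤ H V - H B := by
  subst hV hV'; exact hH.cond_anti W h

lemma polyRate_le (hH : IsShiftPolymatroid H) (k n : ℕ) :
    n * polyRate H k ≤ H (timeBlock k 0 n) := by
  rcases n with _ | n
  · simpa using hH.nonneg _
  · have : polyRate H k ≤ H (timeBlock k 0 (n + 1)) / (n + 1 : ℝ) :=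
      ciInf_le ⟨0, by rintro _ ⟨m, rfl⟩; exact div_nonneg (hH.nonneg _) (by positivity)⟩ n
    rw [le_div_iff₀ (by positivity)] at this
    push_cast
    linarith

lemma exists_lt_polyRate (k : ℕ) {ε : ℝ} (hε : 0 < ε) :
    ∃ n : ℕ, 0 < n ∧ H (timeBlock k 0 n) < n * (polyRate H k + ε) := by
  obtain ⟨n, hn⟩ := exists_lt_of_ciInf_lt (show polyRate H k < polyRate H k + ε by linarith)
  refine ⟨n + 1, by omega, ?_⟩
  rw [div_lt_iff₀ (by positivity)] at hn
  push_cast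
  linarith

lemma increment_anti (hH : IsShiftPolymatroid H) (k : ℕ) :
    Antitone fun L => H (timeBlock k 0 (L + 1)) - H (timeBlock k 0 L) := by
  refine antitone_nat_of_succ_le fun L => ?_
  have h := hH.cond_anti (B := timeBlock k 1 (L + 1)) (B' := timeBlock k 1 (L + 1 + 1))
    (timeBlock k 0 1) (fun p => by simp only [mem_timeBlock]; omega)
  have e : ∀ L, timeBlock k 0 1 ∪ timeBlock k 1 (L + 1) = timeBlock k 0 (L + 1) := fun L => by
    ext p; simp only [mem_timeBlock, Finset.mem_union]; omega
  have e' : ∀ L, H (timeBlock k 1 (L + 1)) = H (timeBlock k 0 L) := fun L => by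
    rw [← hH.shift 1 (timeBlock k 0 L), timeShift_timeBlock, zero_add]
  rw [e, e, e', e'] at h
  exact h

lemma polyRate_le_increment (hH : IsShiftPolymatroid H) (k L : ℕ) :
    polyRate H k ≤ H (timeBlock k 0 (L + 1)) - H (timeBlock k 0 L) := by
  by_contra! hlt
  set r := H (timeBlock k 0 (L + 1)) - H (timeBlock k 0 L) with hr
  have h1 : ∀ n : ℕ, H (timeBlock k 0 (L + n)) ≤ H (timeBlock k 0 L) + n * r := by
    intro n
    induction n with
    | zero => simp
    | succ n ih =>
      have := hH.increment_anti k (show L ≤ L + n by omega)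
      simp only [← hr] at this
      push_cast
      rw [← add_assoc]
      linarith
  obtain ⟨n, hn⟩ := exists_nat_gt ((H (timeBlock k 0 L) - L * polyRate H k) / (polyRate H k - r))
  rw [div_lt_iff₀ (by linarith)] at hn
  have h2 := hH.polyRate_le k (L + n)
  have h3 := h1 n
  push_cast at h2
  nlinarith

lemma exists_increment_le (hH : IsShiftPolymatroid H) (k : ℕ) {ε : ℝ} (hε : 0 < ε) :
    ∃ L : ℕ, ∀ M ≥ L, H (timeBlock k 0 (M + 1)) - H (timeBlock k 0 M) ≤ polyRate H k + ε := by
  obtain ⟨n, hn0, hn⟩ := exists_lt_polyRate (H := H) k hε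
  by_contra! hcon
  have h0 : ∀ L, polyRate H k + ε < H (timeBlock k 0 (L + 1)) - H (timeBlock k 0 L) := fun L => by
    obtain ⟨M, hM, h⟩ := hcon L
    exact h.trans_le (hH.increment_anti k hM)
  have h1 : ∀ n : ℕ, n * (polyRate H k + ε) ≤ H (timeBlock k 0 n) := by
    intro n
    induction n with
    | zero => simpa using hH.nonneg _
    | succ n ih => have := h0 n; push_cast; linarith
  linarith [h1 n]

/-- The columns `[a,n)` of `k` rows, given a set whose increments dominate, gain at least the
sum of the increments. -/
lemma block_increment_ge (k n : ℕ) (c : ℝ) (V : Finset (ℕ × ℕ))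
    (h : ∀ j < n, c ≤ H (timeBlock k j n ∪ V) - H (timeBlock k (j + 1) n ∪ V)) :
    n * c ≤ H (timeBlock k 0 n ∪ V) - H V := by
  have h1 : ∀ m ≤ n, m * c ≤ H (timeBlock k 0 n ∪ V) - H (timeBlock k m n ∪ V) := by
    intro m hm
    induction m with
    | zero => simp
    | succ m ih =>
      have := ih (by omega)
      have := h m (by omega)
      push_cast
      linarith
  have h2 : timeBlock k n n ∪ V = V := by
    ext p; simp only [mem_timeBlock, Finset.mem_union]; constructor
    · rintro (h | h)
      · omega
      · exact h
    · exact Or.inr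
  simpa [h2] using h1 n le_rfl

lemma block_increment_le (k n : ℕ) (c : ℝ) (V : Finset (ℕ × ℕ))
    (h : ∀ j < n, H (timeBlock k j n ∪ V) - H (timeBlock k (j + 1) n ∪ V) ≤ c) :
    H (timeBlock k 0 n ∪ V) - H V ≤ n * c := by
  have h1 : ∀ m ≤ n, H (timeBlock k 0 n ∪ V) - H (timeBlock k m n ∪ V) ≤ m * c := by
    intro m hm
    induction m with
    | zero => simp
    | succ m ih =>
      have := ih (by omega)
      have := h m (by omega)
      push_cast
      linarith
  have h2 : timeBlock k n n ∪ V = V := by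
    ext p; simp only [mem_timeBlock, Finset.mem_union]; constructor
    · rintro (h | h)
      · omega
      · exact h
    · exact Or.inr
  simpa [h2] using h1 n le_rfl

/-- Coarse rows on `[1,l)` and finer rows on `[l,L)`. -/
abbrev mixedFuture (k l L : ℕ) : Finset (ℕ × ℕ) := timeBlock k 1 l ∪ timeBlock (k + 1) l L

lemma mixedFuture_shift (hH : IsShiftPolymatroid H) (k n M j : ℕ) (hj : j < n) (hM : n ≤ M) :
    H (timeBlock k j n ∪ timeBlock (k + 1) n M) - H (timeBlock k (j + 1) n ∪ timeBlock (k + 1) n M) =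
      H (timeBlock k 0 1 ∪ mixedFuture k (n - j) (M - j)) - H (mixedFuture k (n - j) (M - j)) := by
  rw [← hH.shift j (timeBlock k 0 1 ∪ mixedFuture k (n - j) (M - j)),
    ← hH.shift j (mixedFuture k (n - j) (M - j))]
  simp only [timeShift_union, timeShift_timeBlock]
  congr 2
  · ext p; simp only [mem_timeBlock, Finset.mem_union]; omega
  · ext p; simp only [mem_timeBlock, Finset.mem_union]; omega

/-- A far finer future carries almost no information about the present. -/
lemma exists_mixedFuture (hH : IsShiftPolymatroid H) (k : ℕ) {δ : ℝ} (hδ : 0 < δ) :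
    ∃ l₀, ∀ l ≥ l₀, ∀ L ≥ l, polyRate H k - δ ≤
      H (timeBlock k 0 1 ∪ mixedFuture k l L) - H (mixedFuture k l L) := by
  suffices hs : ∃ l₀, ∀ L ≥ l₀, polyRate H k - δ ≤
      H (timeBlock k 0 1 ∪ mixedFuture k l₀ L) - H (mixedFuture k l₀ L) by
    obtain ⟨l₀, hl₀⟩ := hs
    refine ⟨l₀, fun l hl L hL => (hl₀ L (by omega)).trans ?_⟩
    exact hH.cond_anti _ fun p => by
      simp only [mem_timeBlock, Finset.mem_union]; omega
  by_contra! hcon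
  choose L hL hlt using hcon
  obtain ⟨n, hn0, hn⟩ := exists_lt_polyRate (H := H) (k + 1) hδ
  set M := n + ∑ l ∈ Finset.range (n + 1), L l with hMdef
  have hLM : ∀ l ≤ n, L l + (n - l) ≤ M := fun l hl => by
    have := Finset.single_le_sum (f := L) (fun i _ => Nat.zero_le _)
      (Finset.mem_range.2 (by omega : l < n + 1))
    omega
  have hup : H (timeBlock k 0 n ∪ timeBlock (k + 1) n M) - H (timeBlock (k + 1) n M) ≤
      n * (polyRate H k - δ) := by
    refine block_increment_le k n _ _ fun j hj => ?_
    rw [hH.mixedFuture_shift k n M j hj (by omega)]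
    refine le_trans ?_ (hlt (n - j)).le
    have h1 := hLM (n - j) (by omega)
    have h2 := hL (n - j)
    exact hH.cond_anti _ fun p => by
      simp only [mem_timeBlock, Finset.mem_union]; omega
  have hlow : n * polyRate H (k + 1) ≤
      H (timeBlock (k + 1) 0 n ∪ timeBlock (k + 1) n M) - H (timeBlock (k + 1) n M) := by
    refine block_increment_ge (k + 1) n _ _ fun j hj => ?_
    refine (hH.polyRate_le_increment (k + 1) (M - j - 1)).trans (le_of_eq ?_)
    rw [← hH.shift j (timeBlock (k + 1) 0 (M - j - 1 + 1)),
      ← hH.shift (j + 1) (timeBlock (k + 1) 0 (M - j - 1))]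
    simp only [timeShift_timeBlock]
    congr 2
    · ext p; simp only [mem_timeBlock, Finset.mem_union]; omega
    · ext p; simp only [mem_timeBlock, Finset.mem_union]; omega
  have hsub := hH.cond_anti' (B := timeBlock k 0 n)
    (B' := timeBlock k 0 n ∪ timeBlock (k + 1) n M)
    (V := timeBlock (k + 1) 0 n) (V' := timeBlock (k + 1) 0 n ∪ timeBlock (k + 1) n M)
    (timeBlock (k + 1) 0 n) Finset.subset_union_left
    (by ext p; simp only [mem_timeBlock, Finset.mem_union]; omega)
    (by ext p; simp only [mem_timeBlock, Finset.mem_union]; omega)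
  have h3 := hH.polyRate_le k n
  nlinarith

/-- The information that a sufficiently remote future of `k+1` rows carries about the first `n`
columns of `k` rows is at most `ε`. -/
lemma exists_remote (hH : IsShiftPolymatroid H) (k n : ℕ) {ε : ℝ} (hε : 0 < ε) :
    ∃ N > n, ∀ L ≥ N,
      (H (timeBlock k 0 N) - H (timeBlock k n N)) -
        (H (timeBlock k 0 N ∪ timeBlock (k + 1) N L) -
          H (timeBlock k n N ∪ timeBlock (k + 1) N L)) ≤ ε := by
  have hδ : 0 < ε / (2 * (n + 1)) := by positivity
  obtain ⟨l₀, hl₀⟩ := hH.exists_mixedFuture k hδ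
  obtain ⟨l₁, hl₁⟩ := hH.exists_increment_le k hδ
  refine ⟨n + l₀ + l₁ + 1, by omega, fun L hL => ?_⟩
  set N := n + l₀ + l₁ + 1 with hN
  have h1 : H (timeBlock k 0 n ∪ timeBlock k n N) - H (timeBlock k n N) ≤
      n * (polyRate H k + ε / (2 * (n + 1))) := by
    refine block_increment_le k n _ _ fun j hj => ?_
    refine le_trans (le_of_eq ?_) (hl₁ (N - j - 1) (by omega))
    rw [← hH.shift j (timeBlock k 0 (N - j - 1 + 1)),
      ← hH.shift (j + 1) (timeBlock k 0 (N - j - 1))]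
    simp only [timeShift_timeBlock]
    congr 2
    · ext p; simp only [mem_timeBlock, Finset.mem_union]; omega
    · ext p; simp only [mem_timeBlock, Finset.mem_union]; omega
  have h2 : n * (polyRate H k - ε / (2 * (n + 1))) ≤
      H (timeBlock k 0 n ∪ (timeBlock k n N ∪ timeBlock (k + 1) N L)) -
        H (timeBlock k n N ∪ timeBlock (k + 1) N L) := by
    refine block_increment_ge k n _ _ fun j hj => ?_
    refine (hl₀ (N - j) (by omega) (L - j) (by omega)).trans ?_
    rw [← hH.mixedFuture_shift k N L j (by omega) (by omega)]
    refine le_of_eq ?_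
    congr 2
    · ext p; simp only [mem_timeBlock, Finset.mem_union]; omega
    · ext p; simp only [mem_timeBlock, Finset.mem_union]; omega
  have e1 : timeBlock k 0 n ∪ timeBlock k n N = timeBlock k 0 N := by
    ext p; simp only [mem_timeBlock, Finset.mem_union]; omega
  have e2 : timeBlock k 0 n ∪ (timeBlock k n N ∪ timeBlock (k + 1) N L) =
      timeBlock k 0 N ∪ timeBlock (k + 1) N L := by
    ext p; simp only [mem_timeBlock, Finset.mem_union]; omega
  rw [e1] at h1
  rw [e2] at h2
  have h3 : n * (ε / (2 * (n + 1))) ≤ ε / 2 := by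
    rw [mul_div_assoc', div_le_div_iff₀ (by positivity) (by positivity)]
    nlinarith
  linarith

lemma exists_times (hH : IsShiftPolymatroid H) :
    ∃ τ : ℕ → ℕ, StrictMono τ ∧ 1 ≤ τ 0 ∧ ∀ J, ∀ L ≥ τ (J + 1),
      (H (timeBlock J 0 (τ (J + 1))) - H (timeBlock J (τ J) (τ (J + 1)))) -
        (H (timeBlock J 0 (τ (J + 1)) ∪ timeBlock (J + 1) (τ (J + 1)) L) -
          H (timeBlock J (τ J) (τ (J + 1)) ∪ timeBlock (J + 1) (τ (J + 1)) L)) ≤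
        (1 / 2 : ℝ) ^ J := by
  choose N hN hN' using fun k n => hH.exists_remote k n (ε := (1 / 2 : ℝ) ^ k) (by positivity)
  let τ : ℕ → ℕ := fun J => Nat.rec 1 (fun J n => N J n) J
  exact ⟨τ, strictMono_nat_of_lt_succ fun J => hN J (τ J), le_rfl, fun J L hL => hN' J (τ J) L hL⟩

/-- Row `i < J` from time `1` (if `i < k`) or from `τ (i+1)` on, up to time `L`. -/
def staircase (τ : ℕ → ℕ) (k J L : ℕ) : Finset (ℕ × ℕ) :=
  (timeBlock J 1 L).filter fun p => p.1 < k ∨ τ (p.1 + 1) ≤ p.2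

/-- There are starting times `m i` for the rows so that the columns of the first `k` rows keep
their rate given the whole remote staircase, up to an error tending to `0` with `k`. -/
theorem exists_staircase (hH : IsShiftPolymatroid H) :
    ∃ m : ℕ → ℕ, ∀ k n : ℕ, ∀ S' : Finset (ℕ × ℕ), (∀ p ∈ S', m p.1 + n ≤ p.2) →
      n * (polyRate H k - 2 * (1 / 2 : ℝ) ^ k) ≤ H (timeBlock k 0 n ∪ S') - H S' := by
  obtain ⟨τ, hτ, hτ0, hbound⟩ := hH.exists_times
  have hτ1 : ∀ J, 1 ≤ τ J := fun J => hτ0.trans (hτ.monotone (Nat.zero_le J))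
  have hstair : ∀ k d L, τ (k + d) ≤ L →
      polyRate H k - 2 * (1 / 2 : ℝ) ^ k + 2 * (1 / 2 : ℝ) ^ (k + d) ≤
        H (timeBlock k 0 1 ∪ staircase τ k (k + d) L) - H (staircase τ k (k + d) L) := by
    intro k d
    induction d with
    | zero =>
      intro L hL
      have h1 := hτ1 (k + 0)
      have := hH.polyRate_le_increment k (L - 1)
      rw [← hH.shift 1 (timeBlock k 0 (L - 1)), timeShift_timeBlock] at this
      have e1 : timeBlock k 0 1 ∪ staircase τ k (k + 0) L = timeBlock k 0 (L - 1 + 1) := by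
        ext p; simp only [staircase, mem_timeBlock, Finset.mem_union, Finset.mem_filter]; omega
      have e2 : staircase τ k (k + 0) L = timeBlock k (0 + 1) (L - 1 + 1) := by
        ext p; simp only [staircase, mem_timeBlock, Finset.mem_filter]; omega
      rw [e1, e2]
      simpa using this
    | succ d ih =>
      intro L hL
      rw [← add_assoc] at hL ⊢
      set J := k + d with hJ
      set N := τ (J + 1) with hN
      have hNJ : τ J < N := hτ (Nat.lt_succ_self J)
      have hJ1 := hτ1 J
      have hi := ih N hNJ.le
      have hb := hbound J L hL
      rw [← hN] at hb
      have hmono : ∀ i, i < J → τ (i + 1) ≤ τ J := fun i hi => hτ.monotone hi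
      have hmono' : ∀ i, i < J + 1 → τ (i + 1) ≤ N := fun i hi => hτ.monotone (by omega)
      have e1 : staircase τ k (J + 1) L = staircase τ k J N ∪ timeBlock (J + 1) N L := by
        ext p
        simp only [staircase, mem_timeBlock, Finset.mem_union, Finset.mem_filter]
        have h1 := hmono' p.1
        constructor
        · rintro ⟨⟨h2, h3, h4⟩, h5⟩
          by_cases h6 : p.2 < N
          · left
            refine ⟨⟨?_, h3, h6⟩, h5⟩
            by_contra h7
            have h8 : p.1 = J := by omega
            rw [h8] at h5
            omega
          · right; omega
        · rintro (⟨⟨h2, h3, h4⟩, h5⟩ | ⟨h2, h3, h4⟩)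
          · exact ⟨⟨by omega, h3, by omega⟩, h5⟩
          · exact ⟨⟨h2, by omega, h4⟩, Or.inr ((h1 h2).trans h3)⟩
      have m1 := hH.cond_anti (B := timeBlock k 0 1 ∪ staircase τ k J N) (B' := timeBlock J 0 N)
        (timeBlock (J + 1) N L) (fun p => by
          simp only [staircase, mem_timeBlock, Finset.mem_union, Finset.mem_filter]; omega)
      have m2 := hH.cond_anti (B := timeBlock J (τ J) N) (B' := staircase τ k J N)
        (timeBlock (J + 1) N L) (fun p => by
          simp only [staircase, mem_timeBlock, Finset.mem_filter]
          have := hmono p.1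
          omega)
      have e2 : timeBlock k 0 1 ∪ staircase τ k (J + 1) L =
          timeBlock (J + 1) N L ∪ (timeBlock k 0 1 ∪ staircase τ k J N) := by
        rw [e1]; ext p; simp only [Finset.mem_union]; tauto
      rw [e2, e1, Finset.union_comm (staircase τ k J N)]
      rw [Finset.union_comm (timeBlock J 0 N), Finset.union_comm (timeBlock J (τ J) N)] at hb
      have hpow : (1 / 2 : ℝ) ^ (J + 1) = (1 / 2) ^ J / 2 := by rw [pow_succ]; ring
      rw [hpow]
      linarith
  have hcol : ∀ k, ∀ S' : Finset (ℕ × ℕ), (∀ p ∈ S', (p.1 < k ∧ 1 ≤ p.2) ∨ τ (p.1 + 1) ≤ p.2) →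
      polyRate H k - 2 * (1 / 2 : ℝ) ^ k ≤ H (timeBlock k 0 1 ∪ S') - H S' := by
    intro k S' hS'
    obtain ⟨D, hD⟩ : ∃ D, ∀ p ∈ S', p.1 < D ∧ p.2 < D :=
      ⟨∑ p ∈ S', (p.1 + p.2 + 1), fun p hp => by
        have := Finset.single_le_sum (f := fun p : ℕ × ℕ => p.1 + p.2 + 1)
          (fun i _ => Nat.zero_le _) hp
        omega⟩
    have h1 := hstair k D (τ (k + D) + D) (by omega)
    have h2 : S' ⊆ staircase τ k (k + D) (τ (k + D) + D) := fun p hp => by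
      have h3 := hS' p hp
      have h4 := hD p hp
      have h5 := hτ1 (p.1 + 1)
      simp only [staircase, mem_timeBlock, Finset.mem_filter]
      omega
    have h3 := hH.cond_anti (timeBlock k 0 1) h2
    have h4 : (0 : ℝ) ≤ 2 * (1 / 2 : ℝ) ^ (k + D) := by positivity
    linarith
  refine ⟨fun i => τ (i + 1), fun k n => ?_⟩
  induction n with
  | zero =>
    intro S' _
    have e : timeBlock k 0 0 ∪ S' = S' := by
      ext p; simp [mem_timeBlock]
    simp [e]
  | succ n ih =>
    intro S' hS'
    obtain ⟨S'', rfl⟩ : ∃ S'', S' = timeShift 1 S'' :=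
      ⟨S'.image fun p => (p.1, p.2 - 1), by
        ext p
        simp only [mem_timeShift, Finset.mem_image, Prod.exists, Prod.mk.injEq]
        constructor
        · intro hp
          have := hS' p hp
          exact ⟨by omega, p.1, p.2, hp, rfl, rfl⟩
        · rintro ⟨h1, a, b, hab, rfl, h2⟩
          have := hS' _ hab
          simp only at this
          have : b = p.2 := by omega
          rwa [this] at hab⟩
    have hS'' : ∀ p ∈ S'', τ (p.1 + 1) + n ≤ p.2 := fun p hp => by
      have := hS' (p.1, p.2 + 1) (by simp [mem_timeShift, hp])
      simp only at this
      omega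
    have h1 := ih S'' hS''
    have h2 := hcol k (timeShift 1 (timeBlock k 0 n ∪ S'')) (fun p hp => by
      simp only [mem_timeShift, Finset.mem_union, mem_timeBlock] at hp
      rcases hp with ⟨h3, h4 | h4⟩
      · omega
      · have h5 : τ (p.1 + 1) + n ≤ p.2 - 1 := hS'' _ h4
        omega)
    rw [hH.shift] at h2
    rw [hH.shift]
    have e : timeBlock k 0 1 ∪ timeShift 1 (timeBlock k 0 n ∪ S'') =
        timeBlock k 0 (n + 1) ∪ timeShift 1 S'' := by
      rw [timeShift_union, timeShift_timeBlock]
      ext p; simp only [Finset.mem_union, mem_timeBlock]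
      constructor
      · rintro (h | h | h)
        · left; omega
        · left; omega
        · exact Or.inr h
      · rintro (h | h)
        · by_cases h0 : p.2 = 0
          · left; omega
          · right; left; omega
        · exact Or.inr (Or.inr h)
    rw [e] at h2
    push_cast
    linarith

end IsShiftPolymatroid

/-- The Shannon entropy of a random variable with values in a finite type. -/
def rvEnt {X ι : Type*} [MeasurableSpace X] [Fintype ι] (ν : Measure X) (Y : X → ι) : ℝ :=
  ∑ i, Real.negMulLog (ν.real (Y ⁻¹' {i}))

section RandomVariables

variable {X ι κ α β γ : Type*} [MeasurableSpace X]
  [Fintype ι] [MeasurableSpace ι] [MeasurableSingletonClass ι]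
  [Fintype κ] [Fintype α] [MeasurableSpace α] [MeasurableSingletonClass α]
  [Fintype β] [MeasurableSpace β] [MeasurableSingletonClass β]
  [Fintype γ] [MeasurableSpace γ] [MeasurableSingletonClass γ]
  {ν : Measure X} [IsProbabilityMeasure ν]

lemma rvEnt_nonneg (Y : X → ι) : 0 ≤ rvEnt ν Y :=
  Finset.sum_nonneg fun _ _ => Real.negMulLog_nonneg measureReal_nonneg measureReal_le_one

open Classical in
lemma measureReal_preimage_eq_sum {Z : X → ι} (hZ : Measurable Z) (s : Set ι) :
    ν.real (Z ⁻¹' s) = ∑ i, if i ∈ s then ν.real (Z ⁻¹' {i}) else 0 := by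
  rw [← Finset.sum_filter, ← measureReal_biUnion_finset]
  · congr 1; ext x; simp
  · intro i _ j _ hij
    exact Disjoint.preimage _ (by simpa using hij)
  · intro i _
    exact hZ (measurableSet_singleton i)

lemma sum_measureReal_preimage {Z : X → ι} (hZ : Measurable Z) :
    ∑ i, ν.real (Z ⁻¹' {i}) = 1 := by
  classical
  have := measureReal_preimage_eq_sum (ν := ν) hZ univ
  simpa using this.symm

lemma rvEnt_comp {Z : X → ι} (hZ : Measurable Z) (f : ι → κ) :
    rvEnt ν (f ∘ Z) =
      ∑ i, -(ν.real (Z ⁻¹' {i}) * Real.log (ν.real (f ∘ Z ⁻¹' {f i}))) := by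
  classical
  rw [rvEnt, ← Finset.sum_fiberwise (g := f) (s := Finset.univ)]
  refine Finset.sum_congr rfl fun k _ => ?_
  have h := measureReal_preimage_eq_sum (ν := ν) hZ (f ⁻¹' {k})
  rw [← preimage_comp, ← Finset.sum_filter] at h
  rw [Real.negMulLog, neg_mul, Finset.sum_neg_distrib]
  nth_rewrite 1 [h]
  rw [Finset.sum_mul]
  congr 1
  refine Finset.sum_congr (by ext; simp) fun i hi => ?_
  simp only [Finset.mem_filter, Finset.mem_univ, true_and, mem_preimage, mem_singleton_iff] at hi
  rw [hi]

lemma rvEnt_comp_le {Z : X → ι} (hZ : Measurable Z) (f : ι → κ) :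
    rvEnt ν (f ∘ Z) ≤ rvEnt ν Z := by
  rw [rvEnt_comp hZ f, rvEnt]
  refine Finset.sum_le_sum fun i _ => ?_
  rw [Real.negMulLog, neg_mul, neg_le_neg_iff]
  rcases (measureReal_nonneg (μ := ν) (s := Z ⁻¹' {i})).eq_or_lt with h | h
  · simp [← h]
  · refine mul_le_mul_of_nonneg_left (Real.log_le_log h ?_) h.le
    exact measureReal_mono fun x hx => by
      simp only [mem_preimage, mem_singleton_iff, Function.comp] at hx ⊢; rw [hx]

lemma rvEnt_le_of_factors {Z : X → ι} (hZ : Measurable Z) {Y : X → κ} (f : ι → κ)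
    (h : ∀ x, Y x = f (Z x)) : rvEnt ν Y ≤ rvEnt ν Z := by
  rw [show Y = f ∘ Z from funext h]; exact rvEnt_comp_le hZ f

lemma rvEnt_submodular {A : X → α} {B : X → β} {C : X → γ} (hA : Measurable A)
    (hB : Measurable B) (hC : Measurable C) :
    rvEnt ν (fun x => (A x, B x, C x)) + rvEnt ν C ≤
      rvEnt ν (fun x => (A x, C x)) + rvEnt ν (fun x => (B x, C x)) := by
  classical
  set Z : X → α × β × γ := fun x => (A x, B x, C x) with hZdef
  have hZ : Measurable Z := hA.prodMk (hB.prodMk hC)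
  set p : α × β × γ → ℝ := fun i => ν.real (Z ⁻¹' {i}) with hp
  set pc : γ → ℝ := fun c => ν.real (C ⁻¹' {c}) with hpc
  set pac : α → γ → ℝ := fun a c => ν.real ((fun x => (A x, C x)) ⁻¹' {(a, c)}) with hpac
  set pbc : β → γ → ℝ := fun b c => ν.real ((fun x => (B x, C x)) ⁻¹' {(b, c)}) with hpbc
  have e0 : rvEnt ν Z = ∑ i, -(p i * Real.log (p i)) := by
    simp [rvEnt, Real.negMulLog, hp]
  have e1 : rvEnt ν C = ∑ i, -(p i * Real.log (pc i.2.2)) :=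
    rvEnt_comp hZ (fun i : α × β × γ => i.2.2)
  have e2 : rvEnt ν (fun x => (A x, C x)) = ∑ i, -(p i * Real.log (pac i.1 i.2.2)) :=
    rvEnt_comp hZ (fun i : α × β × γ => (i.1, i.2.2))
  have e3 : rvEnt ν (fun x => (B x, C x)) = ∑ i, -(p i * Real.log (pbc i.2.1 i.2.2)) :=
    rvEnt_comp hZ (fun i : α × β × γ => (i.2.1, i.2.2))
  have hsa : ∀ c, ∑ a, pac a c = pc c := fun c => by
    have h := measureReal_preimage_eq_sum (ν := ν) (hA.prodMk hC) (Prod.snd ⁻¹' {c})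
    rw [← preimage_comp, Fintype.sum_prod_type] at h
    simp only [hpc]
    rw [show C = Prod.snd ∘ fun x => (A x, C x) from rfl, h]
    simp [hpac]
  have hsb : ∀ c, ∑ b, pbc b c = pc c := fun c => by
    have h := measureReal_preimage_eq_sum (ν := ν) (hB.prodMk hC) (Prod.snd ⁻¹' {c})
    rw [← preimage_comp, Fintype.sum_prod_type] at h
    simp only [hpc]
    rw [show C = Prod.snd ∘ fun x => (B x, C x) from rfl, h]
    simp [hpbc]
  have hterm : ∀ i, p i * (Real.log (pac i.1 i.2.2) + Real.log (pbc i.2.1 i.2.2)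
      - Real.log (p i) - Real.log (pc i.2.2)) ≤
        pac i.1 i.2.2 * pbc i.2.1 i.2.2 / pc i.2.2 - p i := by
    rintro ⟨a, b, c⟩
    simp only
    have n1 : 0 ≤ pac a c := measureReal_nonneg
    have n2 : 0 ≤ pbc b c := measureReal_nonneg
    have n3 : 0 ≤ pc c := measureReal_nonneg
    rcases (measureReal_nonneg (μ := ν) (s := Z ⁻¹' {(a, b, c)})).eq_or_lt with h | h
    · have : p (a, b, c) = 0 := h.symm
      rw [this]
      simp only [zero_mul, sub_zero]
      positivity
    · change 0 < p (a, b, c) at h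
      have q1 : 0 < pac a c := h.trans_le (measureReal_mono fun x hx => by
        simp only [hZdef, mem_preimage, mem_singleton_iff, Prod.mk.injEq] at hx ⊢; tauto)
      have q2 : 0 < pbc b c := h.trans_le (measureReal_mono fun x hx => by
        simp only [hZdef, mem_preimage, mem_singleton_iff, Prod.mk.injEq] at hx ⊢; tauto)
      have q3 : 0 < pc c := h.trans_le (measureReal_mono fun x hx => by
        simp only [hZdef, mem_preimage, mem_singleton_iff, Prod.mk.injEq] at hx ⊢; tauto)
      have hl := Real.log_le_sub_one_of_pos (x := pac a c * pbc b c / (p (a, b, c) * pc c))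
        (by positivity)
      rw [Real.log_div (by positivity) (by positivity), Real.log_mul q1.ne' q2.ne',
        Real.log_mul h.ne' q3.ne'] at hl
      have hm := mul_le_mul_of_nonneg_left hl h.le
      have he : p (a, b, c) * (pac a c * pbc b c / (p (a, b, c) * pc c) - 1) =
          pac a c * pbc b c / pc c - p (a, b, c) := by
        field_simp
      rw [he] at hm
      linarith
  have hsum := Finset.sum_le_sum fun i (_ : i ∈ (Finset.univ : Finset (α × β × γ))) => hterm i
  have hr : ∑ i : α × β × γ, (pac i.1 i.2.2 * pbc i.2.1 i.2.2 / pc i.2.2 - p i) = 0 := by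
    rw [Finset.sum_sub_distrib, sum_measureReal_preimage hZ, sub_eq_zero,
      Fintype.sum_prod_type, Finset.sum_comm, Fintype.sum_prod_type, Finset.sum_comm]
    simp only
    rw [← sum_measureReal_preimage (ν := ν) hC]
    refine Finset.sum_congr rfl fun c _ => ?_
    have : ∀ b, ∑ a, pac a c * pbc b c / pc c = pbc b c * (pc c / pc c) := fun b => by
      rw [← hsa c, Finset.sum_div, Finset.mul_sum]
      simp only [hsa]
      exact Finset.sum_congr rfl fun a _ => by ring
    simp only [this, ← Finset.sum_mul, hsb]
    change pc c * (pc c / pc c) = pc c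
    by_cases h : pc c = 0
    · simp [h]
    · rw [div_self h, mul_one]
  rw [hr] at hsum
  rw [e0, e1, e2, e3, ← Finset.sum_add_distrib, ← Finset.sum_add_distrib, ← sub_nonpos,
    ← Finset.sum_sub_distrib]
  refine le_trans (le_of_eq (Finset.sum_congr rfl fun i _ => ?_)) hsum
  ring

/-- Gibbs' inequality, for weights `c` on the values of positive probability. -/
lemma rvEnt_add_le_log_sum_exp {Z : X → ι} (hZ : Measurable Z) (c : ι → ℝ) {R : ℝ}
    (hR : ∑ i ∈ Finset.univ.filter (fun i => 0 < ν.real (Z ⁻¹' {i})), Real.exp (c i) ≤ R) :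
    rvEnt ν Z + ∑ i, ν.real (Z ⁻¹' {i}) * c i ≤ Real.log R := by
  classical
  set p : ι → ℝ := fun i => ν.real (Z ⁻¹' {i}) with hp
  have hp0 : ∀ i, 0 ≤ p i := fun i => measureReal_nonneg
  have hp1 : ∑ i, p i = 1 := sum_measureReal_preimage hZ
  have hRpos : 0 < R := by
    refine lt_of_lt_of_le ?_ hR
    refine Finset.sum_pos (fun i _ => Real.exp_pos _) ?_
    by_contra hne
    rw [Finset.not_nonempty_iff_eq_empty, Finset.filter_eq_empty_iff] at hne
    have : ∑ i, p i = 0 := Finset.sum_eq_zero fun i hi => le_antisymm (not_lt.1 (hne hi)) (hp0 i)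
    linarith
  have hterm : ∀ i, Real.negMulLog (p i) + p i * c i - p i * Real.log R ≤
      (if 0 < p i then Real.exp (c i) / R else 0) - p i := by
    intro i
    split_ifs with h
    · have hl := Real.log_le_sub_one_of_pos (x := Real.exp (c i) / (p i * R)) (by positivity)
      rw [Real.log_div (by positivity) (by positivity), Real.log_exp,
        Real.log_mul h.ne' hRpos.ne'] at hl
      have hm := mul_le_mul_of_nonneg_left hl h.le
      have he : p i * (Real.exp (c i) / (p i * R) - 1) = Real.exp (c i) / R - p i := by
        field_simp
      rw [he] at hm
      rw [Real.negMulLog]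
      linarith
    · have : p i = 0 := le_antisymm (not_lt.1 h) (hp0 i)
      simp [this]
  have hs := Finset.sum_le_sum fun i (_ : i ∈ (Finset.univ : Finset ι)) => hterm i
  rw [Finset.sum_sub_distrib, Finset.sum_sub_distrib, Finset.sum_add_distrib, ← Finset.sum_mul,
    hp1, ← Finset.sum_filter, ← Finset.sum_div] at hs
  have h2 : (∑ i ∈ Finset.univ.filter (fun i => 0 < p i), Real.exp (c i)) / R ≤ 1 := by
    rw [div_le_one hRpos]; exact hR
  change ∑ i, Real.negMulLog (p i) + _ ≤ _
  linarith

lemma rvEnt_le_log_card {Z : X → ι} (hZ : Measurable Z) :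
    rvEnt ν Z ≤ Real.log (Fintype.card ι) := by
  have h := rvEnt_add_le_log_sum_exp (ν := ν) hZ (fun _ => 0) (R := Fintype.card ι) (by
    simp only [Real.exp_zero, Finset.sum_const, nsmul_eq_mul, mul_one]
    exact_mod_cast Finset.card_le_univ _)
  simpa using h

end RandomVariables

section Joint

variable {X : Type*} [MeasurableSpace X]

/-- The joint random variable of a finite family of events. -/
def jointEvents (ξ : ℕ × ℕ → X → Prop) (S : Finset (ℕ × ℕ)) (x : X) : S → Prop :=
  fun p => ξ p x

/-- The entropy of a finite family of events. -/
def eventEnt (ν : Measure X) (ξ : ℕ × ℕ → X → Prop) (S : Finset (ℕ × ℕ)) : ℝ :=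
  rvEnt ν (jointEvents ξ S)

variable {ξ : ℕ × ℕ → X → Prop} {ν : Measure X} [IsProbabilityMeasure ν]

lemma measurable_jointEvents (hξ : ∀ p, Measurable (ξ p)) (S : Finset (ℕ × ℕ)) :
    Measurable (jointEvents ξ S) := measurable_pi_iff.2 fun p => hξ p

lemma eventEnt_mono (hξ : ∀ p, Measurable (ξ p)) {S S' : Finset (ℕ × ℕ)} (h : S ⊆ S') :
    eventEnt ν ξ S ≤ eventEnt ν ξ S' :=
  rvEnt_le_of_factors (measurable_jointEvents hξ S')
    (fun w (p : S) => w ⟨p.1, h p.2⟩) fun _ => rfl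

lemma eventEnt_nonneg (S : Finset (ℕ × ℕ)) : 0 ≤ eventEnt ν ξ S := rvEnt_nonneg _

lemma eventEnt_union_le_prod (hξ : ∀ p, Measurable (ξ p)) {ι : Type*} [Fintype ι]
    [MeasurableSpace ι] [MeasurableSingletonClass ι] {Z : X → ι} (hZ : Measurable Z)
    (S S' : Finset (ℕ × ℕ)) (h : ∀ p ∈ S, p ∈ S' ∨ ∃ f : ι → Prop, ∀ x, ξ p x = f (Z x)) :
    eventEnt ν ξ S ≤ rvEnt ν (fun x => (jointEvents ξ S' x, Z x)) := by
  classical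
  have h' : ∀ p : S, ∃ F : (S' → Prop) × ι → Prop, ∀ x, ξ p x = F (jointEvents ξ S' x, Z x) := by
    rintro ⟨p, hp⟩
    rcases h p hp with hp' | ⟨f, hf⟩
    · exact ⟨fun w => w.1 ⟨p, hp'⟩, fun _ => rfl⟩
    · exact ⟨fun w => f w.2, hf⟩
  choose F hF using h'
  exact rvEnt_le_of_factors ((measurable_jointEvents hξ S').prodMk hZ)
    (fun w p => F p w) fun x => funext fun p => hF p x

lemma eventEnt_submod (hξ : ∀ p, Measurable (ξ p)) (S S' : Finset (ℕ × ℕ)) :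
    eventEnt ν ξ (S ∪ S') + eventEnt ν ξ (S ∩ S') ≤ eventEnt ν ξ S + eventEnt ν ξ S' := by
  classical
  have hm := measurable_jointEvents hξ
  have h := rvEnt_submodular (ν := ν) (hm S) (hm S') (hm (S ∩ S'))
  have h1 : eventEnt ν ξ (S ∪ S') ≤
      rvEnt ν (fun x => (jointEvents ξ S x, jointEvents ξ S' x, jointEvents ξ (S ∩ S') x)) :=
    eventEnt_union_le_prod hξ ((hm S').prodMk (hm (S ∩ S'))) _ _ fun p hp => by
      rcases Finset.mem_union.1 hp with hp | hp
      · exact Or.inl hp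
      · exact Or.inr ⟨fun w => w.1 ⟨p, hp⟩, fun _ => rfl⟩
  have h2 : rvEnt ν (fun x => (jointEvents ξ S x, jointEvents ξ (S ∩ S') x)) ≤ eventEnt ν ξ S :=
    rvEnt_le_of_factors (hm S)
      (fun w => (w, fun p : ↥(S ∩ S') => w ⟨p.1, (Finset.mem_inter.1 p.2).1⟩)) fun _ => rfl
  have h3 : rvEnt ν (fun x => (jointEvents ξ S' x, jointEvents ξ (S ∩ S') x)) ≤
      eventEnt ν ξ S' :=
    rvEnt_le_of_factors (hm S')
      (fun w => (w, fun p : ↥(S ∩ S') => w ⟨p.1, (Finset.mem_inter.1 p.2).2⟩)) fun _ => rfl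
  change _ + eventEnt ν ξ (S ∩ S') ≤ _ at h
  linarith

lemma eventEnt_union_le (hξ : ∀ p, Measurable (ξ p)) (S S' : Finset (ℕ × ℕ)) :
    eventEnt ν ξ (S ∪ S') ≤ eventEnt ν ξ S + eventEnt ν ξ S' := by
  have := eventEnt_submod (ν := ν) hξ S S'
  have := eventEnt_nonneg (ν := ν) (ξ := ξ) (S ∩ S')
  linarith

lemma eventEnt_le_card (hξ : ∀ p, Measurable (ξ p)) (S : Finset (ℕ × ℕ)) :
    eventEnt ν ξ S ≤ S.card * Real.log 2 := by
  refine (rvEnt_le_log_card (measurable_jointEvents hξ S)).trans (le_of_eq ?_)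
  simp [Fintype.card_pi]

lemma eventEnt_empty (hξ : ∀ p, Measurable (ξ p)) : eventEnt ν ξ ∅ = 0 :=
  le_antisymm (by simpa using eventEnt_le_card (ν := ν) hξ ∅) (eventEnt_nonneg ∅)

end Joint

section CantorSpace

open Uniformity

lemma exists_forall_agree_mem_uniformity {V : Set ((ℕ → Bool) × (ℕ → Bool))}
    (hV : V ∈ 𝓤 (ℕ → Bool)) :
    ∃ q₀ : ℕ, ∀ c c' : ℕ → Bool, (∀ i < q₀, c i = c' i) → (c, c') ∈ V := by
  have hle : (⨅ q : ℕ, 𝓟 {p : (ℕ → Bool) × (ℕ → Bool) | ∀ i < q, p.1 i = p.2 i}) ≤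
      𝓤 (ℕ → Bool) := by
    rw [Pi.uniformity]
    refine le_iInf fun i => (iInf_le _ (i + 1)).trans ?_
    rw [← tendsto_iff_comap, DiscreteUniformity.eq_principal_setRelId, tendsto_principal_principal]
    intro p hp
    simpa using hp i (Nat.lt_succ_self i)
  have := (mem_iInf_of_directed (f := fun q : ℕ =>
    𝓟 {p : (ℕ → Bool) × (ℕ → Bool) | ∀ i < q, p.1 i = p.2 i}) ?_ V).1 (hle hV)
  · obtain ⟨q, hq⟩ := this
    exact ⟨q, fun c c' h => (mem_principal.1 hq) (a := (c, c')) h⟩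
  · refine (Monotone.directed_ge (f := fun q : ℕᵒᵈ => 𝓟 {p : (ℕ → Bool) × (ℕ → Bool) | ∀ i < OrderDual.ofDual q, p.1 i = p.2 i}) ?_)
    intro _ b hab
    exact principal_mono.2 fun _ hp _ hi => hp _ (lt_of_lt_of_le hi hab)

/-- The first `q` coordinates of a point of the Cantor space. -/
def cantorCell (q : ℕ) (c : ℕ → Bool) : Fin q → Bool := fun i => c i

lemma continuous_cantorCell (q : ℕ) : Continuous (cantorCell q) :=
  continuous_pi fun i => continuous_apply _

/-- A point of the cell with a given address. -/
def cantorPoint (q : ℕ) (j : Fin q → Bool) : ℕ → Bool :=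
  fun i => if h : i < q then j ⟨i, h⟩ else false

lemma cantorPoint_agree (q : ℕ) (c : ℕ → Bool) {i : ℕ} (hi : i < q) :
    cantorPoint q (cantorCell q c) i = c i := by
  simp [cantorPoint, cantorCell, hi]

lemma cantorCell_eq_iff {q : ℕ} {c c' : ℕ → Bool} :
    cantorCell q c = cantorCell q c' ↔ ∀ i < q, c i = c' i := by
  simp [cantorCell, funext_iff, Fin.forall_iff]

lemma isCantorSet_range {X : Type*} [TopologicalSpace X] [T2Space X] {e : (ℕ → Bool) → X}
    (he : Continuous e) (hinj : Function.Injective e) : IsCantorSet (range e) := by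
  have hemb : IsClosedEmbedding e := he.isClosedEmbedding hinj
  refine ⟨range_nonempty _, isCompact_range he, ⟨(isCompact_range he).isClosed, ?_⟩, ?_⟩
  · rintro _ ⟨z, rfl⟩
    rw [accPt_iff_nhds]
    intro V hV
    let w : ℕ → ℕ → Bool := fun n => Function.update z n (!z n)
    have hw : Tendsto w atTop (𝓝 z) := by
      rw [tendsto_pi_nhds]
      intro i
      refine tendsto_const_nhds.congr' ?_
      filter_upwards [eventually_gt_atTop i] with n hn
      simp [w, Function.update_of_ne hn.ne]
    obtain ⟨n, hn⟩ := (((he.tendsto z).comp hw).eventually hV).exists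
    refine ⟨e (w n), ⟨hn, mem_range_self _⟩, fun h => ?_⟩
    have := congrFun (hinj h) n
    simp [w] at this
  · exact hemb.isEmbedding.isTotallyDisconnected_range.2 inferInstance

end CantorSpace

section BaireGeneric

open Uniformity

variable {X : Type*} [MetricSpace X] {T : X → X} {A : Set X} {U : ℕ → Set X}

/-- Every finite list of pairs of basic open sets meeting `A` has arbitrarily large common
transition times. -/
def HasMixingTimes (T : X → X) (A : Set X) (U : ℕ → Set X) : Prop :=
  ∀ L : Finset (ℕ × ℕ), (∀ p ∈ L, (U p.1 ∩ A).Nonempty ∧ (U p.2 ∩ A).Nonempty) →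
    ∀ N, ∃ n ≥ N, ∀ p ∈ L, ∃ y ∈ A, y ∈ U p.1 ∧ T^[n] y ∈ U p.2

lemma HasMixingTimes.exists_shrink (hmix : HasMixingTimes T A U) (hT : Continuous T)
    (hU : TopologicalSpace.IsTopologicalBasis (range U)) {P : Type*} [Finite P]
    {S : Type*} (W : S → P → ℕ) (hW : ∀ s p, (U (W s p) ∩ A).Nonempty) (N : ℕ)
    (V : P → Set X) (hV : ∀ p, IsOpen (V p)) (hVA : ∀ p, (V p ∩ A).Nonempty) (F : Finset S) :
    ∃ V' : P → Set X, (∀ p, IsOpen (V' p)) ∧ (∀ p, (V' p ∩ A).Nonempty) ∧ (∀ p, V' p ⊆ V p) ∧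
      ∀ s ∈ F, ∃ n ≥ N, ∀ p, ∀ y ∈ V' p, T^[n] y ∈ U (W s p) := by
  classical
  have := Fintype.ofFinite P
  induction F using Finset.induction_on with
  | empty => exact ⟨V, hV, hVA, fun _ => subset_rfl, by simp⟩
  | insert s F _ ih =>
    obtain ⟨V', hV'o, hV'A, hV'V, hF⟩ := ih
    have hb : ∀ p, ∃ i, (U i ∩ A).Nonempty ∧ U i ⊆ V' p := by
      intro p
      obtain ⟨a, haV, haA⟩ := hV'A p
      obtain ⟨_, ⟨i, rfl⟩, hai, hi⟩ := hU.exists_subset_of_mem_open haV (hV'o p)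
      exact ⟨i, ⟨a, hai, haA⟩, hi⟩
    choose b hbA hbV using hb
    obtain ⟨n, hn, hnL⟩ := hmix (Finset.univ.image fun p => (b p, W s p)) (by
      simp only [Finset.mem_image, Finset.mem_univ, true_and, forall_exists_index]
      rintro _ p rfl
      exact ⟨hbA p, hW s p⟩) N
    refine ⟨fun p => U (b p) ∩ T^[n] ⁻¹' U (W s p), fun p => ?_, fun p => ?_, fun p => ?_, ?_⟩
    · exact (hU.isOpen (mem_range_self _)).inter
        ((hU.isOpen (mem_range_self _)).preimage (hT.iterate n))
    · obtain ⟨y, hyA, hy1, hy2⟩ := hnL (b p, W s p) (Finset.mem_image_of_mem _ (Finset.mem_univ p))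
      exact ⟨y, ⟨hy1, hy2⟩, hyA⟩
    · exact inter_subset_left.trans ((hbV p).trans (hV'V p))
    · intro t ht
      rcases Finset.mem_insert.1 ht with rfl | ht
      · exact ⟨n, hn, fun p y hy => hy.2⟩
      · obtain ⟨k, hk, hkF⟩ := hF t ht
        exact ⟨k, hk, fun p y hy => hkF p y (hbV p hy.1)⟩

/-- Families of maps from the Cantor space to `A` that realize every assignment of small cells to
basic open sets of index less than `l`. -/
def cellMixing (T : X → X) (A : Set X) (U : ℕ → Set X) (l : ℕ) : Set (ℕ → C(ℕ → Bool, A)) :=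
  {h | ∃ q ≥ l, ∀ s : Fin l × (Fin q → Bool) → {i : Fin l // (U i ∩ A).Nonempty},
    ∃ n ≥ l, ∀ (m : Fin l) (c : ℕ → Bool), T^[n] (h m c) ∈ U (s (m, cantorCell q c)).1}

lemma isOpen_cellMixing (hT : Continuous T) (hU : TopologicalSpace.IsTopologicalBasis (range U)) (l : ℕ) :
    IsOpen (cellMixing T A U l) := by
  have key : ∀ (q n : ℕ) (s : Fin l × (Fin q → Bool) → {i : Fin l // (U i ∩ A).Nonempty}),
      IsOpen {h : ℕ → C(ℕ → Bool, A) |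
        ∀ (m : Fin l) (c : ℕ → Bool), T^[n] (h m c) ∈ U (s (m, cantorCell q c)).1} := by
    intro q n s
    have heq : {h : ℕ → C(ℕ → Bool, A) |
        ∀ (m : Fin l) (c : ℕ → Bool), T^[n] (h m c) ∈ U (s (m, cantorCell q c)).1} =
        ⋂ (m : Fin l) (j : Fin q → Bool), (fun h : ℕ → C(ℕ → Bool, A) => h m) ⁻¹'
          {g | MapsTo g (cantorCell q ⁻¹' {j}) {a : A | T^[n] a ∈ U (s (m, j)).1}} := by
      ext h
      simp only [mem_ofPred_eq, mem_iInter, mem_preimage]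
      constructor
      · rintro H m _ c rfl
        exact H m c
      · exact fun H m c => H m (cantorCell q c) rfl
    rw [heq]
    refine isOpen_iInter_of_finite fun m => isOpen_iInter_of_finite fun j =>
      IsOpen.preimage (continuous_apply (m : ℕ)) (ContinuousMap.isOpen_setOfPred_mapsTo ?_ ?_)
    · exact ((isClosed_discrete {j}).preimage (continuous_cantorCell q)).isCompact
    · exact (hU.isOpen (mem_range_self _)).preimage
        ((hT.iterate n).comp continuous_subtype_val)
  have heq : cellMixing T A U l = ⋃ (q : ℕ) (_ : q ≥ l),
      ⋂ s : Fin l × (Fin q → Bool) → {i : Fin l // (U i ∩ A).Nonempty}, ⋃ (n : ℕ) (_ : n ≥ l),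
        {h : ℕ → C(ℕ → Bool, A) |
          ∀ (m : Fin l) (c : ℕ → Bool), T^[n] (h m c) ∈ U (s (m, cantorCell q c)).1} := by
    ext h
    simp [cellMixing]
  rw [heq]
  exact isOpen_iUnion fun q => isOpen_iUnion fun _ => isOpen_iInter_of_finite fun s =>
    isOpen_iUnion fun n => isOpen_iUnion fun _ => key q n s

lemma dense_cellMixing (hmix : HasMixingTimes T A U) (hT : Continuous T)
    (hU : TopologicalSpace.IsTopologicalBasis (range U)) (l : ℕ) : Dense (cellMixing T A U l) := by
  classical
  intro h
  have hex : ∀ q : ℕ, ∃ y : Fin l × (Fin q → Bool) → A,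
      (∀ m j, dist (y (m, j)) (h m (cantorPoint q j)) < 1 / (q + 1 : ℝ)) ∧
      ∀ s : Fin l × (Fin q → Bool) → {i : Fin l // (U i ∩ A).Nonempty},
        ∃ n ≥ l, ∀ p, T^[n] (y p) ∈ U (s p).1 := by
    intro q
    obtain ⟨V, -, hVA, hVV, hVs⟩ := hmix.exists_shrink hT hU
      (fun (s : Fin l × (Fin q → Bool) → {i : Fin l // (U i ∩ A).Nonempty}) p => ((s p).1 : ℕ))
      (fun s p => (s p).2) l
      (fun p => Metric.ball (h p.1 (cantorPoint q p.2) : X) (1 / (q + 1 : ℝ)))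
      (fun p => Metric.isOpen_ball)
      (fun p => ⟨_, Metric.mem_ball_self (by positivity), (h p.1 (cantorPoint q p.2)).2⟩)
      Finset.univ
    choose y hyV hyA using hVA
    refine ⟨fun p => ⟨y p, hyA p⟩, fun m j => hVV _ (hyV (m, j)), fun s => ?_⟩
    obtain ⟨n, hn, hs⟩ := hVs s (Finset.mem_univ s)
    exact ⟨n, hn, fun p => hs p _ (hyV p)⟩
  choose y hyd hys using hex
  let G : ℕ → ℕ → C(ℕ → Bool, A) := fun q m =>
    if hm : m < l then
      (ContinuousMap.mk (fun j => y q (⟨m, hm⟩, j)) continuous_of_discreteTopology).comp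
        ⟨cantorCell q, continuous_cantorCell q⟩
    else h m
  have hG : ∀ q (m : Fin l) c, G q m c = y q (m, cantorCell q c) := by
    intro q m c
    simp [G]
  refine mem_closure_of_tendsto (f := G) (b := atTop) ?_ ?_
  · rw [tendsto_pi_nhds]
    intro m
    by_cases hm : m < l
    · rw [ContinuousMap.tendsto_iff_tendstoUniformly, Metric.tendstoUniformly_iff]
      intro ε hε
      have huc : UniformContinuous (h m) :=
        CompactSpace.uniformContinuous_of_continuous (h m).continuous
      obtain ⟨q₀, hq₀⟩ := exists_forall_agree_mem_uniformity
        (huc (Metric.dist_mem_uniformity (half_pos hε)))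
      obtain ⟨q₁, hq₁⟩ := exists_nat_one_div_lt (half_pos hε)
      filter_upwards [eventually_ge_atTop q₀, eventually_ge_atTop q₁] with q h0 h1 c
      have e1 : dist (h m c) (h m (cantorPoint q (cantorCell q c))) < ε / 2 :=
        hq₀ _ _ fun i hi => (cantorPoint_agree q c (hi.trans_le h0)).symm
      have e2 := hyd q ⟨m, hm⟩ (cantorCell q c)
      have e3 : (1 : ℝ) / (q + 1) ≤ 1 / (q₁ + 1) := by gcongr
      rw [hG q ⟨m, hm⟩ c]
      rw [dist_comm] at e2
      linarith [dist_triangle (h m c) (h m (cantorPoint q (cantorCell q c)))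
        (y q (⟨m, hm⟩, cantorCell q c))]
    · simp only [G, hm, dite_false]
      exact tendsto_const_nhds
  · filter_upwards [eventually_ge_atTop l] with q hq
    refine ⟨q, hq, fun s => ?_⟩
    obtain ⟨n, hn, hs⟩ := hys q s
    refine ⟨n, hn, fun m c => ?_⟩
    rw [hG]
    exact hs _

lemma isOpen_exists_apply_mem {V : Set X} (hV : IsOpen V) :
    IsOpen {h : ℕ → C(ℕ → Bool, A) | ∃ m c, (h m c : X) ∈ V} := by
  simp only [ofPred_exists]
  refine isOpen_iUnion fun m => isOpen_iUnion fun c => ?_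
  exact hV.preimage (continuous_subtype_val.comp
    ((continuous_eval_const c).comp (continuous_apply m)))

lemma dense_exists_apply_mem {V : Set X} (hVA : (V ∩ A).Nonempty) :
    Dense {h : ℕ → C(ℕ → Bool, A) | ∃ m c, (h m c : X) ∈ V} := by
  intro h
  obtain ⟨a, haV, haA⟩ := hVA
  refine mem_closure_of_tendsto (b := atTop)
    (f := fun n => Function.update h n (ContinuousMap.const _ ⟨a, haA⟩)) ?_ ?_
  · rw [tendsto_pi_nhds]
    intro i
    refine tendsto_const_nhds.congr' ?_
    filter_upwards [eventually_gt_atTop i] with n hn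
    simp [Function.update_of_ne hn.ne]
  · exact Eventually.of_forall fun n => ⟨n, fun _ => false, by simpa using haV⟩

lemma injective_of_forall_mem_cellMixing (hU : TopologicalSpace.IsTopologicalBasis (range U))
    (hA : A.Nontrivial) {h : ℕ → C(ℕ → Bool, A)} (hh : ∀ l, h ∈ cellMixing T A U l) (m : ℕ) :
    Function.Injective (h m) := by
  classical
  intro z z' hz
  by_contra hne
  obtain ⟨r, hr⟩ := Function.ne_iff.1 hne
  obtain ⟨a, ha, b, hb, hab⟩ := hA
  obtain ⟨Va, Vb, hVa, hVb, haV, hbV, hd⟩ := t2_separation hab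
  obtain ⟨_, ⟨i, rfl⟩, hai, hi⟩ := hU.exists_subset_of_mem_open haV hVa
  obtain ⟨_, ⟨k, rfl⟩, hbk, hk⟩ := hU.exists_subset_of_mem_open hbV hVb
  obtain ⟨q, hq, H⟩ := hh (max (max (m + 1) (r + 1)) (max (i + 1) (k + 1)))
  set l := max (max (m + 1) (r + 1)) (max (i + 1) (k + 1)) with hl
  have hml : m < l := by omega
  have hil : i < l := by omega
  have hkl : k < l := by omega
  have hrq : r < q := by omega
  let si : {i : Fin l // (U i ∩ A).Nonempty} := ⟨⟨i, hil⟩, ⟨a, hai, ha⟩⟩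
  let sk : {i : Fin l // (U i ∩ A).Nonempty} := ⟨⟨k, hkl⟩, ⟨b, hbk, hb⟩⟩
  obtain ⟨n, -, hn⟩ := H fun p => if p.2 = cantorCell q z then si else sk
  have h1 := hn ⟨m, hml⟩ z
  have h2 := hn ⟨m, hml⟩ z'
  have hcell : ¬ cantorCell q z' = cantorCell q z := fun hc =>
    hr (cantorCell_eq_iff.1 hc r hrq).symm
  simp only [if_true, hcell, if_false] at h1 h2
  rw [← hz] at h2
  exact disjoint_left.1 hd (hi h1) (hk h2)

lemma exists_time_forall_dist_lt (hA : IsCompact A) (hU : TopologicalSpace.IsTopologicalBasis (range U))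
    {h : ℕ → C(ℕ → Bool, A)} (hh : ∀ l, h ∈ cellMixing T A U l) {C : Set X} (hC : IsCompact C)
    {g : C → X} (hg : Continuous g) (hgA : ∀ c, g c ∈ A) (r N : ℕ) {ε : ℝ} (hε : 0 < ε) :
    ∃ n ≥ N, ∀ c : C, (∃ m < r, ∃ z, (h m z : X) = c) → dist (T^[n] c) (g c) < ε := by
  classical
  by_cases hCe : Nonempty C
  swap
  · exact ⟨N, le_rfl, fun c => (hCe ⟨c⟩).elim⟩
  have hcov : ∀ a : X, ∃ i, a ∈ U i ∧ U i ⊆ Metric.ball a (ε / 4) := by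
    intro a
    obtain ⟨_, ⟨i, rfl⟩, hai, hi⟩ := hU.exists_subset_of_mem_open
      (Metric.mem_ball_self (x := a) (show 0 < ε / 4 by positivity)) Metric.isOpen_ball
    exact ⟨i, hai, hi⟩
  choose b hb hbU using hcov
  obtain ⟨I, -, hI⟩ := hA.elim_nhds_subcover (fun a => U (b a))
    fun a _ => (hU.isOpen (mem_range_self _)).mem_nhds (hb a)
  have hIdist : ∀ a y y', y ∈ U (b a) → y' ∈ U (b a) → dist y y' < ε / 2 := by
    intro a y y' hy hy'
    have h1 := hbU a hy
    have h2 := hbU a hy'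
    rw [Metric.mem_ball] at h1 h2
    rw [dist_comm] at h2
    linarith [dist_triangle y a y']
  have hDc : ∀ m, IsCompact {z | (h m z : X) ∈ C} := fun m =>
    (hC.isClosed.preimage (continuous_subtype_val.comp (h m).continuous)).isCompact
  have huc : ∀ m, ∃ q₀ : ℕ, ∀ z z' : {z | (h m z : X) ∈ C}, (∀ i < q₀, z.1 i = z'.1 i) →
      dist (g ⟨h m z, z.2⟩) (g ⟨h m z', z'.2⟩) < ε / 2 := by
    intro m
    have := isCompact_iff_compactSpace.1 (hDc m)
    have hcont : Continuous fun z : {z | (h m z : X) ∈ C} => g ⟨h m z, z.2⟩ :=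
      hg.comp ((continuous_subtype_val.comp
        ((h m).continuous.comp continuous_subtype_val)).subtype_mk _)
    have hu := CompactSpace.uniformContinuous_of_continuous hcont
      (Metric.dist_mem_uniformity (half_pos hε))
    rw [mem_map, uniformity_subtype, mem_comap] at hu
    obtain ⟨V, hV, hVs⟩ := hu
    obtain ⟨q₀, hq₀⟩ := exists_forall_agree_mem_uniformity hV
    exact ⟨q₀, fun z z' hzz => @hVs (z, z') (hq₀ z z' hzz)⟩
  choose q₀ hq₀ using huc
  set l := max (max r N) (max (I.sup fun a => b a + 1) ((Finset.range r).sup q₀)) with hl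
  obtain ⟨q, hq, H⟩ := hh l
  have hbl : ∀ a ∈ I, b a < l := fun a ha => by
    have := Finset.le_sup (f := fun a => b a + 1) ha
    omega
  have hql : ∀ m < r, q₀ m ≤ q := fun m hm => by
    have := Finset.le_sup (f := q₀) (Finset.mem_range.2 hm)
    omega
  have htarget : ∀ a : A, ∃ t : {i : Fin l // (U i ∩ A).Nonempty},
      ∀ y ∈ U t.1, dist y a < ε / 2 := by
    rintro ⟨a, ha⟩
    obtain ⟨a', ha', haa'⟩ := mem_iUnion₂.1 (hI ha)
    exact ⟨⟨⟨b a', hbl a' ha'⟩, ⟨a, haa', ha⟩⟩, fun y hy => hIdist a' y a hy haa'⟩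
  choose t ht using htarget
  obtain ⟨c₀⟩ := hCe
  let s : Fin l × (Fin q → Bool) → {i : Fin l // (U i ∩ A).Nonempty} := fun p =>
    if hp : ∃ z : {z | (h p.1 z : X) ∈ C}, cantorCell q z = p.2 then
      t ⟨_, hgA ⟨h p.1 hp.choose, hp.choose.2⟩⟩ else t ⟨_, hgA c₀⟩
  obtain ⟨n, hn, hs⟩ := H s
  refine ⟨n, by omega, ?_⟩
  rintro ⟨_, hcC⟩ ⟨m, hm, z, rfl⟩
  have h1 := hs ⟨m, by omega⟩ z
  have hp : ∃ z' : {z | (h m z : X) ∈ C}, cantorCell q z' = cantorCell q z := ⟨⟨z, hcC⟩, rfl⟩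
  simp only [s, hp, dite_true] at h1
  have h2 := ht _ _ h1
  have h3 := hq₀ m hp.choose ⟨z, hcC⟩ fun i hi =>
    cantorCell_eq_iff.1 hp.choose_spec i (hi.trans_le (hql m hm))
  linarith [dist_triangle (T^[n] (h m z)) (g ⟨h m hp.choose, hp.choose.2⟩) (g ⟨h m z, hcC⟩)]

/-- A nontrivial compact set with mixing times is weakly mixing. -/
theorem HasMixingTimes.isWeaklyMixingSet (hmix : HasMixingTimes T A U) (hT : Continuous T)
    (hU : TopologicalSpace.IsTopologicalBasis (range U)) (hA : IsCompact A)
    (hnt : A.Nontrivial) : IsWeaklyMixingSet T A := by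
  have := isCompact_iff_compactSpace.1 hA
  have hdense : Dense ((⋂ l, cellMixing T A U l) ∩ ⋂ i : {i : ℕ // (U i ∩ A).Nonempty},
      {h : ℕ → C(ℕ → Bool, A) | ∃ m c, (h m c : X) ∈ U i}) :=
    Dense.inter_of_Gδ
      (.iInter_of_isOpen (isOpen_cellMixing hT hU))
      (.iInter_of_isOpen fun i => isOpen_exists_apply_mem (hU.isOpen (mem_range_self _)))
      (dense_iInter_of_isOpen (isOpen_cellMixing hT hU) (dense_cellMixing hmix hT hU))
      (dense_iInter_of_isOpen (fun i => isOpen_exists_apply_mem (hU.isOpen (mem_range_self _)))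
        fun i => dense_exists_apply_mem i.2)
  obtain ⟨a₀, ha₀⟩ := hnt.nonempty
  have : Nonempty (ℕ → C(ℕ → Bool, A)) := ⟨fun _ => ContinuousMap.const _ ⟨a₀, ha₀⟩⟩
  obtain ⟨h, hh, hd⟩ := hdense.nonempty
  rw [mem_iInter] at hh hd
  refine ⟨hnt.nonempty, hA.isClosed, ⋃ m, range fun z => (h m z : X), ?_, ⟨_, fun m => ?_, rfl⟩,
    ?_, ?_⟩
  · exact iUnion_subset fun m => range_subset_iff.2 fun z => (h m z).2
  · exact isCantorSet_range (continuous_subtype_val.comp (h m).continuous)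
      (Subtype.val_injective.comp (injective_of_forall_mem_cellMixing hU hnt hh m))
  · refine (closure_minimal (iUnion_subset fun m => range_subset_iff.2 fun z => (h m z).2)
      hA.isClosed).antisymm fun a ha => ?_
    rw [mem_closure_iff]
    intro V hV haV
    obtain ⟨_, ⟨i, rfl⟩, hai, hi⟩ := hU.exists_subset_of_mem_open haV hV
    obtain ⟨m, c, hmc⟩ := hd ⟨i, a, hai, ha⟩
    exact ⟨_, hi hmc, mem_iUnion.2 ⟨m, c, rfl⟩⟩
  · intro C hCB hC g hg hgA
    have hfreq : ∀ r : ℕ, ∃ᶠ n in atTop, ∀ c : C, (∃ m < r, ∃ z, (h m z : X) = c) →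
        dist (T^[n] c) (g c) < 1 / (r + 1 : ℝ) := fun r => frequently_atTop.2 fun N =>
      exists_time_forall_dist_lt hA hU hh hC.2.1 hg hgA r N (by positivity)
    obtain ⟨φ, hφ, hP⟩ := extraction_forall_of_frequently hfreq
    refine ⟨φ, hφ, fun c => ?_⟩
    obtain ⟨m, z, hz⟩ := mem_iUnion.1 (hCB c.2)
    rw [tendsto_iff_dist_tendsto_zero]
    refine squeeze_zero' (Eventually.of_forall fun _ => dist_nonneg) ?_
      tendsto_one_div_add_atTop_nhds_zero_nat
    filter_upwards [eventually_gt_atTop m] with r hr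
    exact (hP r c ⟨m, hr, z, hz⟩).le

end BaireGeneric

section Pressure

variable {X : Type*} [MetricSpace X] {T : X → X} {f : X → ℝ}

lemma continuous_birk (hT : Continuous T) (hf : Continuous f) (n : ℕ) :
    Continuous (birk T f n) :=
  continuous_finsetSum _ fun j _ => hf.comp (hT.iterate j)

variable [CompactSpace X]

/-- `E` is an `(n, δ)`-separated subset of `K`. -/
def IsSepIn (T : X → X) (n : ℕ) (δ : ℝ) (K : Set X) (E : Finset X) : Prop :=
  ↑E ⊆ K ∧ ∀ x ∈ E, ∀ y ∈ E, x ≠ y → ∃ i < n, δ < dist (T^[i] x) (T^[i] y)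

lemma exists_card_le_of_isSepIn (hT : Continuous T) (n : ℕ) {δ : ℝ} (hδ : 0 < δ) :
    ∃ k : ℕ, ∀ (K : Set X) (E : Finset X), IsSepIn T n δ K E → E.card ≤ k := by
  let N : X → Set X := fun x => ⋂ i : Fin n, {y | dist (T^[i] x) (T^[i] y) < δ / 2}
  have hN : ∀ x ∈ univ, N x ∈ 𝓝 x := fun x _ => by
    refine (isOpen_iInter_of_finite fun i => ?_).mem_nhds ?_
    · exact isOpen_lt (continuous_const.dist (hT.iterate i)) continuous_const
    · simp [hδ]
  obtain ⟨t, -, ht⟩ := isCompact_univ.elim_nhds_subcover N hN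
  have hc : ∀ y, ∃ x ∈ t, y ∈ N x := fun y => by simpa using ht (mem_univ y)
  choose c hct hc using hc
  refine ⟨t.card, fun K E hE => Finset.card_le_card_of_injOn c (fun y _ => hct y) ?_⟩
  intro x hx y hy hxy
  by_contra hne
  obtain ⟨i, hi, hd⟩ := hE.2 x hx y hy hne
  have h1 := mem_iInter.1 (hc x) ⟨i, hi⟩
  have h2 := mem_iInter.1 (hc y) ⟨i, hi⟩
  simp only [mem_ofPred_eq, ← hxy] at h1 h2
  rw [dist_comm] at h1
  linarith [dist_triangle (T^[i] x) (T^[i] (c x)) (T^[i] y)]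

lemma sum_exp_birk_le_sepPn (hT : Continuous T) (hf : Continuous f) {n : ℕ} {δ : ℝ} (hδ : 0 < δ)
    {K : Set X} {E : Finset X} (hE : IsSepIn T n δ K E) :
    ∑ x ∈ E, Real.exp (birk T f n x) ≤ sepPn T f n δ K := by
  refine le_csSup ?_ ⟨E, hE.1, hE.2, rfl⟩
  obtain ⟨k, hk⟩ := exists_card_le_of_isSepIn hT n hδ
  obtain ⟨M, hM⟩ := isCompact_univ.bddAbove_image (continuous_birk hT hf n).continuousOn
  refine ⟨k * Real.exp M, ?_⟩
  rintro _ ⟨F, hFK, hF, rfl⟩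
  calc ∑ x ∈ F, Real.exp (birk T f n x) ≤ ∑ x ∈ F, Real.exp M :=
        Finset.sum_le_sum fun x _ => Real.exp_le_exp.2 (hM (mem_image_of_mem _ (mem_univ x)))
    _ = F.card * Real.exp M := by simp
    _ ≤ k * Real.exp M := by
        have := hk K F ⟨hFK, hF⟩
        gcongr

lemma exists_maximal_isSepIn (hT : Continuous T) (n : ℕ) {δ : ℝ} (hδ : 0 < δ) (K : Set X) :
    ∃ E : Finset X, IsSepIn T n δ K E ∧
      ∀ y ∈ K, ∃ e ∈ E, ∀ i < n, dist (T^[i] e) (T^[i] y) ≤ δ := by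
  classical
  obtain ⟨k, hk⟩ := exists_card_le_of_isSepIn hT n hδ
  let S : Set ℕ := {m | ∃ E, IsSepIn T n δ K E ∧ E.card = m}
  have hS : S.Nonempty := ⟨0, ∅, ⟨by simp, by simp⟩, rfl⟩
  have hSb : BddAbove S := ⟨k, by rintro _ ⟨E, hE, rfl⟩; exact hk K E hE⟩
  obtain ⟨E, hE, hcard⟩ := Nat.sSup_mem hS hSb
  refine ⟨E, hE, fun y hy => ?_⟩
  by_contra! H
  have hyE : y ∉ E := fun h => by
    obtain ⟨i, _, hi⟩ := H y h
    simp at hi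
    linarith
  have hsep : IsSepIn T n δ K (insert y E) := by
    refine ⟨by simpa [insert_subset_iff] using ⟨hy, hE.1⟩, ?_⟩
    intro a ha b hb hab
    rcases Finset.mem_insert.1 ha with rfl | ha' <;> rcases Finset.mem_insert.1 hb with rfl | hb'
    · exact (hab rfl).elim
    · obtain ⟨i, hi, h⟩ := H b hb'
      exact ⟨i, hi, by rwa [dist_comm]⟩
    · exact H a ha'
    · exact hE.2 a ha' b hb' hab
  have := le_csSup hSb ⟨_, hsep, rfl⟩
  rw [Finset.card_insert_of_notMem hyE] at this
  omega

/-- Counting the words of length `n` over `W × Bool` weighted by the number of marked letters, if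
for each position at most one unmarked letter is allowed. -/
lemma sum_prod_weight_le {W : Type*} [Fintype W] [DecidableEq W] {n : ℕ} {s : ℝ}
    (P : Fin n → W → Prop) (hP : ∀ i w w', P i w → P i w' → w = w')
    (F : Finset (Fin n → W × Bool)) (hF : ∀ u ∈ F, ∀ i, (u i).2 = false → P i (u i).1) :
    ∑ u ∈ F, ∏ i, (if (u i).2 then Real.exp (-s) else 1) ≤
      (1 + Fintype.card W * Real.exp (-s)) ^ n := by
  classical
  let t : Fin n → Finset (W × Bool) := fun i =>
    Finset.univ.filter fun l => l.2 = false → P i l.1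
  have h1 : ∑ u ∈ F, ∏ i, (if (u i).2 then Real.exp (-s) else 1) ≤
      ∑ u ∈ Fintype.piFinset t, ∏ i, (if (u i).2 then Real.exp (-s) else 1) := by
    refine Finset.sum_le_sum_of_subset_of_nonneg (fun u hu => ?_) fun u _ _ =>
      Finset.prod_nonneg fun i _ => by split_ifs <;> positivity
    simp only [Fintype.mem_piFinset, t, Finset.mem_filter, Finset.mem_univ, true_and]
    exact hF u hu
  refine h1.trans ?_
  rw [← Finset.prod_univ_sum t fun _ l => if l.2 then Real.exp (-s) else 1]
  calc _ ≤ ∏ _i : Fin n, (1 + Fintype.card W * Real.exp (-s)) := by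
        refine Finset.prod_le_prod (fun i _ => Finset.sum_nonneg fun l _ => by
          split_ifs <;> positivity) fun i _ => ?_
        rw [Finset.sum_filter, Fintype.sum_prod_type]
        simp only [Fintype.sum_bool, forall_const, Bool.true_eq_false, IsEmpty.forall_iff, if_true,
          Bool.false_eq_true, if_false]
        rw [Finset.sum_add_distrib, add_comm]
        refine add_le_add ?_ (by simp)
        rw [Finset.sum_boole]
        exact_mod_cast Finset.card_le_one.2 fun w hw w' hw' =>
          hP i w w' (by simpa using hw) (by simpa using hw')
    _ = _ := by simp

variable [MeasurableSpace X] [BorelSpace X]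

lemma rvEnt_add_integral_birk_le (hT : Continuous T) (hf : Continuous f) {ν : Measure X}
    [IsProbabilityMeasure ν] {A : Set X} (hA : ν Aᶜ = 0) {W : Type*} [Fintype W]
    [MeasurableSpace W] [MeasurableSingletonClass W] {a : X → W} (ha : Measurable a)
    {K : W → Set X} (hK : ∀ w, MeasurableSet (K w)) (hKa : ∀ w, ∀ x ∈ K w, a x = w) {δ ε s : ℝ}
    (hδ : 0 < δ)
    (hKδ : ∀ w w', w ≠ w' → ∀ x ∈ K w, ∀ y ∈ K w', 2 * δ < dist x y)
    (hfδ : ∀ x y, dist x y ≤ δ → |f x - f y| ≤ ε) (n : ℕ) :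
    rvEnt ν (fun x (i : Fin n) => a (T^[i] x)) +
        ∫ x, birk T (fun x => f x - s * (⋃ w, K w)ᶜ.indicator 1 x) n x ∂ν ≤
      n * ε + n * Real.log (1 + Fintype.card W * Real.exp (-s)) +
        Real.log (sepPn T f n δ A) := by
  classical
  set B0 : Set X := (⋃ w, K w)ᶜ with hB0
  have hB0m : MeasurableSet B0 := (MeasurableSet.iUnion hK).compl
  have hTi : ∀ i, Measurable T^[i] := fun i => (hT.iterate i).measurable
  let Z : X → Fin n → W × Bool := fun x i => (a (T^[i] x), decide (T^[i] x ∈ B0))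
  have hZ : Measurable Z := by
    refine measurable_pi_iff.2 fun i => (ha.comp (hTi i)).prodMk ?_
    have : Measurable fun x => decide (x ∈ B0) := by
      refine measurable_to_bool ?_
      convert hB0m using 1
      ext x; simp
    exact this.comp (hTi i)
  have hent : rvEnt ν (fun x (i : Fin n) => a (T^[i] x)) ≤ rvEnt ν Z :=
    rvEnt_le_of_factors hZ (fun u i => (u i).1) fun _ => rfl
  let cnt : (Fin n → W × Bool) → ℝ := fun u => ∑ i, if (u i).2 then s else 0
  have hbirk : ∀ x, birk T (fun x => f x - s * B0.indicator 1 x) n x =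
      birk T f n x - cnt (Z x) := by
    intro x
    simp only [birk, cnt, Z, Finset.sum_sub_distrib]
    congr 1
    rw [← Fin.sum_univ_eq_sum_range (fun j => s * B0.indicator 1 (T^[j] x))]
    refine Finset.sum_congr rfl fun i _ => ?_
    by_cases h : T^[i] x ∈ B0 <;> simp [h]
  have h_int : Integrable (birk T f n) ν := by
    have hc := continuous_birk (T := T) hT hf n
    exact hc.integrable_of_hasCompactSupport (HasCompactSupport.of_compactSpace _)
  have hy : ∀ u, ∃ y, 0 < ν.real (Z ⁻¹' {u}) → y ∈ A ∧ Z y = u ∧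
      ∫ x in Z ⁻¹' {u}, birk T f n x ∂ν ≤ ν.real (Z ⁻¹' {u}) * birk T f n y := by
    intro u
    by_cases hu : 0 < ν.real (Z ⁻¹' {u})
    swap
    · obtain ⟨x⟩ : Nonempty X := nonempty_of_isProbabilityMeasure ν
      exact ⟨x, fun h => (hu h).elim⟩
    have hms : MeasurableSet (Z ⁻¹' {u}) := hZ (measurableSet_singleton u)
    have hne : ν.restrict (Z ⁻¹' {u}) ≠ 0 := by
      intro h
      rw [Measure.restrict_eq_zero] at h
      simp [measureReal_def, h] at hu
    have hnull : ν.restrict (Z ⁻¹' {u}) (Aᶜ ∪ (Z ⁻¹' {u})ᶜ) = 0 := by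
      refine measure_union_null ?_ ?_
      · exact Measure.restrict_apply_eq_zero' hms |>.2 (measure_mono_null inter_subset_left hA)
      · rw [Measure.restrict_apply_eq_zero' hms]; simp
    obtain ⟨y, hyN, hy⟩ := exists_notMem_null_average_le hne h_int.integrableOn hnull
    simp only [mem_union, mem_compl_iff, not_or, not_not] at hyN
    refine ⟨y, fun _ => ⟨hyN.1, hyN.2, ?_⟩⟩
    rw [setAverage_eq, smul_eq_mul, inv_mul_le_iff₀ hu] at hy
    exact hy
  choose y hy using hy
  obtain ⟨E, hE, hEmax⟩ := exists_maximal_isSepIn hT n hδ A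
  set D : ℝ := 1 + Fintype.card W * Real.exp (-s) with hD
  have hD0 : 0 < D := by positivity
  set c : (Fin n → W × Bool) → ℝ := fun u => birk T f n (y u) - cnt u with hc
  set Good := Finset.univ.filter fun u => 0 < ν.real (Z ⁻¹' {u}) with hGood
  have hGoodP : ∀ u ∈ Good, y u ∈ A ∧ Z (y u) = u ∧
      ∫ x in Z ⁻¹' {u}, birk T f n x ∂ν ≤ ν.real (Z ⁻¹' {u}) * birk T f n (y u) :=
    fun u hu => hy u (Finset.mem_filter.1 hu).2
  have hR : ∑ u ∈ Good, Real.exp (c u) ≤ sepPn T f n δ A * Real.exp (n * ε) * D ^ n := by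
    have he : ∀ u, ∃ e, u ∈ Good → e ∈ E ∧ ∀ i < n, dist (T^[i] e) (T^[i] (y u)) ≤ δ := by
      intro u
      by_cases hu : u ∈ Good
      · obtain ⟨e, h1, h2⟩ := hEmax _ (hGoodP u hu).1
        exact ⟨e, fun _ => ⟨h1, h2⟩⟩
      · exact ⟨y u, fun h => (hu h).elim⟩
    choose e he using he
    rw [← Finset.sum_fiberwise_of_maps_to (t := E) (g := e) fun u hu => (he u hu).1]
    calc _ ≤ ∑ z ∈ E, Real.exp (birk T f n z) * Real.exp (n * ε) * D ^ n := by
          refine Finset.sum_le_sum fun z hz => ?_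
          have hterm : ∀ u ∈ Good.filter (fun u => e u = z), Real.exp (c u) ≤
              Real.exp (birk T f n z) * Real.exp (n * ε) *
                ∏ i, (if (u i).2 then Real.exp (-s) else 1) := by
            intro u hu
            obtain ⟨huG, rfl⟩ := Finset.mem_filter.1 hu
            have h1 : birk T f n (y u) ≤ birk T f n (e u) + n * ε := by
              have : ∀ i ∈ Finset.range n, f (T^[i] (y u)) ≤ f (T^[i] (e u)) + ε := fun i hi => by
                have := hfδ _ _ ((he u huG).2 i (Finset.mem_range.1 hi))
                linarith [(abs_le.1 this).1]
              refine (Finset.sum_le_sum this).trans (le_of_eq ?_)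
              simp [Finset.sum_add_distrib, birk]
            have h2 : ∏ i, (if (u i).2 then Real.exp (-s) else 1) = Real.exp (-cnt u) := by
              rw [← Finset.sum_neg_distrib, Real.exp_sum]
              refine Finset.prod_congr rfl fun i _ => ?_
              split_ifs <;> simp
            rw [h2, ← Real.exp_add, ← Real.exp_add, Real.exp_le_exp]
            simp only [hc]
            linarith
          refine (Finset.sum_le_sum hterm).trans ?_
          rw [← Finset.mul_sum]
          refine mul_le_mul_of_nonneg_left ?_ (by positivity)
          refine sum_prod_weight_le (fun i w => ∃ x ∈ K w, dist (T^[i] z) x ≤ δ) ?_ _ ?_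
          · rintro i w w' ⟨x, hx, hxd⟩ ⟨x', hx', hxd'⟩
            by_contra hne
            have := hKδ w w' hne x hx x' hx'
            rw [dist_comm] at hxd
            linarith [dist_triangle x (T^[i] z) x']
          · intro u hu i hi
            obtain ⟨huG, rfl⟩ := Finset.mem_filter.1 hu
            refine ⟨T^[i] (y u), ?_, (he u huG).2 i i.2⟩
            have hZu := congrFun (hGoodP u huG).2.1 i
            rw [← hZu] at hi ⊢
            simp only [Z, decide_eq_false_iff_not, hB0, mem_compl_iff, not_not, mem_iUnion] at hi
            obtain ⟨w, hw⟩ := hi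
            simp only [Z]
            rwa [hKa w _ hw]
      _ ≤ _ := by
          rw [← Finset.sum_mul, ← Finset.sum_mul]
          have := sum_exp_birk_le_sepPn (f := f) hT hf hδ hE
          gcongr
  have hgibbs := rvEnt_add_le_log_sum_exp hZ c hR
  have hsep : 0 < sepPn T f n δ A := by
    have hAne : A.Nonempty := by
      by_contra h
      rw [not_nonempty_iff_eq_empty] at h
      simp [h] at hA
    obtain ⟨x, hx⟩ := hAne
    obtain ⟨z, hz, -⟩ := hEmax x hx
    exact (Finset.sum_pos (fun x _ => Real.exp_pos (birk T f n x)) ⟨z, hz⟩).trans_le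
      (sum_exp_birk_le_sepPn hT hf hδ hE)
  have hlog : Real.log (sepPn T f n δ A * Real.exp (n * ε) * D ^ n) =
      Real.log (sepPn T f n δ A) + n * ε + n * Real.log D := by
    rw [Real.log_mul (by positivity) (by positivity), Real.log_mul (by positivity) (by positivity),
      Real.log_exp, Real.log_pow]
  have hintegral : ∫ x, birk T (fun x => f x - s * B0.indicator 1 x) n x ∂ν ≤
      ∑ u, ν.real (Z ⁻¹' {u}) * c u := by
    simp_rw [hbirk]
    have hcnt : Integrable (fun x => cnt (Z x)) ν :=
      (Integrable.of_finite (μ := ν.map Z) (f := cnt)).comp_measurable hZ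
    rw [← setIntegral_univ, show (univ : Set X) = ⋃ u, Z ⁻¹' {u} by ext; simp,
      integral_iUnion_fintype (fun u => hZ (measurableSet_singleton u))
      (fun u v huv => Disjoint.preimage _ (by simpa using huv))
      (fun u => show IntegrableOn (fun x => birk T f n x - cnt (Z x)) _ ν from
        (h_int.sub hcnt).integrableOn)]
    refine Finset.sum_le_sum fun u _ => ?_
    rw [integral_sub h_int.integrableOn hcnt.integrableOn]
    have h1 : ∫ x in Z ⁻¹' {u}, cnt (Z x) ∂ν = ν.real (Z ⁻¹' {u}) * cnt u := by
      rw [setIntegral_congr_fun (g := fun _ => cnt u) (hZ (measurableSet_singleton u))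
        (fun x hx => by rw [show Z x = u from hx]), setIntegral_const, smul_eq_mul]
    rw [h1, hc, mul_sub]
    refine sub_le_sub_right ?_ _
    by_cases hu : u ∈ Good
    · exact (hGoodP u hu).2.2
    · have h0 : ν.real (Z ⁻¹' {u}) = 0 :=
        le_antisymm (not_lt.1 fun h => hu (by simpa [hGood] using h)) measureReal_nonneg
      have h0' : ν (Z ⁻¹' {u}) = 0 := (measureReal_eq_zero_iff).1 h0
      simp [h0, Measure.restrict_eq_zero.2 h0']
  linarith

end Pressure

section ReverseMartingale

variable {Ω : Type*} {m m0 : MeasurableSpace Ω} {μ : Measure Ω}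

lemma aestronglyMeasurable_iInf_of_tendsto {F : ℕ → MeasurableSpace Ω} (hF : Antitone F)
    {e : ℕ → Ω → ℝ} (he : ∀ n, Measurable[F n] (e n)) {L : Ω → ℝ}
    (h : ∀ᵐ x ∂μ, Tendsto (fun n => e n x) atTop (𝓝 (L x))) :
    AEStronglyMeasurable[⨅ n, F n] L μ := by
  refine ⟨fun x => limsup (fun n => e n x) atTop, ?_, ?_⟩
  · refine Measurable.stronglyMeasurable ?_
    intro s hs
    rw [MeasurableSpace.measurableSet_iInf]
    intro j
    have : (fun x => limsup (fun n => e n x) atTop) =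
        fun x => limsup (fun n => e (n + j) x) atTop := by
      funext x
      exact (limsup_nat_add (fun n => e n x) j).symm
    rw [this]
    exact Measurable.limsup (fun n => (he (n + j)).mono (hF (by omega)) le_rfl) hs
  · filter_upwards [h] with x hx
    exact hx.limsup_eq.symm

variable [IsProbabilityMeasure μ]

set_option maxHeartbeats 1000000 in
lemma tendsto_eLpNorm_condExp_of_antitone {F : ℕ → MeasurableSpace Ω} (hF : Antitone F)
    (hF0 : ∀ n, F n ≤ m0) {ψ : Ω → ℝ} (hψ : MemLp ψ 2 μ) :
    Tendsto (fun n => eLpNorm (μ[ψ|F n] - μ[ψ|⨅ n, F n]) 1 μ) atTop (𝓝 0) := by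
  have hFinf : ⨅ n, F n ≤ m0 := (iInf_le F 0).trans (hF0 0)
  let ψ' : Lp ℝ 2 μ := hψ.toLp
  let K : ℕ → Submodule ℝ (Lp ℝ 2 μ) := fun n => lpMeas ℝ ℝ (F n) 2 μ
  have hfact : ∀ n, Fact (F n ≤ m0) := fun n => ⟨hF0 n⟩
  have hKanti : Antitone K := fun i j hij f hf => by
    simp only [K, mem_lpMeas_iff_aestronglyMeasurable] at hf ⊢
    exact hf.mono (hF hij)
  have hKp : Monotone fun n => (K n)ᗮ := fun i j hij => Submodule.orthogonal_le (hKanti hij)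
  have hlim := Submodule.starProjection_tendsto_closure_iSup (fun n => (K n)ᗮ) hKp ψ'
  set L := ψ' - (⨆ n, (K n)ᗮ).topologicalClosure.starProjection ψ' with hL
  have hE : Tendsto (fun n => (K n).starProjection ψ') atTop (𝓝 L) := by
    have := (tendsto_const_nhds (x := ψ')).sub hlim
    refine this.congr fun n => ?_
    rw [Submodule.starProjection_orthogonal']
    simp
  have hEae : ∀ n, (K n).starProjection ψ' =ᵐ[μ] μ[ψ|F n] := fun n =>
    hψ.condExpL2_ae_eq_condExp (𝕜 := ℝ) (hF0 n)
  have h2 : Tendsto (fun n => eLpNorm (((K n).starProjection ψ' : Ω → ℝ) - (L : Ω → ℝ)) 2 μ)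
      atTop (𝓝 0) := (Lp.tendsto_Lp_iff_tendsto_eLpNorm' _ _).1 hE
  have h2' : Tendsto (fun n => eLpNorm (μ[ψ|F n] - (L : Ω → ℝ)) 2 μ) atTop (𝓝 0) :=
    h2.congr fun n => eLpNorm_congr_ae ((hEae n).sub .rfl)
  have hLmeas : AEStronglyMeasurable[⨅ n, F n] L μ := by
    have hme := tendstoInMeasure_of_tendsto_eLpNorm (μ := μ) (two_ne_zero)
      (fun n => (stronglyMeasurable_condExp.mono (hF0 n)).aestronglyMeasurable)
      (Lp.aestronglyMeasurable L) h2'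
    obtain ⟨φ, hφ, hae⟩ := hme.exists_seq_tendsto_ae
    have := aestronglyMeasurable_iInf_of_tendsto (F := fun n => F (φ n))
      (fun i j hij => hF (hφ.monotone hij))
      (fun n => stronglyMeasurable_condExp.measurable) hae
    have hle : ⨅ n, F (φ n) ≤ ⨅ n, F n :=
      le_iInf fun n => (iInf_le _ n).trans (hF (hφ.id_le n))
    exact this.mono hle
  have hLeq : (L : Ω → ℝ) =ᵐ[μ] μ[ψ|⨅ n, F n] := by
    have : Fact (⨅ n, F n ≤ m0) := ⟨hFinf⟩
    have h := (hψ.condExpL2_ae_eq_condExp (𝕜 := ℝ) hFinf)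
    suffices hLL : L = (lpMeas ℝ ℝ (⨅ n, F n) 2 μ).starProjection ψ' by
      rw [hLL]
      exact h
    refine (Submodule.eq_starProjection_of_mem_of_inner_eq_zero ?_ ?_).symm
    · exact mem_lpMeas_iff_aestronglyMeasurable.2 hLmeas
    · intro w hw
      have hw' : ∀ n, w ∈ K n := fun n => mem_lpMeas_iff_aestronglyMeasurable.2
        ((mem_lpMeas_iff_aestronglyMeasurable.1 hw).mono (iInf_le F n))
      have : Tendsto (fun n => inner ℝ (ψ' - (K n).starProjection ψ') w) atTop
          (𝓝 (inner ℝ (ψ' - L) w)) := (tendsto_const_nhds.sub hE).inner tendsto_const_nhds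
      refine tendsto_nhds_unique this (tendsto_const_nhds.congr fun n => ?_)
      exact ((K n).starProjection_inner_eq_zero ψ' w (hw' n)).symm
  refine tendsto_of_tendsto_of_tendsto_of_le_of_le tendsto_const_nhds h2' (fun _ => zero_le)
    fun n => ?_
  rw [eLpNorm_congr_ae (g := μ[ψ|F n] - (L : Ω → ℝ)) (EventuallyEq.rfl.sub hLeq.symm)]
  exact eLpNorm_le_eLpNorm_of_exponent_le (by norm_num)
    ((stronglyMeasurable_condExp.mono (hF0 n)).aestronglyMeasurable.sub
      (Lp.aestronglyMeasurable L))

/-- The conditional probability of an event. -/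
def cprob (μ : Measure Ω) (m : MeasurableSpace Ω) (s : Set Ω) : Ω → ℝ :=
  μ[s.indicator (fun _ => (1 : ℝ)) | m]

lemma integrable_indicator_one {s : Set Ω} (hs : MeasurableSet s) :
    Integrable (s.indicator (fun _ => (1 : ℝ))) μ := (integrable_const 1).indicator hs

lemma cprob_mem_Icc (hm : m ≤ m0) {s : Set Ω} (hs : MeasurableSet s) :
    ∀ᵐ x ∂μ, cprob μ m s x ∈ Icc 0 1 := by
  have h0 : 0 ≤ᵐ[μ] cprob μ m s :=
    condExp_nonneg (Eventually.of_forall fun x => indicator_nonneg (fun _ _ => zero_le_one) x)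
  have h1 : cprob μ m s ≤ᵐ[μ] μ[fun _ => (1 : ℝ)|m] :=
    condExp_mono (integrable_indicator_one hs) (integrable_const 1)
      (Eventually.of_forall fun x => indicator_le_self' (fun _ _ => zero_le_one) x)
  rw [condExp_const hm] at h1
  filter_upwards [h0, h1] with x h0 h1 using ⟨h0, h1⟩

lemma tendsto_integral_comp_cprob {F : ℕ → MeasurableSpace Ω}
    (hF : ∀ n, F n ≤ m0) (hm : m ≤ m0) {s : Set Ω} (hs : MeasurableSet s)
    (h : Tendsto (fun n => eLpNorm (cprob μ (F n) s - cprob μ m s) 1 μ) atTop (𝓝 0))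
    {ϕ : ℝ → ℝ} (hϕ : Continuous ϕ) :
    Tendsto (fun n => ∫ x, ϕ (cprob μ (F n) s x) ∂μ) atTop
      (𝓝 (∫ x, ϕ (cprob μ m s x) ∂μ)) := by
  obtain ⟨M, hM⟩ := (isCompact_Icc (a := (0 : ℝ)) (b := 1)).exists_bound_of_continuousOn
    hϕ.continuousOn
  refine tendsto_of_subseq_tendsto fun ns hns => ?_
  have hme := tendstoInMeasure_of_tendsto_eLpNorm (μ := μ) one_ne_zero
    (fun n => (stronglyMeasurable_condExp.mono (hF (ns n))).aestronglyMeasurable)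
    (stronglyMeasurable_condExp.mono hm).aestronglyMeasurable (h.comp hns)
  obtain ⟨φ, -, hae⟩ := hme.exists_seq_tendsto_ae
  refine ⟨φ, tendsto_integral_of_dominated_convergence (fun _ => M) (fun n => ?_)
    (integrable_const M) (fun n => ?_) ?_⟩
  · exact hϕ.comp_aestronglyMeasurable
      (stronglyMeasurable_condExp.mono (hF _)).aestronglyMeasurable
  · filter_upwards [cprob_mem_Icc (μ := μ) (hF (ns (φ n))) hs] with x hx using hM _ hx
  · filter_upwards [hae] with x hx using (hϕ.tendsto _).comp hx

/-- The conditional entropy of a random variable given a σ-algebra. -/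
def condEnt {ι : Type*} [Fintype ι] (μ : Measure Ω) (m : MeasurableSpace Ω) (Y : Ω → ι) : ℝ :=
  ∑ i, ∫ x, Real.negMulLog (cprob μ m (Y ⁻¹' {i}) x) ∂μ

variable {ι κ : Type*} [Fintype ι] [MeasurableSpace ι] [MeasurableSingletonClass ι]
  [Fintype κ] [MeasurableSpace κ] [MeasurableSingletonClass κ]

lemma tendsto_condEnt {F : ℕ → MeasurableSpace Ω}
    (hF : ∀ n, F n ≤ m0) (hm : m ≤ m0) {Y : Ω → ι} (hY : Measurable Y)
    (h : ∀ s, MeasurableSet s →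
      Tendsto (fun n => eLpNorm (cprob μ (F n) s - cprob μ m s) 1 μ) atTop (𝓝 0)) :
    Tendsto (fun n => condEnt μ (F n) Y) atTop (𝓝 (condEnt μ m Y)) :=
  tendsto_finsetSum _ fun i _ => tendsto_integral_comp_cprob hF hm
    (hY (measurableSet_singleton i)) (h _ (hY (measurableSet_singleton i)))
    Real.continuous_negMulLog

lemma tendsto_condEnt_iInf {F : ℕ → MeasurableSpace Ω} (hF : Antitone F)
    (hF0 : ∀ n, F n ≤ m0) {Y : Ω → ι} (hY : Measurable Y) :
    Tendsto (fun n => condEnt μ (F n) Y) atTop (𝓝 (condEnt μ (⨅ n, F n) Y)) :=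
  tendsto_condEnt (m := ⨅ n, F n) hF0 ((iInf_le F 0).trans (hF0 0)) hY fun _ hs =>
    tendsto_eLpNorm_condExp_of_antitone hF hF0 ((memLp_const (1 : ℝ)).indicator hs)

lemma tendsto_condEnt_iSup {F : ℕ → MeasurableSpace Ω} (hF : Monotone F)
    (hF0 : ∀ n, F n ≤ m0) {Y : Ω → ι} (hY : Measurable Y) :
    Tendsto (fun n => condEnt μ (F n) Y) atTop (𝓝 (condEnt μ (⨆ n, F n) Y)) :=
  tendsto_condEnt (m := ⨆ n, F n) hF0 (iSup_le hF0) hY fun _ _ =>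
    tendsto_eLpNorm_condExp (ℱ := ⟨F, hF, hF0⟩) _

end ReverseMartingale

section CondExpDynamics

variable {Ω : Type*} {m m' m0 : MeasurableSpace Ω} {μ : Measure Ω} [IsProbabilityMeasure μ]

lemma condExp_comp_comap {T : Ω → Ω} (hT : MeasurePreserving T μ μ) (hm : m ≤ m0) {g : Ω → ℝ}
    (hg : Integrable g μ) : μ[g|m] ∘ T =ᵐ[μ] μ[g ∘ T|m.comap T] := by
  have hle : m.comap T ≤ m0 := (MeasurableSpace.comap_mono hm).trans hT.measurable.comap_le
  have hTm : Measurable[m.comap T, m] T := measurable_iff_comap_le.2 le_rfl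
  refine ae_eq_condExp_of_forall_setIntegral_eq hle (hT.integrable_comp_of_integrable hg)
    (fun s _ _ => ((hT.integrable_comp_of_integrable integrable_condExp).integrableOn)) ?_ ?_
  · rintro s ⟨t, ht, rfl⟩ -
    have h1 : ∀ k : Ω → ℝ, AEStronglyMeasurable k μ →
        ∫ x in T ⁻¹' t, (k ∘ T) x ∂μ = ∫ x in t, k x ∂μ := fun k hk => by
      have := setIntegral_map (μ := μ) (f := k) (g := T) (hm t ht) (by rwa [hT.map_eq])
        hT.measurable.aemeasurable
      rw [hT.map_eq] at this
      exact this.symm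
    rw [h1 _ integrable_condExp.aestronglyMeasurable, h1 _ hg.aestronglyMeasurable,
      setIntegral_condExp hm hg ht]
  · exact (stronglyMeasurable_condExp.comp_measurable hTm).aestronglyMeasurable

lemma eLpNorm_cprob_inter_sub_mul_le (hm : m ≤ m') (hm' : m' ≤ m0) {A B : Set Ω}
    (hA : MeasurableSet A) (hB : MeasurableSet[m'] B) :
    eLpNorm (cprob μ m (A ∩ B) - cprob μ m A * cprob μ m B) 1 μ ≤
      eLpNorm (cprob μ m' A - cprob μ m A) 1 μ := by
  have hB0 : MeasurableSet B := hm' B hB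
  set a : Ω → ℝ := A.indicator fun _ => 1
  set b : Ω → ℝ := B.indicator fun _ => 1
  have hab : (A ∩ B).indicator (fun _ => (1 : ℝ)) = a * b := by
    funext x
    by_cases h1 : x ∈ A <;> by_cases h2 : x ∈ B <;> simp [a, b, h1, h2]
  have hai : Integrable a μ := integrable_indicator_one hA
  have hbi : Integrable b μ := integrable_indicator_one hB0
  have hbm : StronglyMeasurable[m'] b := stronglyMeasurable_const.indicator hB
  have hbd : ∀ x, ‖b x‖ ≤ 1 := fun x => by
    by_cases h2 : x ∈ B <;> simp [b, h2]
  have hmul : ∀ {g : Ω → ℝ}, Integrable g μ → Integrable (g * b) μ := fun hg =>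
    (hg.bdd_mul (c := 1) hbi.aestronglyMeasurable (Eventually.of_forall hbd)).congr
      (Eventually.of_forall fun x => mul_comm _ _)
  have h1 : cprob μ m (A ∩ B) =ᵐ[μ] μ[μ[a|m'] * b|m] := by
    rw [cprob, hab]
    refine (condExp_condExp_of_le hm hm').symm.trans (condExp_congr_ae ?_)
    exact condExp_mul_of_stronglyMeasurable_right hbm (hmul hai) hai
  have h2 : cprob μ m A * cprob μ m B =ᵐ[μ] μ[μ[a|m] * b|m] :=
    (condExp_mul_of_stronglyMeasurable_left stronglyMeasurable_condExp
      (hmul integrable_condExp) hbi).symm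
  have h3 : cprob μ m (A ∩ B) - cprob μ m A * cprob μ m B =ᵐ[μ]
      μ[(μ[a|m'] - μ[a|m]) * b|m] := by
    refine (h1.sub h2).trans ?_
    rw [sub_mul]
    exact (condExp_sub (hmul integrable_condExp) (hmul integrable_condExp) m).symm
  rw [eLpNorm_congr_ae h3]
  refine (eLpNorm_condExp_le_eLpNorm _ le_rfl).trans (eLpNorm_mono fun x => ?_)
  rw [Pi.mul_apply, norm_mul]
  exact mul_le_of_le_one_right (norm_nonneg _) (hbd x)

/-- Mean ergodic theorem in weak form: a sequence of correlations of an ergodic map that tends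
to zero does so only if one of the two functions has zero mean. -/
lemma Ergodic.integral_mul_integral_eq_zero {T : Ω → Ω} (hT : Ergodic T μ) {u v : Ω → ℝ}
    (hu : MemLp u 2 μ) (hv : MemLp v 2 μ)
    (h : Tendsto (fun n => ∫ x, u x * v (T^[n] x) ∂μ) atTop (𝓝 0)) :
    (∫ x, u x ∂μ) * ∫ x, v x ∂μ = 0 := by
  have hTm := hT.toMeasurePreserving
  have hfact : Fact ((1 : ENNReal) ≤ 2) := ⟨by norm_num⟩
  let K₀ : Lp ℝ 2 μ →ₗᵢ[ℝ] Lp ℝ 2 μ := Lp.compMeasurePreservingₗᵢ ℝ T hTm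
  let K : Lp ℝ 2 μ →L[ℝ] Lp ℝ 2 μ := K₀.toContinuousLinearMap
  have hK1 : ‖K‖ ≤ 1 := K₀.norm_toContinuousLinearMap_le
  let u' : Lp ℝ 2 μ := hu.toLp
  let v' : Lp ℝ 2 μ := hv.toLp
  let e : Lp ℝ 2 μ := (memLp_const (1 : ℝ)).toLp
  have hiter : ∀ n, ∃ h : MemLp (v ∘ T^[n]) 2 μ, K^[n] v' = h.toLp := by
    intro n
    refine ⟨hv.comp_measurePreserving (hTm.iterate n), ?_⟩
    induction n with
    | zero => rfl
    | succ n ih =>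
      rw [Function.iterate_succ_apply', ih]
      change Lp.compMeasurePreserving T hTm _ = _
      rw [Lp.toLp_compMeasurePreserving]
      rfl
  have hinner : ∀ n, inner ℝ u' (K^[n] v') = ∫ x, u x * v (T^[n] x) ∂μ := by
    intro n
    obtain ⟨hn, hn'⟩ := hiter n
    rw [hn', L2.inner_def]
    refine integral_congr_ae ?_
    filter_upwards [hu.coeFn_toLp, hn.coeFn_toLp] with x h1 h2
    simp only [u', h1, h2]
    simp [mul_comm]
  have hlim := K.tendsto_birkhoffAverage_orthogonalProjection hK1 v'
  set S := K.eqLocus (1 : Lp ℝ 2 μ →L[ℝ] Lp ℝ 2 μ)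
  set w : Lp ℝ 2 μ := (S.orthogonalProjectionOnto v' : Lp ℝ 2 μ) with hw
  have hwS : K w = w := (S.orthogonalProjectionOnto v').2
  have h0 : inner ℝ u' w = 0 := by
    have h1 : Tendsto (fun n => inner ℝ u' (birkhoffAverage ℝ K _root_.id n v')) atTop
        (𝓝 (inner ℝ u' w)) := tendsto_const_nhds.inner hlim
    refine tendsto_nhds_unique h1 (h.cesaro.congr fun n => ?_)
    simp only [birkhoffAverage, birkhoffSum, inner_smul_right, inner_sum, id, hinner]
  obtain ⟨c, hc⟩ : ∃ c : ℝ, (w : Ω → ℝ) =ᵐ[μ] fun _ => c := by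
    refine hT.ae_eq_const_of_ae_eq_comp_ae (Lp.aestronglyMeasurable w) ?_
    have := Lp.coeFn_compMeasurePreserving w hTm
    refine this.symm.trans ?_
    change (K w : Ω → ℝ) =ᵐ[μ] w
    rw [hwS]
  have hcu : inner ℝ u' w = c * ∫ x, u x ∂μ := by
    rw [L2.inner_def, ← integral_const_mul]
    refine integral_congr_ae ?_
    filter_upwards [hu.coeFn_toLp, hc] with x h1 h2
    simp only [u', h1, h2]
    simp
  have heS : e ∈ S := by
    change K e = e
    change Lp.compMeasurePreserving T hTm _ = _
    rw [Lp.toLp_compMeasurePreserving]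
    rfl
  have hcv : c = ∫ x, v x ∂μ := by
    have h1 : inner ℝ (v' - w) e = 0 := S.starProjection_inner_eq_zero v' e heS
    rw [inner_sub_left, sub_eq_zero] at h1
    have h2 : inner ℝ v' e = ∫ x, v x ∂μ := by
      rw [L2.inner_def]
      refine integral_congr_ae ?_
      filter_upwards [hv.coeFn_toLp, (memLp_const (1 : ℝ) : MemLp _ 2 μ).coeFn_toLp] with x h1 h2
      simp only [v', e, h1, h2]
      simp
    have h3 : inner ℝ w e = c := by
      rw [L2.inner_def]
      trans ∫ _, c ∂μ
      · refine integral_congr_ae ?_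
        filter_upwards [hc, (memLp_const (1 : ℝ) : MemLp _ 2 μ).coeFn_toLp] with x h1 h2
        simp only [e, h1, h2]
        simp
      · simp
    rw [← h2, h1, h3]
  rw [← hcv, mul_comm, ← hcu, h0]

end CondExpDynamics

section Tail

variable {X : Type*}

/-- The σ-algebra generated by the events `T^t x ∈ U i` with `t ≥ m i + j`. -/
abbrev tailAlg (T : X → X) (U : ℕ → Set X) (m : ℕ → ℕ) (j : ℕ) : MeasurableSpace X :=
  MeasurableSpace.generateFrom {s | ∃ i t, m i + j ≤ t ∧ s = T^[t] ⁻¹' U i}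

variable {T : X → X} {U : ℕ → Set X} {m : ℕ → ℕ}

lemma measurableSet_tailAlg {i j t : ℕ} (h : m i + j ≤ t) :
    MeasurableSet[tailAlg T U m j] (T^[t] ⁻¹' U i) :=
  MeasurableSpace.measurableSet_generateFrom ⟨i, t, h, rfl⟩

lemma tailAlg_le [MeasurableSpace X] (hT : Measurable T) (hU : ∀ i, MeasurableSet (U i)) (j : ℕ) :
    tailAlg T U m j ≤ ‹MeasurableSpace X› := by
  refine MeasurableSpace.generateFrom_le ?_
  rintro s ⟨i, t, -, rfl⟩
  exact hT.iterate t (hU i)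

lemma tailAlg_antitone : Antitone (tailAlg T U m) := fun j k hjk =>
  MeasurableSpace.generateFrom_mono fun _ ⟨i, t, h, hs⟩ => ⟨i, t, by omega, hs⟩

lemma comap_tailAlg (j : ℕ) : (tailAlg T U m j).comap T = tailAlg T U m (j + 1) := by
  rw [tailAlg, MeasurableSpace.comap_generateFrom, tailAlg]
  congr 1
  ext s
  constructor
  · rintro ⟨_, ⟨i, t, h, rfl⟩, rfl⟩
    exact ⟨i, t + 1, by omega, by rw [Function.iterate_succ, preimage_comp]⟩
  · rintro ⟨i, t, h, rfl⟩
    obtain ⟨t, rfl⟩ : ∃ t', t = t' + 1 := ⟨t - 1, by omega⟩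
    exact ⟨_, ⟨i, t, by omega, rfl⟩, by rw [Function.iterate_succ, preimage_comp]⟩

lemma comap_iInf_tailAlg (hT : Function.Surjective T) :
    (⨅ j, tailAlg T U m j).comap T = ⨅ j, tailAlg T U m j := by
  refine le_antisymm ?_ ?_
  · refine le_iInf fun j => (MeasurableSpace.comap_mono (iInf_le _ j)).trans ?_
    rw [comap_tailAlg]
    exact tailAlg_antitone (Nat.le_succ j)
  · intro s hs
    rw [MeasurableSpace.measurableSet_iInf] at hs
    have h : ∀ j, MeasurableSet[tailAlg T U m j] (T '' s) ∧ T ⁻¹' (T '' s) = s := fun j => by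
      have := hs (j + 1)
      rw [← comap_tailAlg] at this
      obtain ⟨t, ht, rfl⟩ := this
      rw [image_preimage_eq t hT]
      exact ⟨ht, rfl⟩
    exact ⟨T '' s, MeasurableSpace.measurableSet_iInf.2 fun j => (h j).1, (h 0).2⟩

lemma iInf_tailAlg_le [MeasurableSpace X] (hT : Measurable T) (hU : ∀ i, MeasurableSet (U i)) :
    ⨅ j, tailAlg T U m j ≤ ‹MeasurableSpace X› := (iInf_le _ 0).trans (tailAlg_le hT hU 0)

lemma mem_stableSet_of_forall_iff [MetricSpace X] [CompactSpace X]
    (hU : TopologicalSpace.IsTopologicalBasis (range U)) {j : ℕ} {x y : X}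
    (h : ∀ i t, m i + j ≤ t → (T^[t] x ∈ U i ↔ T^[t] y ∈ U i)) : y ∈ stableSet T x := by
  refine Metric.tendsto_atTop.2 fun ε hε => ?_
  have hex : ∀ z : X, ∃ i, z ∈ U i ∧ U i ⊆ Metric.ball z (ε / 2) := fun z => by
    obtain ⟨_, ⟨i, rfl⟩, hz, hi⟩ := hU.exists_subset_of_mem_open
      (Metric.mem_ball_self (half_pos hε)) (Metric.isOpen_ball (x := z))
    exact ⟨i, hz, hi⟩
  choose i hi hib using hex
  obtain ⟨s, hs⟩ := isCompact_univ.elim_finite_subcover (fun z => U (i z))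
    (fun z => hU.isOpen ⟨_, rfl⟩) fun z _ => mem_iUnion.2 ⟨z, hi z⟩
  refine ⟨s.sup (fun z => m (i z)) + j, fun t ht => ?_⟩
  obtain ⟨z, hz, hzt⟩ := mem_iUnion₂.1 (hs (mem_univ (T^[t] x)))
  have hmz : m (i z) ≤ s.sup (fun z => m (i z)) := Finset.le_sup (f := fun z => m (i z)) hz
  have hyt := (h (i z) t (by omega)).1 hzt
  have h1 := hib z hzt
  have h2 := hib z hyt
  rw [Metric.mem_ball] at h1 h2
  rw [Real.dist_eq, sub_zero, abs_of_nonneg dist_nonneg]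
  calc dist (T^[t] x) (T^[t] y) ≤ dist (T^[t] x) z + dist (T^[t] y) z := dist_triangle_right _ _ _
    _ < ε := by linarith

end Tail

section Kernel

open ProbabilityTheory

variable {X : Type*}

lemma ae_ae_condExpKernel_mem_iff {m m0 : MeasurableSpace X}
    [StandardBorelSpace X] {μ : Measure X} [IsProbabilityMeasure μ] (hm : m ≤ m0) {s : Set X}
    (hs : MeasurableSet[m] s) :
    ∀ᵐ x ∂μ, ∀ᵐ y ∂(condExpKernel μ m x), y ∈ s ↔ x ∈ s := by
  have h := condExpKernel_ae_eq_condExp (μ := μ) hm (hm s hs)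
  rw [condExp_of_stronglyMeasurable hm (stronglyMeasurable_const.indicator hs)
    (integrable_indicator_one (hm s hs))] at h
  filter_upwards [h] with x hx
  by_cases hxs : x ∈ s
  · have h1 : (condExpKernel μ m x).real s = 1 := by simpa [hxs] using hx
    have h2 : ∀ᵐ y ∂(condExpKernel μ m x), y ∈ s := by
      rw [measureReal_def, ENNReal.toReal_eq_one_iff] at h1
      exact (prob_compl_eq_zero_iff (hm s hs)).2 h1
    filter_upwards [h2] with y hy using by simp [hy, hxs]
  · have h1 : (condExpKernel μ m x).real s = 0 := by simpa [hxs] using hx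
    have h2 : ∀ᵐ y ∂(condExpKernel μ m x), y ∉ s := by
      rw [measureReal_eq_zero_iff] at h1
      exact measure_eq_zero_iff_ae_notMem.1 h1
    filter_upwards [h2] with y hy using by simp [hy, hxs]

/-- The support of a measure, computed with the basis `U`. -/
def suppSet [MeasurableSpace X] (U : ℕ → Set X) (ν : Measure X) : Set X :=
  {y | ∀ i, y ∈ U i → 0 < ν.real (U i)}

lemma compl_suppSet [MeasurableSpace X] (U : ℕ → Set X) (ν : Measure X) :
    (suppSet U ν)ᶜ = ⋃ i, ⋃ (_ : ν.real (U i) = 0), U i := by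
  ext y
  simp only [suppSet, mem_compl_iff, mem_ofPred_eq, not_forall, mem_iUnion, exists_prop, not_lt]
  exact exists_congr fun i => ⟨fun ⟨h1, h2⟩ => ⟨le_antisymm h2 measureReal_nonneg, h1⟩,
    fun ⟨h1, h2⟩ => ⟨h2, h1.le⟩⟩

lemma isClosed_suppSet [TopologicalSpace X] [MeasurableSpace X] {U : ℕ → Set X}
    (hU : ∀ i, IsOpen (U i)) (ν : Measure X) : IsClosed (suppSet U ν) := by
  rw [← isOpen_compl_iff, compl_suppSet]
  exact isOpen_iUnion fun i => isOpen_iUnion fun _ => hU i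

lemma measure_compl_suppSet [MeasurableSpace X] (U : ℕ → Set X) (ν : Measure X)
    [IsFiniteMeasure ν] : ν (suppSet U ν)ᶜ = 0 := by
  rw [compl_suppSet]
  exact measure_iUnion_null fun i => measure_iUnion_null fun h => (measureReal_eq_zero_iff (measure_ne_top _ _)).1 h

lemma inter_suppSet_nonempty [MeasurableSpace X] {U : ℕ → Set X} {ν : Measure X}
    [IsFiniteMeasure ν] {s : Set X} (hs : 0 < ν.real s) : (s ∩ suppSet U ν).Nonempty := by
  by_contra h
  have hsub : s ⊆ (suppSet U ν)ᶜ := fun y hy hyS => h ⟨y, hy, hyS⟩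
  have := measure_mono_null hsub (measure_compl_suppSet U ν)
  rw [measureReal_def, this] at hs
  simp at hs

variable [MetricSpace X] [CompactSpace X] [MeasurableSpace X] [BorelSpace X]

/-- The conditional measures of `μ` on the tail σ-algebra. -/
def tailKer (μ : Measure X) [IsFiniteMeasure μ] (T : X → X) (U : ℕ → Set X) (m : ℕ → ℕ) (x : X) :
    Measure X := condExpKernel μ (⨅ j, tailAlg T U m j) x

instance (μ : Measure X) [IsProbabilityMeasure μ] (T : X → X) (U : ℕ → Set X) (m : ℕ → ℕ) (x : X) :
    IsProbabilityMeasure (tailKer μ T U m x) := by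
  have : Nonempty X := ⟨x⟩
  unfold tailKer
  infer_instance

variable {μ : Measure X} [IsProbabilityMeasure μ] {T : X → X} {U : ℕ → Set X} {m : ℕ → ℕ}

lemma tailKer_real_ae_eq (hT : Measurable T) (hU : ∀ i, MeasurableSet (U i)) {s : Set X}
    (hs : MeasurableSet s) :
    (fun x => (tailKer μ T U m x).real s) =ᵐ[μ] cprob μ (⨅ j, tailAlg T U m j) s :=
  condExpKernel_ae_eq_condExp (iInf_tailAlg_le hT hU) hs

lemma integral_tailKer_ae_eq (hT : Measurable T) (hU : ∀ i, MeasurableSet (U i)) {g : X → ℝ}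
    (hg : Integrable g μ) :
    (fun x => ∫ y, g y ∂(tailKer μ T U m x)) =ᵐ[μ] μ[g|⨅ j, tailAlg T U m j] :=
  (condExp_ae_eq_integral_condExpKernel (iInf_tailAlg_le hT hU) hg).symm

lemma measurable_tailKer_real (hT : Measurable T) (hU : ∀ i, MeasurableSet (U i)) {s : Set X}
    (hs : MeasurableSet s) : Measurable fun x => (tailKer μ T U m x).real s :=
  ((measurable_condExpKernel (μ := μ) (m := ⨅ j, tailAlg T U m j) hs).mono
    (iInf_tailAlg_le hT hU) le_rfl).ennreal_toReal

lemma integral_tailKer_comp (hTs : Function.Surjective T) (hT : MeasurePreserving T μ μ)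
    (hU : ∀ i, MeasurableSet (U i)) {g : X → ℝ} (hg : Integrable g μ) :
    ∀ᵐ x ∂μ, ∫ y, g y ∂(tailKer μ T U m (T x)) = ∫ y, g (T y) ∂(tailKer μ T U m x) := by
  have h1 := integral_tailKer_ae_eq (m := m) hT.measurable hU hg
  have h2 := integral_tailKer_ae_eq (m := m) hT.measurable hU (hT.integrable_comp_of_integrable hg)
  have h3 := condExp_comp_comap hT (iInf_tailAlg_le (m := m) hT.measurable hU) hg
  rw [comap_iInf_tailAlg hTs] at h3
  filter_upwards [hT.quasiMeasurePreserving.ae h1, h2, h3] with x h1 h2 h3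
  rw [h1, ← Function.comp_apply (f := μ[g|⨅ j, tailAlg T U m j]), h3, ← h2]
  rfl

lemma tailKer_real_preimage (hTs : Function.Surjective T) (hT : MeasurePreserving T μ μ)
    (hU : ∀ i, MeasurableSet (U i)) {s : Set X} (hs : MeasurableSet s) :
    ∀ᵐ x ∂μ, (tailKer μ T U m (T x)).real s = (tailKer μ T U m x).real (T ⁻¹' s) := by
  filter_upwards [integral_tailKer_comp (m := m) hTs hT hU (integrable_indicator_one hs)] with x hx
  have h (y : X) : s.indicator (fun _ => (1 : ℝ)) (T y) = (T ⁻¹' s).indicator (fun _ => 1) y := rfl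
  simp only [h] at hx
  have h1 (ν : Measure X) {s : Set X} (hs : MeasurableSet s) :
      ∫ y, s.indicator (fun _ => (1 : ℝ)) y ∂ν = ν.real s := by
    rw [integral_indicator_const _ hs]; simp
  rwa [h1 _ hs, h1 _ (hT.measurable hs)] at hx

lemma tailKer_real_preimage_iterate (hTs : Function.Surjective T) (hT : MeasurePreserving T μ μ)
    (hU : ∀ i, MeasurableSet (U i)) {s : Set X} (hs : MeasurableSet s) (n : ℕ) :
    ∀ᵐ x ∂μ, (tailKer μ T U m (T^[n] x)).real s = (tailKer μ T U m x).real (T^[n] ⁻¹' s) := by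
  induction n with
  | zero => simp
  | succ n ih =>
    have h1 := tailKer_real_preimage (m := m) hTs hT hU (hT.measurable.iterate n hs)
    filter_upwards [hT.quasiMeasurePreserving.ae ih, h1] with x h1 h2
    rw [Function.iterate_succ_apply, h1, h2, Function.iterate_succ, preimage_comp]

lemma suppSet_tailKer_subset (hT : Measurable T)
    (hU : TopologicalSpace.IsTopologicalBasis (range U)) :
    ∀ᵐ x ∂μ, suppSet U (tailKer μ T U m x) ⊆ closure (stableSet T x) := by
  have hUm : ∀ i, MeasurableSet (U i) := fun i => (hU.isOpen ⟨i, rfl⟩).measurableSet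
  have hle := tailAlg_le (m := m) hT hUm
  have hj : ∀ᵐ x ∂μ, ∀ j i, cprob μ (tailAlg T U m j) (U i) x ≠ 0 →
      (U i ∩ stableSet T x).Nonempty := by
    refine ae_all_iff.2 fun j => ?_
    have h1 : ∀ᵐ x ∂μ, ∀ i t, m i + j ≤ t →
        ∀ᵐ y ∂(condExpKernel μ (tailAlg T U m j) x), y ∈ T^[t] ⁻¹' U i ↔ x ∈ T^[t] ⁻¹' U i := by
      simp only [ae_all_iff]
      exact fun i t h => ae_ae_condExpKernel_mem_iff (hle j) (measurableSet_tailAlg h)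
    have h2 : ∀ᵐ x ∂μ, ∀ i, (condExpKernel μ (tailAlg T U m j) x).real (U i) =
        cprob μ (tailAlg T U m j) (U i) x :=
      ae_all_iff.2 fun i => condExpKernel_ae_eq_condExp (hle j) (hUm i)
    filter_upwards [h1, h2] with x h1 h2 i hi
    rw [← h2 i] at hi
    have h3 : ∀ᵐ y ∂(condExpKernel μ (tailAlg T U m j) x), y ∈ stableSet T x := by
      have : ∀ᵐ y ∂(condExpKernel μ (tailAlg T U m j) x), ∀ i t, m i + j ≤ t →
          (y ∈ T^[t] ⁻¹' U i ↔ x ∈ T^[t] ⁻¹' U i) := by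
        simpa only [ae_all_iff] using h1
      filter_upwards [this] with y hy
      exact mem_stableSet_of_forall_iff (m := m) (j := j) hU fun i t h => (hy i t h).symm
    by_contra hne
    refine hi ((measureReal_eq_zero_iff (measure_ne_top _ _)).2 (measure_mono_null (fun y hy hyW => hne ⟨y, hy, hyW⟩) h3))
  have hlim : ∀ᵐ x ∂μ, ∀ i, ∃ φ : ℕ → ℕ,
      Tendsto (fun n => cprob μ (tailAlg T U m (φ n)) (U i) x) atTop
        (𝓝 (cprob μ (⨅ j, tailAlg T U m j) (U i) x)) := by
    refine ae_all_iff.2 fun i => ?_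
    have h := tendsto_eLpNorm_condExp_of_antitone (tailAlg_antitone (T := T) (U := U) (m := m)) hle
      ((memLp_const (1 : ℝ)).indicator (hUm i) : MemLp _ 2 μ)
    have hme := tendstoInMeasure_of_tendsto_eLpNorm (μ := μ) one_ne_zero
      (fun n => (stronglyMeasurable_condExp.mono (hle n)).aestronglyMeasurable)
      (stronglyMeasurable_condExp.mono (iInf_tailAlg_le hT hUm)).aestronglyMeasurable h
    obtain ⟨φ, -, hae⟩ := hme.exists_seq_tendsto_ae
    filter_upwards [hae] with x hx using ⟨φ, hx⟩
  have hker : ∀ᵐ x ∂μ, ∀ i, (tailKer μ T U m x).real (U i) =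
      cprob μ (⨅ j, tailAlg T U m j) (U i) x :=
    ae_all_iff.2 fun i => tailKer_real_ae_eq hT hUm (hUm i)
  filter_upwards [hj, hlim, hker] with x hj hlim hker y hy
  refine hU.mem_closure_iff.2 ?_
  rintro _ ⟨i, rfl⟩ hyi
  by_contra hne
  have hz : ∀ j, cprob μ (tailAlg T U m j) (U i) x = 0 := fun j => by
    by_contra h
    exact hne (hj j i h)
  obtain ⟨φ, hφ⟩ := hlim i
  simp only [hz] at hφ
  have h0 := tendsto_nhds_unique tendsto_const_nhds hφ
  have := hy i hyi
  rw [hker i, ← h0] at this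
  exact lt_irrefl _ this

lemma tendsto_integral_tailKer_decorrelation (hT : Measurable T)
    (hU : ∀ i, MeasurableSet (U i)) {A : Set X} (hA : MeasurableSet A) (i : ℕ) :
    Tendsto (fun n => ∫ x, |(tailKer μ T U m x).real (A ∩ T^[n] ⁻¹' U i) -
      (tailKer μ T U m x).real A * (tailKer μ T U m x).real (T^[n] ⁻¹' U i)| ∂μ) atTop (𝓝 0) := by
  have hle := tailAlg_le (m := m) hT hU
  have h := tendsto_eLpNorm_condExp_of_antitone (tailAlg_antitone (T := T) (U := U) (m := m)) hle
      ((memLp_const (1 : ℝ)).indicator hA : MemLp _ 2 μ)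
  have h' := h.comp (tendsto_sub_atTop_nat (m i))
  have hsq := tendsto_of_tendsto_of_tendsto_of_le_of_le' (g := fun _ => 0)
    (f := fun n => eLpNorm (cprob μ (⨅ j, tailAlg T U m j) (A ∩ T^[n] ⁻¹' U i) -
      cprob μ (⨅ j, tailAlg T U m j) A * cprob μ (⨅ j, tailAlg T U m j) (T^[n] ⁻¹' U i)) 1 μ)
    tendsto_const_nhds h'
    (Eventually.of_forall fun _ => zero_le) ?_
  · have h0 := (ENNReal.tendsto_toReal ENNReal.zero_ne_top).comp hsq
    rw [ENNReal.toReal_zero] at h0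
    refine h0.congr fun n => ?_
    have hB : MeasurableSet (T^[n] ⁻¹' U i) := hT.iterate n (hU i)
    rw [Function.comp_apply, eLpNorm_one_eq_lintegral_enorm,
      ← integral_norm_eq_lintegral_enorm]
    · refine integral_congr_ae ?_
      filter_upwards [tailKer_real_ae_eq (μ := μ) (m := m) hT hU (hA.inter hB),
        tailKer_real_ae_eq (μ := μ) (m := m) hT hU hA,
        tailKer_real_ae_eq (μ := μ) (m := m) hT hU hB] with x h1 h2 h3
      rw [h1, h2, h3]
      rfl
    · exact (integrable_condExp.aestronglyMeasurable.sub
        (integrable_condExp.aestronglyMeasurable.mul integrable_condExp.aestronglyMeasurable))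
  · filter_upwards [eventually_ge_atTop (m i)] with n hn
    exact eLpNorm_cprob_inter_sub_mul_le (iInf_le _ _) (hle _) hA
      (measurableSet_tailAlg (Nat.add_sub_of_le hn).le)

end Kernel

section Mixing

variable {X : Type*} [MetricSpace X] [CompactSpace X] [MeasurableSpace X] [BorelSpace X]
  {μ : Measure X} [IsProbabilityMeasure μ] {T : X → X} {U : ℕ → Set X} {m : ℕ → ℕ}

lemma ae_exists_forall_tailKer_inter_pos (hTs : Function.Surjective T) (hT : Ergodic T μ)
    (hU : ∀ i, MeasurableSet (U i)) (L : Finset (ℕ × ℕ)) (N : ℕ) :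
    ∀ᵐ x ∂μ, (∀ p ∈ L, 0 < (tailKer μ T U m x).real (U p.1) ∧
        0 < (tailKer μ T U m x).real (U p.2)) →
      ∃ n ≥ N, ∀ p ∈ L, 0 < (tailKer μ T U m x).real (U p.1 ∩ T^[n] ⁻¹' U p.2) := by
  have hTm := hT.measurable
  set κ := tailKer μ T U m with hκ
  have hmeas : ∀ {s}, MeasurableSet s → Measurable fun x => (κ x).real s := fun hs =>
    measurable_tailKer_real hTm hU hs
  have hB : ∀ n i, MeasurableSet (T^[n] ⁻¹' U i) := fun n i => hTm.iterate n (hU i)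
  let Bd : Set X := {x | ∀ n ≥ N, ∃ p ∈ L, (κ x).real (U p.1 ∩ T^[n] ⁻¹' U p.2) = 0}
  have hBd : MeasurableSet Bd := by
    have : Bd = ⋂ n, ⋂ (_ : n ≥ N), ⋃ p ∈ L,
        {x | (κ x).real (U p.1 ∩ T^[n] ⁻¹' U p.2) = 0} := by
      ext x; simp [Bd]
    rw [this]
    refine MeasurableSet.iInter fun n => MeasurableSet.iInter fun _ =>
      Finset.measurableSet_biUnion _ fun p _ => ?_
    exact measurableSet_eq_fun (hmeas ((hU _).inter (hB _ _))) measurable_const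
  let w : X → ℝ := fun x => ∏ p ∈ L, (κ x).real (U p.1)
  let v : X → ℝ := fun x => ∏ p ∈ L, (κ x).real (U p.2)
  have hwm : Measurable w := Finset.measurable_prod _ fun p _ => hmeas (hU _)
  have hvm : Measurable v := Finset.measurable_prod _ fun p _ => hmeas (hU _)
  have hw0 : ∀ x, 0 ≤ w x := fun x => Finset.prod_nonneg fun _ _ => measureReal_nonneg
  have hv0 : ∀ x, 0 ≤ v x := fun x => Finset.prod_nonneg fun _ _ => measureReal_nonneg
  have hw1 : ∀ x, w x ≤ 1 := fun x =>
    Finset.prod_le_one (fun _ _ => measureReal_nonneg) fun _ _ => measureReal_le_one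
  have hv1 : ∀ x, v x ≤ 1 := fun x =>
    Finset.prod_le_one (fun _ _ => measureReal_nonneg) fun _ _ => measureReal_le_one
  have hv2 : MemLp v 2 μ := MemLp.of_bound hvm.aestronglyMeasurable 1
    (Eventually.of_forall fun x => by rw [Real.norm_of_nonneg (hv0 x)]; exact hv1 x)
  have hw2 : MemLp w 2 μ := MemLp.of_bound hwm.aestronglyMeasurable 1
    (Eventually.of_forall fun x => by rw [Real.norm_of_nonneg (hw0 x)]; exact hw1 x)
  have hu2 : MemLp (Bd.indicator w) 2 μ := hw2.indicator hBd
  let D : ℕ → ℕ × ℕ → X → ℝ := fun n p x => |(κ x).real (U p.1 ∩ T^[n] ⁻¹' U p.2) -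
      (κ x).real (U p.1) * (κ x).real (T^[n] ⁻¹' U p.2)|
  have hDm : ∀ n p, Measurable (D n p) := fun n p =>
    ((hmeas ((hU _).inter (hB _ _))).sub ((hmeas (hU _)).mul (hmeas (hB _ _)))).abs
  have hDi : ∀ n p, Integrable (D n p) μ := fun n p => by
    refine Integrable.of_bound (hDm n p).aestronglyMeasurable 1 (Eventually.of_forall fun x => ?_)
    rw [Real.norm_eq_abs, abs_abs, abs_le]
    have h1 : (κ x).real (U p.1 ∩ T^[n] ⁻¹' U p.2) ∈ Icc 0 1 :=
      ⟨measureReal_nonneg, measureReal_le_one⟩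
    have h2 : (κ x).real (U p.1) * (κ x).real (T^[n] ⁻¹' U p.2) ∈ Icc 0 1 :=
      ⟨by positivity, mul_le_one₀ measureReal_le_one measureReal_nonneg measureReal_le_one⟩
    constructor <;> linarith [h1.1, h1.2, h2.1, h2.2]
  have hDlim : Tendsto (fun n => ∑ p ∈ L, ∫ x, D n p x ∂μ) atTop (𝓝 0) := by
    have := tendsto_finsetSum (x := atTop) (f := fun p n => ∫ x, D n p x ∂μ) (a := fun _ => 0) L
      fun p _ => tendsto_integral_tailKer_decorrelation hTm hU (hU p.1) p.2
    simpa using this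
  have hle : ∀ n ≥ N, ∀ᵐ x ∂μ, Bd.indicator w x * v (T^[n] x) ≤ ∑ p ∈ L, D n p x := by
    intro n hn
    have heq : ∀ᵐ x ∂μ, ∀ i, (κ (T^[n] x)).real (U i) = (κ x).real (T^[n] ⁻¹' U i) :=
      ae_all_iff.2 fun i => tailKer_real_preimage_iterate hTs hT.toMeasurePreserving hU (hU i) n
    filter_upwards [heq] with x hx
    have hD0 : 0 ≤ ∑ p ∈ L, D n p x := Finset.sum_nonneg fun _ _ => abs_nonneg _
    by_cases hxB : x ∈ Bd
    · rw [indicator_of_mem hxB]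
      obtain ⟨p, hp, hpz⟩ := hxB n hn
      have h1 : w x * v (T^[n] x) =
          ∏ p ∈ L, ((κ x).real (U p.1) * (κ x).real (T^[n] ⁻¹' U p.2)) := by
        simp only [w, v, hx, Finset.prod_mul_distrib]
      have h2 : D n p x = (κ x).real (U p.1) * (κ x).real (T^[n] ⁻¹' U p.2) := by
        simp only [D, hpz, zero_sub, abs_neg]
        exact abs_of_nonneg (by positivity)
      calc _ = _ := h1
        _ ≤ (κ x).real (U p.1) * (κ x).real (T^[n] ⁻¹' U p.2) := by
          rw [← Finset.mul_prod_erase _ _ hp]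
          refine mul_le_of_le_one_right (by positivity)
            (Finset.prod_le_one (fun _ _ => by positivity) fun _ _ => ?_)
          exact mul_le_one₀ measureReal_le_one measureReal_nonneg measureReal_le_one
        _ = D n p x := h2.symm
        _ ≤ _ := Finset.single_le_sum (f := fun p => D n p x) (fun _ _ => abs_nonneg _) hp
    · rw [indicator_of_notMem hxB, zero_mul]
      exact hD0
  have hlim : Tendsto (fun n => ∫ x, Bd.indicator w x * v (T^[n] x) ∂μ) atTop (𝓝 0) := by
    refine tendsto_of_tendsto_of_tendsto_of_le_of_le' tendsto_const_nhds hDlim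
      (Eventually.of_forall fun n => integral_nonneg fun x =>
        mul_nonneg (indicator_nonneg (fun x _ => hw0 x) x) (hv0 _)) ?_
    filter_upwards [eventually_ge_atTop N] with n hn
    rw [← integral_finsetSum _ fun p _ => hDi n p]
    refine integral_mono_of_nonneg (Eventually.of_forall fun x =>
        mul_nonneg (indicator_nonneg (fun x _ => hw0 x) x) (hv0 _))
        (integrable_finsetSum _ fun p _ => hDi n p) (hle n hn)
  have hzero := hT.integral_mul_integral_eq_zero hu2 hv2 hlim
  rcases mul_eq_zero.1 hzero with h | h
  · rw [integral_eq_zero_iff_of_nonneg (indicator_nonneg fun x _ => hw0 x)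
      (hu2.integrable (by norm_num))] at h
    filter_upwards [h] with x hx hpos
    by_contra hcon
    have hxB : x ∈ Bd := fun n hn => by
      by_contra h
      refine hcon ⟨n, hn, fun p hp => lt_of_le_of_ne measureReal_nonneg fun h0 => h ⟨p, hp, h0.symm⟩⟩
    rw [indicator_of_mem hxB] at hx
    exact (Finset.prod_pos fun p hp => (hpos p hp).1).ne' hx
  · rw [integral_eq_zero_iff_of_nonneg hv0 (hv2.integrable (by norm_num))] at h
    filter_upwards [h] with x hx hpos
    exact absurd hx (Finset.prod_pos fun p hp => (hpos p hp).2).ne'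

lemma ae_hasMixingTimes (hTs : Function.Surjective T) (hT : Ergodic T μ)
    (hU : ∀ i, MeasurableSet (U i)) :
    ∀ᵐ x ∂μ, HasMixingTimes T (suppSet U (tailKer μ T U m x)) U := by
  have h : ∀ᵐ x ∂μ, ∀ (L : Finset (ℕ × ℕ)) (N : ℕ), (∀ p ∈ L, 0 < (tailKer μ T U m x).real (U p.1) ∧
        0 < (tailKer μ T U m x).real (U p.2)) →
      ∃ n ≥ N, ∀ p ∈ L, 0 < (tailKer μ T U m x).real (U p.1 ∩ T^[n] ⁻¹' U p.2) := by
    simp only [ae_all_iff]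
    exact fun L N => ae_exists_forall_tailKer_inter_pos hTs hT hU L N
  filter_upwards [h] with x hx L hL N
  obtain ⟨n, hn, hpos⟩ := hx L N fun p hp =>
    ⟨(hL p hp).1.elim fun y hy => hy.2 _ hy.1, (hL p hp).2.elim fun y hy => hy.2 _ hy.1⟩
  refine ⟨n, hn, fun p hp => ?_⟩
  obtain ⟨y, ⟨hy1, hy2⟩, hyS⟩ := inter_suppSet_nonempty (U := U) (hpos p hp)
  exact ⟨y, hyS, hy1, hy2⟩

end Mixing

section EventAlgebras

variable {Ω : Type*}

lemma iSup_comap_jointEvents (ξ : ℕ × ℕ → Ω → Prop) (S : ℕ → Finset (ℕ × ℕ)) :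
    ⨆ n, MeasurableSpace.comap (jointEvents ξ (S n)) inferInstance =
      MeasurableSpace.generateFrom {s | ∃ n, ∃ p ∈ S n, s = {x | ξ p x}} := by
  refine le_antisymm (iSup_le fun n => ?_) (MeasurableSpace.generateFrom_le ?_)
  · rw [← measurable_iff_comap_le]
    let m := MeasurableSpace.generateFrom {s | ∃ n, ∃ p ∈ S n, s = {x | ξ p x}}
    refine measurable_pi_iff.2 fun p => measurableSet_setOfPred.1
      (MeasurableSpace.measurableSet_generateFrom ⟨n, p, p.2, rfl⟩)
  · rintro _ ⟨n, p, hp, rfl⟩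
    refine MeasurableSpace.le_def.1 (le_iSup (fun n => MeasurableSpace.comap
      (jointEvents ξ (S n)) inferInstance) n) _ ⟨{w | w ⟨p, hp⟩}, ?_, rfl⟩
    exact measurableSet_setOfPred.2 (measurable_pi_apply _)

lemma monotone_comap_jointEvents (ξ : ℕ × ℕ → Ω → Prop) {S : ℕ → Finset (ℕ × ℕ)}
    (hS : Monotone S) :
    Monotone fun n => MeasurableSpace.comap (jointEvents ξ (S n)) inferInstance := by
  intro a b hab
  have hf : Measurable fun (w : S b → Prop) (p : S a) => w ⟨p.1, hS hab p.2⟩ :=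
    measurable_of_finite _
  exact ((hf.comp (comap_measurable (jointEvents ξ (S b))))).comap_le

end EventAlgebras

section FiniteConditioning

variable {Ω ι κ : Type*} [MeasurableSpace Ω] {μ : Measure Ω} [IsProbabilityMeasure μ]
  [Fintype ι] [MeasurableSpace ι] [MeasurableSingletonClass ι]
  [Fintype κ] [MeasurableSpace κ] [MeasurableSingletonClass κ]

lemma integral_comp_fintype {Z : Ω → κ} (hZ : Measurable Z) (g : κ → ℝ) (t : Set Ω) :
    ∫ x in t, g (Z x) ∂μ = ∑ z, μ.real (Z ⁻¹' {z} ∩ t) * g z := by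
  have h : ∫ x in t, g (Z x) ∂μ = ∫ z, g z ∂((μ.restrict t).map Z) :=
    (integral_map hZ.aemeasurable (measurable_of_finite g).aestronglyMeasurable).symm
  have : IsFiniteMeasure ((μ.restrict t).map Z) := Measure.isFiniteMeasure_map _ _
  rw [h, integral_fintype .of_finite]
  refine Finset.sum_congr rfl fun z _ => ?_
  rw [map_measureReal_apply hZ (measurableSet_singleton z),
    measureReal_restrict_apply (hZ (measurableSet_singleton z)), smul_eq_mul]

lemma cprob_comap_fintype {Z : Ω → κ} (hZ : Measurable Z) {s : Set Ω} (hs : MeasurableSet s) :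
    cprob μ (MeasurableSpace.comap Z inferInstance) s =ᵐ[μ]
      fun x => μ.real (Z ⁻¹' {Z x} ∩ s) / μ.real (Z ⁻¹' {Z x}) := by
  have hg : Measurable fun z => μ.real (Z ⁻¹' {z} ∩ s) / μ.real (Z ⁻¹' {z}) :=
    measurable_of_finite _
  have hle := hZ.comap_le
  have hbd : ∀ x, ‖μ.real (Z ⁻¹' {Z x} ∩ s) / μ.real (Z ⁻¹' {Z x})‖ ≤ 1 := fun x => by
    rw [Real.norm_of_nonneg (by positivity)]
    exact div_le_one_of_le₀ (measureReal_mono inter_subset_left) measureReal_nonneg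
  have h_int : Integrable (fun x => μ.real (Z ⁻¹' {Z x} ∩ s) / μ.real (Z ⁻¹' {Z x})) μ :=
    Integrable.of_bound (hg.comp hZ).aestronglyMeasurable 1 (Eventually.of_forall hbd)
  symm
  refine ae_eq_condExp_of_forall_setIntegral_eq hle (integrable_indicator_one hs)
    (fun _ _ _ => h_int.integrableOn) ?_ ?_
  · rintro _ ⟨t, ht, rfl⟩ -
    rw [integral_comp_fintype hZ (fun z => μ.real (Z ⁻¹' {z} ∩ s) / μ.real (Z ⁻¹' {z})) _,
      setIntegral_indicator hs, setIntegral_const, smul_eq_mul, mul_one]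
    have h1 : ∫ x in Z ⁻¹' t ∩ s, (1 : ℝ) ∂μ = ∑ z, μ.real (Z ⁻¹' {z} ∩ (Z ⁻¹' t ∩ s)) * 1 :=
      integral_comp_fintype hZ (fun _ => 1) _
    rw [setIntegral_const, smul_eq_mul, mul_one] at h1
    rw [h1]
    refine Finset.sum_congr rfl fun z _ => ?_
    by_cases hz : z ∈ t
    · have e1 : Z ⁻¹' {z} ∩ Z ⁻¹' t = Z ⁻¹' {z} :=
        inter_eq_left.2 fun x hx => by rw [mem_preimage, mem_singleton_iff] at hx; simpa [hx]
      rw [← inter_assoc, e1, mul_one]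
      by_cases h0 : μ.real (Z ⁻¹' {z}) = 0
      · rw [h0, zero_mul]
        exact (measureReal_mono_null inter_subset_left h0).symm
      · field_simp
    · have e1 : Z ⁻¹' {z} ∩ Z ⁻¹' t = ∅ :=
        eq_empty_of_forall_notMem fun x hx => hz (by
          have := hx.1; rw [mem_preimage, mem_singleton_iff] at this; rw [← this]; exact hx.2)
      rw [← inter_assoc, e1]
      simp
  · exact (hg.comp (comap_measurable Z)).stronglyMeasurable.aestronglyMeasurable

lemma condEnt_comap_fintype {Y : Ω → ι} (hY : Measurable Y) {Z : Ω → κ} (hZ : Measurable Z) :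
    condEnt μ (MeasurableSpace.comap Z inferInstance) Y =
      rvEnt μ (fun x => (Y x, Z x)) - rvEnt μ Z := by
  have h1 : ∀ i, ∫ x, Real.negMulLog
      (cprob μ (MeasurableSpace.comap Z inferInstance) (Y ⁻¹' {i}) x) ∂μ =
      ∑ z, μ.real (Z ⁻¹' {z}) *
        Real.negMulLog (μ.real (Z ⁻¹' {z} ∩ Y ⁻¹' {i}) / μ.real (Z ⁻¹' {z})) := fun i => by
    have h2 := cprob_comap_fintype (μ := μ) hZ (hY (measurableSet_singleton i))
    rw [integral_congr_ae (g := fun x => Real.negMulLog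
      (μ.real (Z ⁻¹' {Z x} ∩ Y ⁻¹' {i}) / μ.real (Z ⁻¹' {Z x})))
      (h2.mono fun x hx => by simp only [hx])]
    have := integral_comp_fintype (μ := μ) hZ (fun z => Real.negMulLog
      (μ.real (Z ⁻¹' {z} ∩ Y ⁻¹' {i}) / μ.real (Z ⁻¹' {z}))) univ
    simpa using this
  have h2 : ∀ i z, μ.real (Z ⁻¹' {z}) *
      Real.negMulLog (μ.real (Z ⁻¹' {z} ∩ Y ⁻¹' {i}) / μ.real (Z ⁻¹' {z})) =
      Real.negMulLog (μ.real (Z ⁻¹' {z} ∩ Y ⁻¹' {i})) +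
        μ.real (Z ⁻¹' {z} ∩ Y ⁻¹' {i}) * Real.log (μ.real (Z ⁻¹' {z})) := fun i z => by
    by_cases h0 : μ.real (Z ⁻¹' {z}) = 0
    · have h0' : μ.real (Z ⁻¹' {z} ∩ Y ⁻¹' {i}) = 0 := measureReal_mono_null inter_subset_left h0
      simp [h0, h0']
    by_cases h0' : μ.real (Z ⁻¹' {z} ∩ Y ⁻¹' {i}) = 0
    · simp [h0']
    rw [Real.negMulLog, Real.negMulLog, Real.log_div h0' h0]
    field_simp
    ring
  have h3 : ∀ z, ∑ i, μ.real (Z ⁻¹' {z} ∩ Y ⁻¹' {i}) = μ.real (Z ⁻¹' {z}) := fun z => by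
    have := integral_comp_fintype (μ := μ) hY (fun _ => 1) (Z ⁻¹' {z})
    rw [setIntegral_const, smul_eq_mul, mul_one] at this
    rw [this]
    exact Finset.sum_congr rfl fun i _ => by rw [inter_comm, mul_one]
  have h4 : rvEnt μ (fun x => (Y x, Z x)) =
      ∑ z, ∑ i, Real.negMulLog (μ.real (Z ⁻¹' {z} ∩ Y ⁻¹' {i})) := by
    rw [rvEnt, Fintype.sum_prod_type_right]
    refine Finset.sum_congr rfl fun z _ => Finset.sum_congr rfl fun i _ => ?_
    congr 2
    ext x
    simp [and_comm]
  have h5 : rvEnt μ Z = -∑ z, ∑ i, μ.real (Z ⁻¹' {z} ∩ Y ⁻¹' {i}) *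
      Real.log (μ.real (Z ⁻¹' {z})) := by
    rw [rvEnt, ← Finset.sum_neg_distrib]
    refine Finset.sum_congr rfl fun z _ => ?_
    rw [← Finset.sum_mul, h3, Real.negMulLog, neg_mul]
  rw [condEnt, h4, h5, sub_neg_eq_add, ← Finset.sum_add_distrib, Finset.sum_congr rfl fun i _ => h1 i,
    Finset.sum_comm]
  refine Finset.sum_congr rfl fun z _ => ?_
  rw [← Finset.sum_add_distrib]
  exact Finset.sum_congr rfl fun i _ => h2 i z

end FiniteConditioning

section Visits

variable {X : Type*} {T : X → X} {U : ℕ → Set X} {m : ℕ → ℕ}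

/-- The event that the orbit is in `U i` at time `t`. -/
def visits (T : X → X) (U : ℕ → Set X) (p : ℕ × ℕ) (x : X) : Prop := T^[p.2] x ∈ U p.1

variable [MeasurableSpace X] {μ : Measure X} [IsProbabilityMeasure μ]

lemma measurable_visits (hT : Measurable T) (hU : ∀ i, MeasurableSet (U i)) (p : ℕ × ℕ) :
    Measurable (visits T U p) := measurableSet_setOfPred.1 (hT.iterate p.2 (hU p.1))

lemma eventEnt_timeShift (hT : Measurable T) (hU : ∀ i, MeasurableSet (U i))
    (S : Finset (ℕ × ℕ)) :
    eventEnt μ (visits T U) (timeShift 1 S) =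
      rvEnt μ (fun x => jointEvents (visits T U) S (T x)) := by
  have hv := measurable_visits hT hU
  have h1 : ∀ p : timeShift 1 S, ∃ q : S, (p : ℕ × ℕ) = (q.1.1, q.1.2 + 1) := by
    rintro ⟨p, hp⟩
    obtain ⟨q, hq, rfl⟩ := Finset.mem_image.1 hp
    exact ⟨⟨q, hq⟩, rfl⟩
  choose q hq using h1
  refine le_antisymm ?_ ?_
  · refine rvEnt_le_of_factors ((measurable_jointEvents hv S).comp hT)
      (fun w p => w (q p)) fun x => funext fun p => ?_
    change (T^[p.1.2] x ∈ U p.1.1) = (T^[(q p).1.2] (T x) ∈ U (q p).1.1)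
    rw [hq p, Function.iterate_succ_apply]
  · refine rvEnt_le_of_factors (measurable_jointEvents hv (timeShift 1 S))
      (fun w p => w ⟨(p.1.1, p.1.2 + 1), Finset.mem_image_of_mem _ p.2⟩) fun x => rfl

lemma isShiftPolymatroid_eventEnt_visits (hT : MeasurePreserving T μ μ)
    (hU : ∀ i, MeasurableSet (U i)) : IsShiftPolymatroid (eventEnt μ (visits T U)) where
  empty := eventEnt_empty (measurable_visits hT.measurable hU)
  mono h := eventEnt_mono (measurable_visits hT.measurable hU) h
  submod := eventEnt_submod (measurable_visits hT.measurable hU)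
  shift_one S := by
    rw [eventEnt_timeShift hT.measurable hU, eventEnt, rvEnt, rvEnt]
    refine Finset.sum_congr rfl fun w _ => ?_
    congr 1
    exact hT.measureReal_preimage (measurable_jointEvents (measurable_visits hT.measurable hU) S
      (measurableSet_singleton w)).nullMeasurableSet

lemma eventEnt_union_sub_le_condEnt {ξ : ℕ × ℕ → X → Prop} (hξ : ∀ p, Measurable (ξ p))
    (S S' : Finset (ℕ × ℕ)) :
    eventEnt μ ξ (S ∪ S') - eventEnt μ ξ S' ≤
      condEnt μ (MeasurableSpace.comap (jointEvents ξ S') inferInstance) (jointEvents ξ S) := by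
  rw [condEnt_comap_fintype (measurable_jointEvents hξ S) (measurable_jointEvents hξ S')]
  refine sub_le_sub_right (eventEnt_union_le_prod hξ (measurable_jointEvents hξ S') _ _
    fun p hp => ?_) _
  rcases Finset.mem_union.1 hp with hp | hp
  · exact Or.inl hp
  · exact Or.inr ⟨fun w => w ⟨p, hp⟩, fun _ => rfl⟩

lemma le_condEnt_tailAlg (hT : Measurable T) (hU : ∀ i, MeasurableSet (U i))
    {S : Finset (ℕ × ℕ)} {c : ℝ} {j : ℕ}
    (h : ∀ S' : Finset (ℕ × ℕ), (∀ p ∈ S', m p.1 + j ≤ p.2) →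
      c ≤ eventEnt μ (visits T U) (S ∪ S') - eventEnt μ (visits T U) S') :
    c ≤ condEnt μ (tailAlg T U m j) (jointEvents (visits T U) S) := by
  have hv := measurable_visits hT hU
  let R : ℕ → Finset (ℕ × ℕ) := fun n =>
    (Finset.range n ×ˢ Finset.range n).filter fun p => m p.1 + j ≤ p.2
  have hR : Monotone R := fun a b hab p hp => by
    simp only [R, Finset.mem_filter, Finset.mem_product, Finset.mem_range] at hp ⊢
    omega
  have heq : ⨆ n, MeasurableSpace.comap (jointEvents (visits T U) (R n)) inferInstance =
      tailAlg T U m j := by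
    rw [iSup_comap_jointEvents, tailAlg]
    congr 1
    ext s
    constructor
    · rintro ⟨n, p, hp, rfl⟩
      exact ⟨p.1, p.2, (Finset.mem_filter.1 hp).2, rfl⟩
    · rintro ⟨i, t, hit, rfl⟩
      refine ⟨max i t + 1, (i, t), ?_, rfl⟩
      simp only [R, Finset.mem_filter, Finset.mem_product, Finset.mem_range]
      omega
  rw [← heq]
  refine ge_of_tendsto' (tendsto_condEnt_iSup (monotone_comap_jointEvents (visits T U) hR)
    (fun n => (measurable_jointEvents hv (R n)).comap_le) (measurable_jointEvents hv S)) fun n => ?_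
  exact (h (R n) fun p hp => (Finset.mem_filter.1 hp).2).trans
    (eventEnt_union_sub_le_condEnt hv S (R n))

end Visits

section TailEntropy

variable {X : Type*} [MetricSpace X] [CompactSpace X] [MeasurableSpace X] [BorelSpace X]
  {μ : Measure X} [IsProbabilityMeasure μ] {T : X → X} {U : ℕ → Set X} {m : ℕ → ℕ}

lemma integral_rvEnt_tailKer (hT : Measurable T) (hU : ∀ i, MeasurableSet (U i))
    {ι : Type*} [Fintype ι] [MeasurableSpace ι] [MeasurableSingletonClass ι] {Y : X → ι}
    (hY : Measurable Y) :
    ∫ x, rvEnt (tailKer μ T U m x) Y ∂μ = condEnt μ (⨅ j, tailAlg T U m j) Y := by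
  have h : ∀ i, ∀ᵐ x ∂μ, Real.negMulLog ((tailKer μ T U m x).real (Y ⁻¹' {i})) =
      Real.negMulLog (cprob μ (⨅ j, tailAlg T U m j) (Y ⁻¹' {i}) x) := fun i =>
    (tailKer_real_ae_eq hT hU (hY (measurableSet_singleton i))).mono fun x hx => by rw [← hx]
  simp only [rvEnt]
  rw [condEnt, integral_finsetSum]
  · exact Finset.sum_congr rfl fun i _ => integral_congr_ae (h i)
  · intro i _
    obtain ⟨M, hM⟩ := (isCompact_Icc (a := (0 : ℝ)) (b := 1)).exists_bound_of_continuousOn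
      Real.continuous_negMulLog.continuousOn
    exact Integrable.of_bound (Real.continuous_negMulLog.measurable.comp
      (measurable_tailKer_real hT hU (hY (measurableSet_singleton i)))).aestronglyMeasurable M
      (Eventually.of_forall fun x => hM _ ⟨measureReal_nonneg, measureReal_le_one⟩)

lemma le_integral_eventEnt_tailKer (hT : Measurable T) (hU : ∀ i, MeasurableSet (U i))
    {S : Finset (ℕ × ℕ)} {c : ℝ} {n : ℕ}
    (h : ∀ S' : Finset (ℕ × ℕ), (∀ p ∈ S', m p.1 + n ≤ p.2) →
      c ≤ eventEnt μ (visits T U) (S ∪ S') - eventEnt μ (visits T U) S') :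
    c ≤ ∫ x, eventEnt (tailKer μ T U m x) (visits T U) S ∂μ := by
  have hY := measurable_jointEvents (measurable_visits hT hU) S
  refine le_of_le_of_eq ?_ (integral_rvEnt_tailKer hT hU hY).symm
  refine ge_of_tendsto (tendsto_condEnt_iInf tailAlg_antitone (tailAlg_le hT hU) hY) ?_
  filter_upwards [eventually_ge_atTop n] with j hj
  exact le_condEnt_tailAlg hT hU fun S' hS' => h S' fun p hp => by have := hS' p hp; omega

end TailEntropy

section AlmostInvariant

variable {Ω : Type*} [MeasurableSpace Ω] {μ : Measure Ω} [IsProbabilityMeasure μ]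

lemma Ergodic.ae_frequently_lt_of_lt_integral {T : Ω → Ω} (hT : Ergodic T μ) {g : ℕ → Ω → ℝ}
    (hg : ∀ n, Measurable (g n)) {M C c : ℝ} (hM : ∀ n x, |g n x| ≤ M)
    (hC : ∀ᵐ x ∂μ, ∀ n : ℕ, |g n (T x) - g n x| ≤ C / n) (hc : ∀ n ≥ 1, c ≤ ∫ x, g n x ∂μ) :
    ∀ c' < c, ∀ᵐ x ∂μ, ∃ᶠ n in atTop, c' < g n x := by
  intro c' hc'
  let Z : Set Ω := {x | ∃ q : ℚ, c' < q ∧ ∃ᶠ n in atTop, (q : ℝ) < g n x}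
  have hZ : MeasurableSet Z := by
    have : Z = ⋃ q : ℚ, ⋃ (_ : c' < q), ⋂ a : ℕ, ⋃ b : ℕ, ⋃ (_ : b ≥ a),
        {x | (q : ℝ) < g b x} := by
      ext x
      simp [Z, frequently_atTop]
    rw [this]
    exact MeasurableSet.iUnion fun q => MeasurableSet.iUnion fun _ => MeasurableSet.iInter fun a =>
      MeasurableSet.iUnion fun b => MeasurableSet.iUnion fun _ =>
        measurableSet_lt measurable_const (hg b)
  have hinv : Z ≤ᵐ[μ] T ⁻¹' Z := by
    filter_upwards [hC] with x hx hxZ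
    obtain ⟨q, hq, hfreq⟩ := hxZ
    obtain ⟨q', hq'1, hq'2⟩ := exists_rat_btwn hq
    refine ⟨q', hq'1, ?_⟩
    have hlim : Tendsto (fun n : ℕ => C / n) atTop (𝓝 0) := tendsto_const_div_atTop_nhds_zero_nat C
    refine (hfreq.and_eventually (hlim.eventually_lt_const (sub_pos.2 hq'2))).mono fun n hn => ?_
    have := (abs_le.1 (hx n)).1
    linarith [hn.1, hn.2]
  rcases hT.ae_empty_or_univ_of_ae_le_preimage hZ.nullMeasurableSet hinv
    with h | h
  · exfalso
    have hae : ∀ᵐ x ∂μ, Tendsto (fun n => max (g n x - c') 0) atTop (𝓝 0) := by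
      filter_upwards [h] with x hx
      have hxZ : x ∉ Z := fun hxZ => (iff_of_eq hx).1 hxZ
      refine tendsto_order.2 ⟨fun a ha => Eventually.of_forall fun n =>
        ha.trans_le (le_max_right _ _), fun a ha => ?_⟩
      obtain ⟨q, hq1, hq2⟩ := exists_rat_btwn (show c' < c' + a by linarith)
      have : ¬ ∃ᶠ n in atTop, (q : ℝ) < g n x := fun hf => hxZ ⟨q, hq1, hf⟩
      filter_upwards [not_frequently.1 this] with n hn
      exact max_lt (by linarith [not_lt.1 hn]) ha
    have h_int : ∀ n, Integrable (fun x => max (g n x - c') 0) μ := fun n =>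
      Integrable.of_bound (((hg n).sub_const c').max measurable_const).aestronglyMeasurable
        (M + |c'|) (Eventually.of_forall fun x => by
          have h1 := abs_le.1 (hM n x)
          have h2 := neg_abs_le c'
          rw [Real.norm_of_nonneg (le_max_right _ _)]
          refine max_le (by linarith [h1.2]) ?_
          linarith [h1.1, h1.2, abs_nonneg c'])
    have hlim := tendsto_integral_of_dominated_convergence (μ := μ)
      (F := fun n x => max (g n x - c') 0) (f := fun _ => 0) (fun _ => M + |c'|)
      (fun n => (h_int n).aestronglyMeasurable) (integrable_const _)
      (fun n => Eventually.of_forall fun x => by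
          have h1 := abs_le.1 (hM n x)
          have h2 := neg_abs_le c'
          rw [Real.norm_of_nonneg (le_max_right _ _)]
          refine max_le (by linarith [h1.2]) ?_
          linarith [h1.1, h1.2, abs_nonneg c']) hae
    rw [integral_zero] at hlim
    have hgi : ∀ n, Integrable (g n) μ := fun n =>
      Integrable.of_bound (hg n).aestronglyMeasurable M (Eventually.of_forall (hM n))
    have : c - c' ≤ 0 := by
      refine ge_of_tendsto hlim ?_
      filter_upwards [eventually_ge_atTop 1] with n hn
      calc c - c' ≤ ∫ x, g n x ∂μ - c' := sub_le_sub_right (hc n hn) c'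
        _ = ∫ x, (g n x - c') ∂μ := by
          rw [integral_sub (hgi n) (integrable_const _)]; simp
        _ ≤ _ := integral_mono ((hgi n).sub (integrable_const _)) (h_int n)
          fun x => le_max_left _ _
    linarith
  · filter_upwards [h] with x hx
    have hxZ : x ∈ Z := (iff_of_eq hx).2 trivial
    obtain ⟨q, hq, hf⟩ := hxZ
    exact hf.mono fun n hn => hq.trans hn

end AlmostInvariant

section TailGrowth

variable {X : Type*}

lemma birk_comp_sub (T : X → X) (F : X → ℝ) (n : ℕ) (x : X) :
    birk T F n (T x) - birk T F n x = F (T^[n] x) - F x := by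
  have h1 := Finset.sum_range_succ (fun j => F (T^[j] x)) n
  have h2 := Finset.sum_range_succ' (fun j => F (T^[j] x)) n
  simp only [birk, ← Function.iterate_succ_apply]
  simp only [Function.iterate_zero, id] at h2
  linarith

lemma abs_birk_le {T : X → X} {F : X → ℝ} {M : ℝ} (hM : ∀ x, |F x| ≤ M) (n : ℕ) (x : X) :
    |birk T F n x| ≤ n * M := by
  refine (Finset.abs_sum_le_sum_abs _ _).trans ((Finset.sum_le_sum fun j _ => hM _).trans ?_)
  simp

variable [MeasurableSpace X]

lemma measurable_birk {T : X → X} (hT : Measurable T) {F : X → ℝ} (hF : Measurable F) (n : ℕ) :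
    Measurable (birk T F n) := Finset.measurable_fun_sum _ fun j _ => hF.comp (hT.iterate j)

lemma integral_birk {μ : Measure X} {T : X → X} (hT : MeasurePreserving T μ μ) {F : X → ℝ}
    (hF : Integrable F μ) (n : ℕ) : ∫ x, birk T F n x ∂μ = n * ∫ x, F x ∂μ := by
  simp only [birk]
  have hi : ∀ j ∈ Finset.range n, Integrable (fun x => F (T^[j] x)) μ :=
    fun j _ => (hT.iterate j).integrable_comp_of_integrable hF
  rw [integral_finsetSum _ hi]
  have : ∀ j, ∫ x, F (T^[j] x) ∂μ = ∫ x, F x ∂μ := fun j => by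
    have h := (hT.iterate j).map_eq
    conv_rhs => rw [← h]
    rw [integral_map (hT.iterate j).measurable.aemeasurable]
    rw [h]
    exact hF.aestronglyMeasurable
  simp [this]

lemma abs_eventEnt_timeBlock_one_sub_le {ν : Measure X} [IsProbabilityMeasure ν]
    {ξ : ℕ × ℕ → X → Prop} (hξ : ∀ p, Measurable (ξ p)) (k n : ℕ) :
    |eventEnt ν ξ (timeBlock k 1 (n + 1)) - eventEnt ν ξ (timeBlock k 0 n)| ≤ k * Real.log 2 := by
  have hcard : ∀ a, eventEnt ν ξ (timeBlock k a (a + 1)) ≤ k * Real.log 2 := fun a =>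
    (eventEnt_le_card hξ _).trans (by simp [timeBlock])
  have h1 : eventEnt ν ξ (timeBlock k 1 (n + 1)) ≤
      eventEnt ν ξ (timeBlock k 0 n) + eventEnt ν ξ (timeBlock k n (n + 1)) :=
    (eventEnt_mono hξ fun p hp => by
      simp only [Finset.mem_union, mem_timeBlock] at hp ⊢; omega).trans (eventEnt_union_le hξ _ _)
  have h2 : eventEnt ν ξ (timeBlock k 0 n) ≤
      eventEnt ν ξ (timeBlock k 1 (n + 1)) + eventEnt ν ξ (timeBlock k 0 (0 + 1)) :=
    (eventEnt_mono hξ fun p hp => by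
      simp only [Finset.mem_union, mem_timeBlock] at hp ⊢; omega).trans (eventEnt_union_le hξ _ _)
  rw [abs_le]
  constructor <;> linarith [hcard n, hcard 0]

end TailGrowth

section TailGrowth

variable {X : Type*} [MetricSpace X] [CompactSpace X] [MeasurableSpace X] [BorelSpace X]
  {μ : Measure X} [IsProbabilityMeasure μ] {T : X → X} {U : ℕ → Set X} {m : ℕ → ℕ}

lemma measurable_integral_tailKer (hT : Measurable T) (hU : ∀ i, MeasurableSet (U i))
    {g : X → ℝ} (hg : Measurable g) : Measurable fun x => ∫ y, g y ∂(tailKer μ T U m x) :=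
  (hg.stronglyMeasurable.integral_condExpKernel (μ := μ)
    (m := ⨅ j, tailAlg T U m j)).measurable.mono (iInf_tailAlg_le hT hU) le_rfl

lemma ae_rvEnt_tailKer_comp (hTs : Function.Surjective T) (hT : MeasurePreserving T μ μ)
    (hU : ∀ i, MeasurableSet (U i)) (S : Finset (ℕ × ℕ)) :
    ∀ᵐ x ∂μ, eventEnt (tailKer μ T U m (T x)) (visits T U) S =
      eventEnt (tailKer μ T U m x) (visits T U) (timeShift 1 S) := by
  have hv := measurable_visits hT.measurable hU
  have h : ∀ᵐ x ∂μ, ∀ w : S → Prop,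
      (tailKer μ T U m (T x)).real (jointEvents (visits T U) S ⁻¹' {w}) =
        (tailKer μ T U m x).real (T ⁻¹' (jointEvents (visits T U) S ⁻¹' {w})) :=
    ae_all_iff.2 fun w => tailKer_real_preimage hTs hT hU
      (measurable_jointEvents hv S (measurableSet_singleton w))
  filter_upwards [h] with x hx
  rw [eventEnt_timeShift hT.measurable hU, eventEnt, rvEnt, rvEnt]
  exact Finset.sum_congr rfl fun w _ => by rw [hx w]; rfl

lemma ae_frequently_lt_eventEnt_tailKer (hTs : Function.Surjective T) (hT : Ergodic T μ)
    (hU : ∀ i, MeasurableSet (U i)) {k : ℕ} {h : ℝ}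
    (hm : ∀ (n : ℕ) (S' : Finset (ℕ × ℕ)), (∀ p ∈ S', m p.1 + n ≤ p.2) →
      n * h ≤ eventEnt μ (visits T U) (timeBlock k 0 n ∪ S') - eventEnt μ (visits T U) S')
    {F : X → ℝ} (hF : Measurable F) {M : ℝ} (hM : ∀ x, |F x| ≤ M) {c : ℝ}
    (hc : c < h + ∫ x, F x ∂μ) :
    ∀ᵐ x ∂μ, ∃ᶠ n : ℕ in atTop, n * c < eventEnt (tailKer μ T U m x) (visits T U) (timeBlock k 0 n) +
      ∫ y, birk T F n y ∂(tailKer μ T U m x) := by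
  have hTm := hT.measurable
  have hv := measurable_visits hTm hU
  have hFi : ∀ (ν : Measure X) [IsProbabilityMeasure ν], Integrable F ν := fun ν _ =>
    Integrable.of_bound hF.aestronglyMeasurable M (Eventually.of_forall hM)
  have hbi : ∀ (n : ℕ) (ν : Measure X) [IsProbabilityMeasure ν], Integrable (birk T F n) ν :=
    fun n ν _ => Integrable.of_bound (measurable_birk hTm hF n).aestronglyMeasurable (n * M)
      (Eventually.of_forall fun x => (Real.norm_eq_abs _).trans_le (abs_birk_le hM n x))
  have hbint : ∀ (n : ℕ) (x : X), |∫ y, birk T F n y ∂(tailKer μ T U m x)| ≤ n * M := fun n x => by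
    have := norm_integral_le_of_norm_le_const (μ := tailKer μ T U m x)
      (f := birk T F n) (C := n * M)
      (Eventually.of_forall fun x => (Real.norm_eq_abs _).trans_le (abs_birk_le hM n x))
    simpa using this
  let A : ℕ → X → ℝ := fun n x => eventEnt (tailKer μ T U m x) (visits T U) (timeBlock k 0 n)
  let B : ℕ → X → ℝ := fun n x => ∫ y, birk T F n y ∂(tailKer μ T U m x)
  have hA : ∀ n, Measurable (A n) := fun n =>
    Finset.measurable_fun_sum _ fun w _ => Real.continuous_negMulLog.measurable.comp
      (measurable_tailKer_real hTm hU (measurable_jointEvents hv _ (measurableSet_singleton w)))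
  have hB : ∀ n, Measurable (B n) := fun n =>
    measurable_integral_tailKer hTm hU (measurable_birk hTm hF n)
  have hA0 : ∀ n x, 0 ≤ A n x := fun n x => eventEnt_nonneg _
  have hA1 : ∀ n x, A n x ≤ n * (k * Real.log 2) := fun n x =>
    (eventEnt_le_card hv _).trans (le_of_eq (by simp [timeBlock]; ring))
  have hlog : 0 ≤ k * Real.log 2 := by positivity
  have key := hT.ae_frequently_lt_of_lt_integral (g := fun n x => (A n x + B n x) / n)
    (M := k * Real.log 2 + M) (C := k * Real.log 2 + 2 * M) (c := h + ∫ x, F x ∂μ)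
    (fun n => ((hA n).add (hB n)).div_const _) ?_ ?_ ?_ c hc
  · filter_upwards [key] with x hx
    refine (hx.and_eventually (eventually_gt_atTop 0)).mono fun n hn => ?_
    have hn0 : (0 : ℝ) < n := by exact_mod_cast hn.2
    have := (lt_div_iff₀ hn0).1 hn.1
    rwa [mul_comm] at this
  · intro n x
    rcases Nat.eq_zero_or_pos n with rfl | hn
    · have := (abs_nonneg _).trans (hM x)
      simp only [Nat.cast_zero, div_zero, abs_zero]
      positivity
    · have hn0 : (0 : ℝ) < n := by exact_mod_cast hn
      rw [abs_div, Nat.abs_cast, div_le_iff₀ hn0, add_mul]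
      refine (abs_add_le _ _).trans (add_le_add ?_ ?_)
      · rw [abs_of_nonneg (hA0 n x), mul_comm]
        exact hA1 n x
      · rw [mul_comm]
        exact hbint n x
  · have h1 : ∀ᵐ x ∂μ, ∀ n, A n (T x) =
        eventEnt (tailKer μ T U m x) (visits T U) (timeBlock k 1 (n + 1)) := by
      refine ae_all_iff.2 fun n => ?_
      have := ae_rvEnt_tailKer_comp (m := m) hTs hT.toMeasurePreserving hU (timeBlock k 0 n)
      rwa [timeShift_timeBlock, zero_add] at this
    have h2 : ∀ᵐ x ∂μ, ∀ n, B n (T x) = ∫ y, birk T F n (T y) ∂(tailKer μ T U m x) :=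
      ae_all_iff.2 fun n => integral_tailKer_comp hTs hT.toMeasurePreserving hU (hbi n μ)
    filter_upwards [h1, h2] with x h1 h2 n
    rw [← sub_div, abs_div, Nat.abs_cast]
    refine div_le_div_of_nonneg_right ?_ (Nat.cast_nonneg n)
    have e : A n (T x) + B n (T x) - (A n x + B n x) =
        (A n (T x) - A n x) + (B n (T x) - B n x) := by ring
    rw [e]
    refine (abs_add_le _ _).trans (add_le_add ?_ ?_)
    · rw [h1 n]
      exact abs_eventEnt_timeBlock_one_sub_le hv k n
    · have hbT : Integrable (fun y => birk T F n (T y)) (tailKer μ T U m x) :=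
        Integrable.of_bound ((measurable_birk hTm hF n).comp hTm).aestronglyMeasurable (n * M)
          (Eventually.of_forall fun y => (Real.norm_eq_abs _).trans_le (abs_birk_le hM n (T y)))
      rw [h2 n, ← integral_sub hbT (hbi n _)]
      have := norm_integral_le_of_norm_le_const (μ := tailKer μ T U m x)
        (f := fun y => birk T F n (T y) - birk T F n y) (C := 2 * M)
        (Eventually.of_forall fun y => by
          rw [birk_comp_sub, Real.norm_eq_abs, two_mul]
          exact (abs_sub _ _).trans (add_le_add (hM _) (hM _)))
      simpa using this
  · intro n hn
    have hn0 : (0 : ℝ) < n := by exact_mod_cast hn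
    have hAi : Integrable (A n) μ := Integrable.of_bound (hA n).aestronglyMeasurable
      (n * (k * Real.log 2)) (Eventually.of_forall fun x => by
        rw [Real.norm_of_nonneg (hA0 n x)]; exact hA1 n x)
    have hBi : Integrable (B n) μ := Integrable.of_bound (hB n).aestronglyMeasurable
      (n * M) (Eventually.of_forall fun x => (Real.norm_eq_abs _).trans_le (hbint n x))
    have hBeq : ∫ x, B n x ∂μ = n * ∫ x, F x ∂μ := by
      rw [← integral_birk hT.toMeasurePreserving (hFi μ) n,
        ← integral_condExp (iInf_tailAlg_le (T := T) (U := U) (m := m) hTm hU) (f := birk T F n)]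
      exact integral_congr_ae (integral_tailKer_ae_eq hTm hU (hbi n μ))
    rw [integral_div, integral_add hAi hBi, hBeq, le_div_iff₀ hn0, add_mul,
      mul_comm (∫ x, F x ∂μ), mul_comm h]
    exact add_le_add_left (le_integral_eventEnt_tailKer hTm hU (hm n)) _

end TailGrowth

section TailPressure

lemma exists_pos_forall_lt_dist {X W : Type*} [PseudoMetricSpace X] [Finite W] {K : W → Set X}
    (hK : ∀ w, IsCompact (K w)) (hKc : ∀ w, IsClosed (K w))
    (hd : ∀ w w', w ≠ w' → Disjoint (K w) (K w')) :
    ∃ δ : ℝ, 0 < δ ∧ ∀ w w', w ≠ w' → ∀ x ∈ K w, ∀ y ∈ K w', δ ≤ dist x y := by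
  have h : ∀ w w', ∃ δ : ℝ, 0 < δ ∧ (w ≠ w' → ∀ x ∈ K w, ∀ y ∈ K w', δ ≤ dist x y) := by
    intro w w'
    by_cases hw : w = w'
    · exact ⟨1, one_pos, fun h => absurd hw h⟩
    · obtain ⟨δ, hδ, hdis⟩ := (hd w w' hw).exists_thickenings (hK w) (hKc w')
      refine ⟨δ, hδ, fun _ x hx y hy => not_lt.1 fun hlt => ?_⟩
      exact Set.disjoint_left.1 hdis (Metric.self_subset_thickening hδ _ hx)
        (Metric.mem_thickening_iff.2 ⟨y, hy, hlt⟩)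
  choose δ hδ hδK using h
  have : ∀ᶠ r in 𝓝[>] (0 : ℝ), ∀ w w', r ≤ δ w w' := by
    simp only [Filter.eventually_all]
    exact fun w w' => nhdsWithin_le_nhds (Iic_mem_nhds (hδ w w'))
  obtain ⟨r, h1, h2⟩ := (this.and self_mem_nhdsWithin).exists
  exact ⟨r, h2, fun w w' hw x hx y hy => (h1 w w').trans (hδK w w' hw x hx y hy)⟩

lemma rvEnt_eq_zero_of_subsingleton {X W : Type*} [MeasurableSpace X] [Fintype W]
    [MeasurableSpace W] [MeasurableSingletonClass W] {ν : Measure X} [IsProbabilityMeasure ν]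
    {A : Set X} (hA : ν Aᶜ = 0) (hs : A.Subsingleton) {Y : X → W} (hY : Measurable Y) :
    rvEnt ν Y = 0 := by
  refine Finset.sum_eq_zero fun w _ => ?_
  rcases (A ∩ Y ⁻¹' {w}).eq_empty_or_nonempty with h | ⟨z, hzA, hz⟩
  · have : ν (Y ⁻¹' {w}) = 0 := measure_mono_null (fun y hy hyA =>
      (Set.eq_empty_iff_forall_notMem.1 h y ⟨hyA, hy⟩)) hA
    simp [measureReal_def, this]
  · have hsub : (Y ⁻¹' {w})ᶜ ⊆ Aᶜ := fun y hy hyA => hy (by rw [hs hyA hzA]; exact hz)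
    have : ν (Y ⁻¹' {w})ᶜ = 0 := measure_mono_null hsub hA
    rw [prob_compl_eq_zero_iff (hY (measurableSet_singleton w))] at this
    simp [measureReal_def, this]

lemma exists_isCompact_fibers {X W : Type*} [MetricSpace X] [MeasurableSpace X] [BorelSpace X]
    {μ : Measure X} [IsProbabilityMeasure μ] [Fintype W] [MeasurableSpace W]
    [MeasurableSingletonClass W] [μ.InnerRegularCompactLTTop] {a : X → W} (ha : Measurable a)
    {η : ℝ} (hη : 0 < η) :
    ∃ K : W → Set X, (∀ w, IsCompact (K w)) ∧ (∀ w, ∀ x ∈ K w, a x = w) ∧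
      μ.real (⋃ w, K w)ᶜ ≤ η := by
  have hη' : 0 < η / (Fintype.card W + 1) := by positivity
  have h : ∀ w, ∃ K ⊆ a ⁻¹' {w}, IsCompact K ∧
      μ (a ⁻¹' {w} \ K) < ENNReal.ofReal (η / (Fintype.card W + 1)) := fun w =>
    (ha (measurableSet_singleton w)).exists_isCompact_sdiff_lt (measure_ne_top _ _)
      (ENNReal.ofReal_pos.2 hη').ne'
  choose K hKs hK hKμ using h
  refine ⟨K, hK, fun w x hx => hKs w hx, ?_⟩
  calc μ.real (⋃ w, K w)ᶜ ≤ μ.real (⋃ w, (a ⁻¹' {w} \ K w)) :=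
        measureReal_mono (fun x hx => mem_iUnion.2 ⟨a x, rfl, fun h => hx (mem_iUnion.2 ⟨_, h⟩)⟩)
    _ ≤ ∑ w, μ.real (a ⁻¹' {w} \ K w) := measureReal_iUnion_fintype_le _
    _ ≤ ∑ w : W, η / (Fintype.card W + 1) := Finset.sum_le_sum fun w _ =>
        ENNReal.toReal_le_of_le_ofReal hη'.le (hKμ w).le
    _ ≤ η := by
        rw [Finset.sum_const, Finset.card_univ, nsmul_eq_mul, mul_div_assoc', div_le_iff₀ (by positivity)]
        nlinarith

lemma eventEnt_visits_timeBlock_le {X : Type*} [MeasurableSpace X] {T : X → X} {U : ℕ → Set X}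
    (hT : Measurable T) (hU : ∀ i, MeasurableSet (U i))
    (ν : Measure X) [IsProbabilityMeasure ν] (k n : ℕ) :
    eventEnt ν (visits T U) (timeBlock k 0 n) ≤
      rvEnt ν fun x (i : Fin n) => jointEvents (visits T U) (timeBlock k 0 1) (T^[i] x) := by
  have hv := measurable_visits hT hU
  have hp : ∀ p : timeBlock k 0 n, (p.1.1, 0) ∈ timeBlock k 0 1 ∧ p.1.2 < n := fun p => by
    have := mem_timeBlock.1 p.2
    rw [mem_timeBlock]
    omega
  have hZ : Measurable fun x (i : Fin n) =>
      jointEvents (visits T U) (timeBlock k 0 1) (T^[i] x) :=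
    measurable_pi_iff.2 fun i => (measurable_jointEvents hv _).comp (hT.iterate i)
  refine rvEnt_le_of_factors hZ (fun (w : Fin n → timeBlock k 0 1 → Prop) p =>
    w ⟨p.1.2, (hp p).2⟩ ⟨(p.1.1, 0), (hp p).1⟩) fun x => ?_
  funext p
  simp only [jointEvents, visits, Function.iterate_zero, id]

variable {X : Type*} [MetricSpace X] [CompactSpace X] [MeasurableSpace X] [BorelSpace X]
  {μ : Measure X} [IsProbabilityMeasure μ] {T : X → X} {U : ℕ → Set X} {m : ℕ → ℕ}

lemma ae_le_pres (hTs : Function.Surjective T) (hTc : Continuous T) (hT : Ergodic T μ)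
    (hU : ∀ i, MeasurableSet (U i)) {k : ℕ} {h : ℝ}
    (hm : ∀ (n : ℕ) (S' : Finset (ℕ × ℕ)), (∀ p ∈ S', m p.1 + n ≤ p.2) →
      n * h ≤ eventEnt μ (visits T U) (timeBlock k 0 n ∪ S') - eventEnt μ (visits T U) S')
    {f : X → ℝ} (hf : Continuous f) {c : ℝ} (hc : c < h + ∫ x, f x ∂μ) :
    ∀ᵐ x ∂μ, (c : EReal) ≤ pres T f (suppSet U (tailKer μ T U m x)) := by
  have hTm := hT.measurable
  have hv := measurable_visits hTm hU
  set η := (h + ∫ x, f x ∂μ - c) / 6 with hη_def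
  have hη : 0 < η := by rw [hη_def]; linarith
  have ha := measurable_jointEvents hv (timeBlock k 0 1)
  set a := jointEvents (visits T U) (timeBlock k 0 1)
  obtain ⟨s, hs, hs0⟩ : ∃ s : ℝ,
      Real.log (1 + Fintype.card (timeBlock k 0 1 → Prop) * Real.exp (-s)) ≤ η ∧ 0 < s := by
    have h1 : Tendsto (fun s : ℝ => Real.log
        (1 + Fintype.card (timeBlock k 0 1 → Prop) * Real.exp (-s))) atTop (𝓝 0) := by
      have h2 : Tendsto (fun s : ℝ => 1 + Fintype.card (timeBlock k 0 1 → Prop) * Real.exp (-s))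
          atTop (𝓝 1) := by
        simpa using (Real.tendsto_exp_neg_atTop_nhds_zero.const_mul
          (Fintype.card (timeBlock k 0 1 → Prop) : ℝ)).const_add 1
      simpa using h2.log one_ne_zero
    exact ((h1.eventually (Iic_mem_nhds hη)).and (eventually_gt_atTop 0)).exists
  obtain ⟨K, hK, hKa, hKμ⟩ := exists_isCompact_fibers (μ := μ) ha (div_pos hη hs0)
  have hKc : ∀ w, IsClosed (K w) := fun w => (hK w).isClosed
  obtain ⟨r, hr, hrK⟩ := exists_pos_forall_lt_dist hK hKc fun w w' hw =>
    Set.disjoint_left.2 fun x hx hx' => hw ((hKa w x hx).symm.trans (hKa w' x hx'))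
  obtain ⟨r', hr', hrf⟩ := Metric.uniformContinuous_iff.1
    (CompactSpace.uniformContinuous_of_continuous hf) η hη
  set δ := min (r / 3) (r' / 2)
  have hδ : 0 < δ := lt_min (by linarith) (by linarith)
  have hfδ : ∀ x y, dist x y ≤ δ → |f x - f y| ≤ η := fun x y hxy =>
    (hrf (hxy.trans_lt ((min_le_right _ _).trans_lt (by linarith)))).le
  have hKδ : ∀ w w', w ≠ w' → ∀ x ∈ K w, ∀ y ∈ K w', 2 * δ < dist x y := fun w w' hw x hx y hy => by
    have := hrK w w' hw x hx y hy
    have : δ ≤ r / 3 := min_le_left _ _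
    linarith
  have hKm : MeasurableSet (⋃ w, K w)ᶜ := (MeasurableSet.iUnion fun w => (hKc w).measurableSet).compl
  let F : X → ℝ := fun x => f x - s * (⋃ w, K w)ᶜ.indicator 1 x
  have hind : Measurable ((⋃ w, K w)ᶜ.indicator (1 : X → ℝ)) := measurable_one.indicator hKm
  have hF : Measurable F := hf.measurable.sub (hind.const_mul s)
  obtain ⟨M, hM⟩ := (isCompact_univ (X := X)).exists_bound_of_continuousOn hf.continuousOn
  have hFM : ∀ x, |F x| ≤ M + s := fun x => by
    refine (abs_sub _ _).trans (add_le_add (hM x trivial) ?_)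
    by_cases hx : x ∈ (⋃ w, K w)ᶜ
    · rw [indicator_of_mem hx]; simp [abs_of_pos hs0]
    · rw [indicator_of_notMem hx]; simp [hs0.le]
  have hfi : Integrable f μ := Integrable.of_bound hf.measurable.aestronglyMeasurable M
    (Eventually.of_forall fun x => hM x trivial)
  have hFint : h + ∫ x, f x ∂μ - η ≤ h + ∫ x, F x ∂μ := by
    have h1 : ∫ x, F x ∂μ = ∫ x, f x ∂μ - s * μ.real (⋃ w, K w)ᶜ := by
      have h2 : Integrable ((⋃ w, K w)ᶜ.indicator (1 : X → ℝ)) μ :=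
        (integrable_const (1 : ℝ)).indicator hKm
      rw [integral_sub hfi (h2.const_mul s), integral_const_mul, integral_indicator_one hKm]
    have h3 := mul_le_mul_of_nonneg_left hKμ hs0.le
    rw [mul_div_cancel₀ _ hs0.ne'] at h3
    rw [h1]
    linarith
  have hc' : c + 3 * η < h + ∫ x, F x ∂μ := by
    have : h + ∫ x, f x ∂μ = c + 6 * η := by rw [hη_def]; ring
    linarith
  filter_upwards [ae_frequently_lt_eventEnt_tailKer hTs hT hU hm hF hFM hc'] with x hx
  refine le_iSup₂_of_le δ hδ (le_limsup_of_frequently_le ?_)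
  refine (hx.and_eventually (eventually_gt_atTop 0)).mono fun n hn => ?_
  obtain ⟨hn, hn0⟩ := hn
  have hn0' : (0 : ℝ) < n := by exact_mod_cast hn0
  rw [EReal.coe_le_coe_iff, le_div_iff₀ hn0']
  have h1 := eventEnt_visits_timeBlock_le hTm hU (tailKer μ T U m x) k n
  have h2 := rvEnt_add_integral_birk_le hTc hf (measure_compl_suppSet U (tailKer μ T U m x))
    ha (fun w => (hKc w).measurableSet) hKa (s := s) hδ hKδ hfδ n
  have h3 := mul_le_mul_of_nonneg_left hs hn0'.le
  simp only [F] at hn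
  nlinarith

lemma ae_nontrivial_suppSet_tailKer (hTs : Function.Surjective T) (hT : Ergodic T μ)
    (hU : ∀ i, MeasurableSet (U i)) {k : ℕ} {h : ℝ}
    (hm : ∀ (n : ℕ) (S' : Finset (ℕ × ℕ)), (∀ p ∈ S', m p.1 + n ≤ p.2) →
      n * h ≤ eventEnt μ (visits T U) (timeBlock k 0 n ∪ S') - eventEnt μ (visits T U) S')
    (hh : 0 < h) : ∀ᵐ x ∂μ, (suppSet U (tailKer μ T U m x)).Nontrivial := by
  have hv := measurable_visits hT.measurable hU
  have := ae_frequently_lt_eventEnt_tailKer (m := m) hTs hT hU hm (F := fun _ => 0) (M := 0) (c := 0)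
    measurable_const (by simp) (by simpa using hh)
  filter_upwards [this] with x hx
  by_contra hnt
  obtain ⟨n, hn⟩ := hx.exists
  rw [eventEnt, rvEnt_eq_zero_of_subsingleton (measure_compl_suppSet U (tailKer μ T U m x))
    (Set.not_nontrivial_iff.1 hnt) (measurable_jointEvents hv _)] at hn
  simp [birk] at hn

end TailPressure

section RowExtension

lemma IsShiftPolymatroid.sub_le_mul {H : Finset (ℕ × ℕ) → ℝ} (hH : IsShiftPolymatroid H)
    {R R' : Finset ℕ} (hR : R ⊆ R') (n : ℕ) :
    H (R' ×ˢ Finset.Ico 0 n) - H (R ×ˢ Finset.Ico 0 n) ≤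
      n * (H (R' ×ˢ Finset.Ico 0 1) - H (R ×ˢ Finset.Ico 0 1)) := by
  induction n with
  | zero => simp
  | succ n ih =>
    have hs : ∀ R : Finset ℕ, H (R ×ˢ Finset.Ico n (n + 1)) = H (R ×ˢ Finset.Ico 0 1) := by
      intro R
      rw [← hH.shift n (R ×ˢ Finset.Ico 0 1)]
      congr 1
      ext p
      simp only [mem_timeShift, Finset.mem_product, Finset.mem_Ico]
      grind
    have h1 := hH.submod (R' ×ˢ Finset.Ico 0 n) (R ×ˢ Finset.Ico 0 (n + 1))
    have h2 := hH.submod (R' ×ˢ Finset.Ico n (n + 1))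
      (R' ×ˢ Finset.Ico 0 n ∪ R ×ˢ Finset.Ico 0 (n + 1))
    have e1 : R' ×ˢ Finset.Ico 0 n ∩ R ×ˢ Finset.Ico 0 (n + 1) = R ×ˢ Finset.Ico 0 n := by
      ext p
      have := @hR p.1
      simp only [Finset.mem_inter, Finset.mem_product, Finset.mem_Ico]
      grind
    have e2 : R' ×ˢ Finset.Ico n (n + 1) ∪
        (R' ×ˢ Finset.Ico 0 n ∪ R ×ˢ Finset.Ico 0 (n + 1)) = R' ×ˢ Finset.Ico 0 (n + 1) := by
      ext p
      have := @hR p.1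
      simp only [Finset.mem_union, Finset.mem_product, Finset.mem_Ico]
      grind
    have e3 : R' ×ˢ Finset.Ico n (n + 1) ∩
        (R' ×ˢ Finset.Ico 0 n ∪ R ×ˢ Finset.Ico 0 (n + 1)) = R ×ˢ Finset.Ico n (n + 1) := by
      ext p
      have := @hR p.1
      simp only [Finset.mem_inter, Finset.mem_union, Finset.mem_product, Finset.mem_Ico]
      grind
    rw [e1] at h1
    rw [e2, e3, hs, hs] at h2
    push_cast
    linarith

end RowExtension

section PartitionEntropy

variable {X : Type*} [MeasurableSpace X] {μ : Measure X} [IsProbabilityMeasure μ]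

lemma condEnt_self {ι : Type*} [Fintype ι] [MeasurableSpace ι] [MeasurableSingletonClass ι]
    {Y : X → ι} (hY : Measurable Y) : condEnt μ ‹MeasurableSpace X› Y = 0 := by
  refine Finset.sum_eq_zero fun i _ => ?_
  have hi := hY (measurableSet_singleton i)
  have h : cprob μ ‹MeasurableSpace X› (Y ⁻¹' {i}) = (Y ⁻¹' {i}).indicator fun _ => (1 : ℝ) :=
    condExp_of_stronglyMeasurable le_rfl (stronglyMeasurable_const.indicator hi)
      (integrable_indicator_one hi)
  rw [h]
  refine integral_eq_zero_of_ae (Eventually.of_forall fun x => ?_)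
  by_cases hx : x ∈ Y ⁻¹' {i}
  · simp [indicator_of_mem hx]
  · simp [indicator_of_notMem hx]

lemma rvEnt_le_of_factorsThrough {ι κ : Type*} [Fintype ι] [MeasurableSpace ι]
    [MeasurableSingletonClass ι] [Fintype κ] [MeasurableSpace κ] [MeasurableSingletonClass κ]
    {Z : X → ι} (hZ : Measurable Z) {Y : X → κ} (h : Y.FactorsThrough Z) :
    rvEnt μ Y ≤ rvEnt μ Z := by
  obtain ⟨x⟩ := nonempty_of_isProbabilityMeasure μ
  exact rvEnt_le_of_factors hZ (Function.extend Z Y fun _ => Y x)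
    fun x => (h.extend_apply _ x).symm

/-- Prepending the first `N` sets of `A` to the sequence `U`. -/
def prependSets (N : ℕ) (A U : ℕ → Set X) (i : ℕ) : Set X := if i < N then A i else U (i - N)

variable {T : X → X} {U A : ℕ → Set X}

lemma eventEnt_prependSets_le (hT : Measurable T) (hU : ∀ i, MeasurableSet (U i)) (N k n : ℕ) :
    eventEnt μ (visits T (prependSets N A U)) (Finset.Ico N (N + k) ×ˢ Finset.Ico 0 n) ≤
      eventEnt μ (visits T U) (timeBlock k 0 n) := by
  refine rvEnt_le_of_factorsThrough (measurable_jointEvents (measurable_visits hT hU) _)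
    fun x y hxy => funext fun p => ?_
  have hp := p.2
  simp only [Finset.mem_product, Finset.mem_Ico] at hp
  have := congrFun hxy ⟨(p.1.1 - N, p.1.2), mem_timeBlock.2 (by simp only; omega)⟩
  simpa only [jointEvents, visits, prependSets, if_neg (not_lt.2 hp.1.1)] using this

lemma dynH_le_eventEnt (hT : Measurable T) (hA : ∀ i, MeasurableSet (A i)) {N : ℕ}
    {α : Finset (Set X)} (hα : IsFinPartition α) (e : Fin N ≃ α) (he : ∀ i : Fin N, A i = e i) (n : ℕ) :
    dynH μ T α n ≤ eventEnt μ (visits T A) (timeBlock N 0 n) := by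
  have hex : ∀ x, ∃ i : Fin N, x ∈ A i := fun x => by
    have : x ∈ ⋃₀ (α : Set (Set X)) := hα.2.1 ▸ mem_univ x
    obtain ⟨a, ha, hx⟩ := this
    exact ⟨e.symm ⟨a, ha⟩, by rw [he]; simpa using hx⟩
  have huniq : ∀ x (i j : Fin N), x ∈ A i → x ∈ A j → i = j := fun x i j hi hj => by
    by_contra hij
    have : (e i : Set X) ≠ e j := fun h => hij (e.injective (Subtype.ext h))
    rw [he] at hi hj
    exact Set.disjoint_left.1 (hα.2.2 (e i).2 (e j).2 this) hi hj
  choose b hb using hex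
  have hb' : ∀ x i, b x = i ↔ x ∈ A i := fun x i =>
    ⟨fun h => h ▸ hb x, fun h => huniq x _ _ (hb x) h⟩
  have h1 : dynH μ T α n = rvEnt μ fun x (i : Fin n) => b (T^[i] x) := by
    rw [dynH, rvEnt, ← (Equiv.piCongrRight fun _ : Fin n => e).sum_comp]
    refine Finset.sum_congr rfl fun g _ => ?_
    rw [measureReal_def]
    congr 3
    ext x
    simp only [mem_iInter, mem_preimage, mem_singleton_iff, funext_iff, hb', he]
    rfl
  rw [h1]
  refine rvEnt_le_of_factorsThrough (measurable_jointEvents (measurable_visits hT hA) _)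
    fun x y hxy => funext fun i => ?_
  have := congrFun hxy ⟨((b (T^[i] y) : ℕ), (i : ℕ)), mem_timeBlock.2 (by simp)⟩
  simp only [jointEvents, visits] at this
  exact (hb' _ _).2 (this ▸ hb _)

lemma eventually_entPart_le_polyRate (hT : MeasurePreserving T μ μ)
    (hU : ∀ i, MeasurableSet (U i))
    (hgen : MeasurableSpace.generateFrom (range U) = ‹MeasurableSpace X›)
    {α : Finset (Set X)} (hα : IsFinPartition α) {η : ℝ} (hη : 0 < η) :
    ∀ᶠ k in atTop, entPart μ T α ≤ polyRate (eventEnt μ (visits T U)) k + η := by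
  set N := α.card
  let e : Fin N ≃ α := α.equivFin.symm
  let A : ℕ → Set X := fun i => if h : i < N then e ⟨i, h⟩ else ∅
  have hA : ∀ i, MeasurableSet (A i) := fun i => by
    by_cases h : i < N
    · simp only [A, dif_pos h]; exact hα.1 _ (e ⟨i, h⟩).2
    · simp only [A, dif_neg h]; exact MeasurableSet.empty
  set V := prependSets N A U
  have hVA : ∀ i < N, V i = A i := fun i hi => if_pos hi
  have hVU : ∀ i, V (N + i) = U i := fun i => by
    change ite _ _ _ = _
    rw [if_neg (by omega), Nat.add_sub_cancel_left]
  have hV : ∀ i, MeasurableSet (V i) := fun i => by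
    change MeasurableSet (ite _ _ _)
    split_ifs
    exacts [hA i, hU _]
  have hTm := hT.measurable
  have hv := measurable_visits hTm hV
  have hP := isShiftPolymatroid_eventEnt_visits (μ := μ) hT hV
  let S : ℕ → Finset (ℕ × ℕ) := fun k => Finset.Ico N (N + k) ×ˢ Finset.Ico 0 1
  have hS : Monotone S := fun a b hab p hp => by
    simp only [S, Finset.mem_product, Finset.mem_Ico] at hp ⊢
    omega
  have hsup : ⨆ k, MeasurableSpace.comap (jointEvents (visits T V) (S k)) inferInstance =
      ‹MeasurableSpace X› := by
    rw [iSup_comap_jointEvents, ← hgen]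
    congr 1
    ext s
    constructor
    · rintro ⟨k, p, hp, rfl⟩
      simp only [S, Finset.mem_product, Finset.mem_Ico] at hp
      refine ⟨p.1 - N, ?_⟩
      rw [← hVU, Nat.add_sub_cancel' hp.1.1]
      have : p.2 = 0 := by omega
      ext x
      simp [visits, this]
    · rintro ⟨i, rfl⟩
      refine ⟨i + 1, (N + i, 0), by simp [S], ?_⟩
      ext x
      simp [visits, hVU]
  have hlim := tendsto_condEnt_iSup (μ := μ) (monotone_comap_jointEvents (visits T V) hS)
    (fun k => (measurable_jointEvents hv (S k)).comap_le)
    (measurable_jointEvents hv (timeBlock N 0 1))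
  rw [hsup, condEnt_self (measurable_jointEvents hv _)] at hlim
  filter_upwards [hlim.eventually (Iic_mem_nhds hη)] with k hk
  have hc := (eventEnt_union_sub_le_condEnt hv (timeBlock N 0 1) (S k)).trans hk
  rw [← sub_le_iff_le_add]
  refine le_ciInf fun n => ?_
  have hn : (0 : ℝ) < n + 1 := by positivity
  have h1 : entPart μ T α ≤ dynH μ T α (n + 1) / (n + 1) :=
    ciInf_le ⟨0, by
      rintro _ ⟨n, rfl⟩
      refine div_nonneg (Finset.sum_nonneg fun g _ => Real.negMulLog_nonneg ENNReal.toReal_nonneg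
        measureReal_le_one) (by positivity)⟩ n
  rw [le_div_iff₀ hn] at h1 ⊢
  have h2 := dynH_le_eventEnt (μ := μ) hTm hV hα e
    (fun i => by rw [hVA i i.2]; simp [A]) (n + 1)
  have h3 := eventEnt_prependSets_le (μ := μ) (A := A) hTm hU N k (n + 1)
  have h4 := hP.sub_le_mul (R := Finset.Ico N (N + k)) (R' := Finset.range N ∪ Finset.Ico N (N + k))
    Finset.subset_union_right (n + 1)
  have h5 : timeBlock N 0 1 ∪ S k = (Finset.range N ∪ Finset.Ico N (N + k)) ×ˢ Finset.Ico 0 1 := by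
    rw [Finset.union_product]; rfl
  have h6 : eventEnt μ (visits T V) (timeBlock N 0 (n + 1)) ≤ eventEnt μ (visits T V)
      ((Finset.range N ∪ Finset.Ico N (N + k)) ×ˢ Finset.Ico 0 (n + 1)) :=
    eventEnt_mono hv (Finset.product_subset_product_left Finset.subset_union_left)
  rw [h5] at hc
  have h7 := mul_le_mul_of_nonneg_left hc hn.le
  push_cast at h4
  have h8 : (entPart μ T α - η) * (n + 1) = entPart μ T α * (n + 1) - (n + 1) * η := by ring
  rw [h8]
  linarith

end PartitionEntropy

/-- For a surjective continuous (non-invertible) `T` on a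
compact metric space, `f ∈ C(X,ℝ)` and an ergodic `T`-invariant Borel
probability measure `μ` with `h_μ(T) > 0`: for `μ`-a.e. `x` there is a closed
`E(x) ⊆ cl(W^s(x,T))` with `P(T,f,E(x)) ≥ P_μ(T,f)` which is weakly mixing
for `T`. -/
theorem stmt19 [MetricSpace X] [CompactSpace X] [MeasurableSpace X] [BorelSpace X]
    (T : X → X) (hT : Continuous T) (hTs : Function.Surjective T) (f : C(X, ℝ))
    (μ : Measure X) [IsProbabilityMeasure μ]
    (herg : Ergodic T μ) (hpos : 0 < mEnt μ T) :
    ∀ᵐ x ∂μ, ∃ E : Set X, IsClosed E ∧ E ⊆ closure (stableSet T x) ∧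
      mPres μ T ⇑f ≤ pres T ⇑f E ∧ IsWeaklyMixingSet T E := by
  have hne : Nonempty X := nonempty_of_isProbabilityMeasure μ
  obtain ⟨b, hbc, -, hb⟩ := TopologicalSpace.exists_countable_basis X
  have hbne : b.Nonempty := by
    obtain ⟨v, hv, -⟩ := hb.exists_subset_of_mem_open (mem_univ hne.some) isOpen_univ
    exact ⟨v, hv⟩
  obtain ⟨U, rfl⟩ := hbc.exists_eq_range hbne
  have hUo : ∀ i, IsOpen (U i) := fun i => hb.isOpen ⟨i, rfl⟩
  have hU : ∀ i, MeasurableSet (U i) := fun i => (hUo i).measurableSet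
  have hgen : MeasurableSpace.generateFrom (range U) = ‹MeasurableSpace X› := by
    rw [← hb.borel_eq_generateFrom, ← BorelSpace.measurable_eq]
  have hT' := herg.toMeasurePreserving
  obtain ⟨m, hm⟩ := (isShiftPolymatroid_eventEnt_visits (μ := μ) hT' hU).exists_staircase
  set h : ℕ → ℝ := fun k => polyRate (eventEnt μ (visits T U)) k - 2 * (1 / 2 : ℝ) ^ k
  have hent : ∀ (α : Finset (Set X)), IsFinPartition α → ∀ c < entPart μ T α,
      ∃ k, c < h k := by
    intro α hα c hc
    have h1 := eventually_entPart_le_polyRate hT' hU hgen hα (half_pos (sub_pos.2 hc))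
    have h2 : Tendsto (fun k : ℕ => 2 * (1 / 2 : ℝ) ^ k) atTop (𝓝 0) := by
      simpa using (tendsto_pow_atTop_nhds_zero_of_lt_one (r := (1 / 2 : ℝ))
        (by norm_num) (by norm_num)).const_mul 2
    obtain ⟨k, hk1, hk2⟩ := (h1.and (h2.eventually_lt_const (half_pos (sub_pos.2 hc)))).exists
    exact ⟨k, by simp only [h]; linarith⟩
  obtain ⟨k₀, hk₀⟩ : ∃ k, 0 < h k := by
    obtain ⟨α, hα⟩ := lt_iSup_iff.1 hpos
    obtain ⟨hα, hlt⟩ := lt_iSup_iff.1 hα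
    exact hent α hα 0 (by exact_mod_cast hlt)
  have hpres : ∀ᵐ x ∂μ, ∀ (k : ℕ) (q : ℚ), (q : ℝ) < h k + ∫ x, f x ∂μ →
      ((q : ℝ) : EReal) ≤ pres T f (suppSet U (tailKer μ T U m x)) := by
    refine ae_all_iff.2 fun k => ae_all_iff.2 fun q => ?_
    by_cases hq : (q : ℝ) < h k + ∫ x, f x ∂μ
    · filter_upwards [ae_le_pres hTs hT herg hU (hm k) f.continuous hq] with x hx _ using hx
    · exact Eventually.of_forall fun x hq' => absurd hq' hq
  filter_upwards [hpres, ae_nontrivial_suppSet_tailKer hTs herg hU (hm k₀) hk₀,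
    ae_hasMixingTimes (m := m) hTs herg hU,
    suppSet_tailKer_subset (m := m) (μ := μ) herg.measurable hb] with x hx hnt hmix hsub
  have hclosed := isClosed_suppSet hUo (tailKer μ T U m x)
  refine ⟨_, hclosed, hsub, ?_, hmix.isWeaklyMixingSet hT hb hclosed.isCompact hnt⟩
  rw [mPres, ← EReal.le_sub_iff_add_le (Or.inl (EReal.coe_ne_bot _)) (Or.inl (EReal.coe_ne_top _))]
  refine iSup₂_le fun α hα => ?_
  rw [EReal.le_sub_iff_add_le (Or.inl (EReal.coe_ne_bot _)) (Or.inl (EReal.coe_ne_top _)),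
    ← EReal.coe_add]
  by_contra hlt
  obtain ⟨q, hq1, hq2⟩ := EReal.lt_iff_exists_rat_btwn.1 (not_le.1 hlt)
  have hq : (q : ℝ) < entPart μ T α + ∫ x, f x ∂μ := by exact_mod_cast hq2
  obtain ⟨k, hk⟩ := hent α hα (q - ∫ x, f x ∂μ) (by linarith)
  exact absurd (hx k q (by linarith)) (not_le.2 hq1)
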